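/- arXiv:1605.09335 — 4 statements merged into one kernel-verified Lean document; each statement's English description precedes it below -/
import Mathlib

section
/- Fix γ > −1/2 and τ ∈ ℝ, and let μ̃ be the Hua–Pickrell measure. Then there is a continuous function G : ℂ → (0,∞) such that lim_{n→∞} n^{2γ+1}·λ_n(e^{ia/n}; μ̃) = G(a), and the convergence is uniform for a in compact subsets of ℂ. -/
open MeasureTheory Filter Set Topology ComplexConjugate

noncomputable section

/-- Rising factorial (Pochhammer symbol) `(v)_k`. -/
def risingFac (v : ℂ) (k : ℕ) : ℂ := (ascPochhammer ℂ k).eval v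

/-- Real rising factorial. -/
def risingFacR (v : ℝ) (k : ℕ) : ℝ := (ascPochhammer ℝ k).eval v

/-- The confluent hypergeometric function `₁F₁(a;b;z)`. -/
def oneF1 (a b z : ℂ) : ℂ :=
  ∑' k : ℕ, risingFac a k / risingFac b k * z ^ k / (Nat.factorial k : ℂ)

/-- The terminating Gauss hypergeometric sum `₂F₁(-m, c; d; x)`. -/
def twoF1t (m : ℕ) (c d x : ℂ) : ℂ :=
  ∑ k ∈ Finset.range (m + 1), (m.choose k : ℂ) * (risingFac c k / risingFac d k) * (-x) ^ k

/-- Real version of the terminating Gauss hypergeometric sum. -/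
def twoF1tR (m : ℕ) (c d x : ℝ) : ℝ :=
  ∑ k ∈ Finset.range (m + 1), (m.choose k : ℝ) * (risingFacR c k / risingFacR d k) * (-x) ^ k

/-- The polynomial reproducing kernel built from a family of polynomials. -/
def repKernel (φ : ℕ → Polynomial ℂ) (n : ℕ) (z w : ℂ) : ℂ :=
  ∑ j ∈ Finset.range (n + 1), (φ j).eval z * conj ((φ j).eval w)

/-- `φ` is the family of orthonormal polynomials of `μ`, with (positive real) leading
coefficients `κ`. -/
structure IsOrthonormalPolys (μ : Measure ℂ) (φ : ℕ → Polynomial ℂ) (κ : ℕ → ℝ) : Prop where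
  natDegree_eq : ∀ n, (φ n).natDegree = n
  lead_pos : ∀ n, 0 < κ n
  lead_eq : ∀ n, (φ n).leadingCoeff = (κ n : ℂ)
  orthonormal : ∀ m n, ∫ z, (φ m).eval z * conj ((φ n).eval z) ∂μ = if m = n then 1 else 0

/-- The (closed) support of a measure on `ℂ`. -/
def msupport (μ : Measure ℂ) : Set ℂ := {z | ∀ U : Set ℂ, IsOpen U → z ∈ U → 0 < μ U}

/-- Logarithmic capacity of a compact set, defined via the transfinite diameter. -/
def capacity (K : Set ℂ) : ℝ :=
  ⨅ n : ℕ, ⨆ f : {f : Fin (n + 2) → ℂ // ∀ i, f i ∈ K},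
    (∏ p ∈ Finset.univ.filter (fun p : Fin (n + 2) × Fin (n + 2) => p.1 < p.2),
        ‖f.1 p.1 - f.1 p.2‖) ^ (2 / (((n : ℝ) + 2) * ((n : ℝ) + 1)))

/-- Stahl–Totik regularity of a measure `μ` whose orthonormal polynomials have leading
coefficients `κ`:  `κ n ^ (1/n) → 1 / cap (supp μ)`. -/
def IsRegularST (μ : Measure ℂ) (κ : ℕ → ℝ) : Prop :=
  Tendsto (fun n : ℕ => κ n ^ ((n : ℝ)⁻¹)) atTop (𝓝 (1 / capacity (msupport μ)))

/-- The Christoffel function `λ_n(z; μ)`. -/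
def christoffel (μ : Measure ℂ) (n : ℕ) (z : ℂ) : ℝ :=
  sInf {x : ℝ | ∃ P : Polynomial ℂ, P.natDegree ≤ n ∧ P.eval z = 1 ∧
    x = ∫ w, ‖P.eval w‖ ^ 2 ∂μ}

/-- Arclength measure `dθ` on the unit circle (parametrized over `[0, 2π]`). -/
def circleArc : Measure ℂ :=
  Measure.map (fun θ : ℝ => Complex.exp (Complex.I * θ)) (volume.restrict (Icc (0:ℝ) (2 * Real.pi)))

/-- The measure `w(θ) dθ/(2π)` on the unit circle. -/
def circleAC (w : ℝ → ℝ) : Measure ℂ :=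
  Measure.map (fun θ : ℝ => Complex.exp (Complex.I * θ))
    ((volume.restrict (Icc (0:ℝ) (2 * Real.pi))).withDensity fun θ =>
      ENNReal.ofReal (w θ / (2 * Real.pi)))

/-- The Hua–Pickrell weight. -/
def hpWeight (γ τ : ℝ) (θ : ℝ) : ℝ :=
  (4:ℝ) ^ γ * ‖Complex.Gamma (1 + (γ:ℂ) + Complex.I * (τ:ℂ))‖ ^ 2
      / Real.Gamma (2 * γ + 1)
    * Real.exp ((Real.pi - θ) * τ) * Real.sin (θ / 2) ^ (2 * γ)

/-- The Hua–Pickrell measure on the unit circle. -/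
def huaPickrell (γ τ : ℝ) : Measure ℂ := circleAC (hpWeight γ τ)

/-- The limiting kernel appearing in Theorem 1.1, with the diagonal `a = b̄` interpreted
by continuity. -/
def hpLimitKernel (γ τ : ℝ) (a b : ℂ) : ℂ :=
  let y : ℂ := (γ:ℂ) + Complex.I * (τ:ℂ)
  let c : ℂ := 2 * (γ:ℂ) + 1
  if a = conj b then
    oneF1 (1 + conj y) c (-Complex.I * conj b) * oneF1 (2 + y) (c + 1) (Complex.I * conj b)
        * (1 + y)
      - oneF1 (conj y) c (-Complex.I * conj b) * oneF1 (1 + y) (c + 1) (Complex.I * conj b) * y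
  else
    c * (oneF1 (conj y) c (-Complex.I * conj b) * oneF1 y c (Complex.I * a)
        - oneF1 (1 + conj y) c (-Complex.I * conj b) * oneF1 (1 + y) c (Complex.I * a))
      / (Complex.I * (conj b - a))

/-- The lemniscate region `G_{r,m} = {z : |z^m - 1| < r^m}`. -/
def lemniscate (r : ℝ) (m : ℕ) : Set ℂ := {z : ℂ | ‖z ^ m - 1‖ < r ^ m}

/-- The function `H = ₁F₁(2;3;·)`. -/
def Hfun (t : ℂ) : ℂ := if t = 0 then 1 else 2 * (Complex.exp t * (t - 1) + 1) / t ^ 2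

/-- The function `T` of (2.1). -/
def Tfun (γ : ℝ) (a : ℝ) : ℂ :=
  oneF1 (1 + (γ:ℂ)) (2 * (γ:ℂ) + 1) (-Complex.I * (a:ℂ))
      * oneF1 (2 + (γ:ℂ)) (2 * (γ:ℂ) + 2) (Complex.I * (a:ℂ)) * (1 + (γ:ℂ))
    - oneF1 (γ:ℂ) (2 * (γ:ℂ) + 1) (-Complex.I * (a:ℂ))
      * oneF1 (1 + (γ:ℂ)) (2 * (γ:ℂ) + 2) (Complex.I * (a:ℂ)) * (γ:ℂ)

end

noncomputable section HPaux

def hpW (γ τ θ : ℝ) : ℝ := Real.exp (-(θ * τ)) * Real.sin (θ / 2) ^ (2 * γ)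

lemma hp_sin_pos {θ : ℝ} (h : θ ∈ Ioo 0 (2 * Real.pi)) : 0 < Real.sin (θ / 2) :=
  Real.sin_pos_of_pos_of_lt_pi (by linarith [h.1]) (by linarith [h.2])

lemma hp_sin_nonneg {θ : ℝ} (h : θ ∈ Icc 0 (2 * Real.pi)) : 0 ≤ Real.sin (θ / 2) :=
  Real.sin_nonneg_of_nonneg_of_le_pi (by linarith [h.1]) (by linarith [h.2])

lemma hp_sin_rpow_hasDerivAt (p : ℝ) {θ : ℝ} (h : θ ∈ Ioo 0 (2 * Real.pi)) :
    HasDerivAt (fun θ : ℝ => Real.sin (θ / 2) ^ (p + 1))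
      ((p + 1) / 2 * Real.cos (θ / 2) * Real.sin (θ / 2) ^ p) θ := by
  have h1 : HasDerivAt (fun θ : ℝ => Real.sin (θ / 2)) (Real.cos (θ / 2) * (1 / 2)) θ :=
    ((hasDerivAt_id θ).div_const 2).sin
  have := h1.rpow_const (p := p + 1) (Or.inl (hp_sin_pos h).ne')
  convert this using 1
  rw [add_sub_cancel_right]; ring

lemma hp_sin_cont (p : ℝ) (hp : 0 ≤ p) : Continuous (fun θ : ℝ => Real.sin (θ / 2) ^ p) := by
  apply Continuous.rpow_const
  · fun_prop
  · intro _; right; exact hp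

lemma hp_sin_int (γ : ℝ) (hγ : -(1/2) < γ) :
    IntervalIntegrable (fun θ => Real.sin (θ / 2) ^ (2 * γ)) volume 0 (2 * Real.pi) := by
  have hpi := Real.pi_pos
  have hc2 : Continuous (fun θ : ℝ => Real.sin (θ / 2) ^ (2 * γ + 2)) :=
    hp_sin_cont _ (by linarith)
  have hc1 : Continuous (fun θ : ℝ => Real.sin (θ / 2) ^ (2 * γ + 1)) :=
    hp_sin_cont _ (by linarith)
  have key : IntervalIntegrable (fun θ => (γ + 1/2) * Real.sin (θ / 2) ^ (2 * γ)) volume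
      0 (2 * Real.pi) := by
    apply intervalIntegral.intervalIntegrable_deriv_of_nonneg
      (g := fun θ => Real.cos (θ / 2) * Real.sin (θ / 2) ^ (2 * γ + 1) +
        (γ + 1) * ∫ t in (0:ℝ)..θ, Real.sin (t / 2) ^ (2 * γ + 2))
    · apply Continuous.continuousOn
      have : Continuous fun θ : ℝ => ∫ t in (0:ℝ)..θ, Real.sin (t / 2) ^ (2 * γ + 2) :=
        intervalIntegral.continuous_primitive (fun a b => hc2.intervalIntegrable a b) 0
      fun_prop
    · intro θ hθ
      rw [min_eq_left (by positivity), max_eq_right (by positivity)] at hθ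
      have h1 : HasDerivAt (fun θ : ℝ => Real.cos (θ / 2)) (-Real.sin (θ / 2) * (1 / 2)) θ :=
        ((hasDerivAt_id θ).div_const 2).cos
      have h2 := hp_sin_rpow_hasDerivAt (2 * γ) hθ
      have h3 := (hc2.integral_hasStrictDerivAt 0 θ).hasDerivAt
      refine ((h1.mul h2).add (h3.const_mul (γ + 1))).congr_deriv ?_
      have hs := hp_sin_pos hθ
      have e2 : Real.sin (θ / 2) ^ (2 * γ + 2) = Real.sin (θ / 2) ^ (2 * γ) * Real.sin (θ / 2) ^ 2 := by
        rw [Real.rpow_add hs]; norm_num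
      have e1 : Real.sin (θ / 2) ^ (2 * γ + 1) = Real.sin (θ / 2) ^ (2 * γ) * Real.sin (θ / 2) := by
        rw [Real.rpow_add hs]; norm_num
      rw [e1, e2]
      have := Real.sin_sq_add_cos_sq (θ / 2)
      have h4 : Real.cos (θ / 2) ^ 2 = 1 - Real.sin (θ / 2) ^ 2 := by linarith
      ring_nf
      ring_nf at h4
      rw [h4]; ring
    · intro θ hθ
      rw [min_eq_left (by positivity), max_eq_right (by positivity)] at hθ
      have := hp_sin_pos hθ
      have : 0 < γ + 1/2 := by linarith
      positivity
  have := key.const_mul (γ + 1/2)⁻¹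
  refine this.congr ?_
  intro θ _
  have : γ + 1/2 ≠ 0 := by linarith
  simp only
  rw [← mul_assoc, inv_mul_cancel₀ this, one_mul]

lemma hpW_int (γ τ : ℝ) (hγ : -(1/2) < γ) :
    IntervalIntegrable (hpW γ τ) volume 0 (2 * Real.pi) :=
  (hp_sin_int γ hγ).continuousOn_mul (by fun_prop)

lemma hpW_mul_int (γ τ : ℝ) (hγ : -(1/2) < γ) {f : ℝ → ℂ} (hf : Continuous f) :
    IntervalIntegrable (fun θ => (hpW γ τ θ : ℂ) * f θ) volume 0 (2 * Real.pi) := by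
  have : IntervalIntegrable (fun θ => (hpW γ τ θ : ℂ)) volume 0 (2 * Real.pi) := by
    have := hpW_int γ τ hγ
    rw [intervalIntegrable_iff] at this ⊢
    exact this.ofReal
  exact this.mul_continuousOn hf.continuousOn

def hpg (k j : ℕ) (θ : ℝ) : ℂ :=
  (1 - Complex.exp (Complex.I * θ)) ^ k * (1 - Complex.exp (-(Complex.I * θ))) ^ j

lemma hpg_cont (k j : ℕ) : Continuous (hpg k j) := by unfold hpg; fun_prop

lemma hpg_deriv (k j : ℕ) (θ : ℝ) : ∃ g' : ℂ, HasDerivAt (hpg k j) g' θ ∧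
    (1 - Complex.exp (-(Complex.I * θ))) * g' =
      Complex.I * (k + j * Complex.exp (-(Complex.I * θ))) * hpg k j θ := by
  have h0 : HasDerivAt (fun θ : ℝ => (θ : ℂ)) 1 θ := Complex.ofRealCLM.hasDerivAt
  have h1 : HasDerivAt (fun θ : ℝ => 1 - Complex.exp (Complex.I * θ))
      (-(Complex.exp (Complex.I * θ) * (Complex.I * 1))) θ :=
    ((h0.const_mul Complex.I).cexp).const_sub 1
  have h2 : HasDerivAt (fun θ : ℝ => 1 - Complex.exp (-(Complex.I * θ)))
      (-(Complex.exp (-(Complex.I * θ)) * (-(Complex.I * 1)))) θ :=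
    ((h0.const_mul Complex.I).neg.cexp).const_sub 1
  refine ⟨_, (h1.pow k).mul (h2.pow j), ?_⟩
  have huv : Complex.exp (Complex.I * θ) * Complex.exp (-(Complex.I * θ)) = 1 := by
    rw [← Complex.exp_add]; simp
  unfold hpg
  simp only [Pi.pow_apply]
  generalize Complex.exp (Complex.I * θ) = u at *
  generalize Complex.exp (-(Complex.I * θ)) = v at *
  rcases k with _ | k <;> rcases j with _ | j <;>
    simp only [Nat.cast_zero, Nat.add_sub_cancel, pow_zero, zero_mul, Nat.cast_add, Nat.cast_one, pow_succ, mul_zero]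
  · ring
  · ring
  · linear_combination (Complex.I * (k+1) * (1-u)^k) * huv
  · linear_combination (Complex.I * (k+1) * (1-u)^k * (1-v)^j*(1-v)) * huv

lemma hp_parts (γ τ : ℝ) (hγ : -(1/2) < γ) (k j : ℕ) :
    ∫ θ in (0:ℝ)..(2 * Real.pi), (hpW γ τ θ : ℂ) *
      (((2 * γ + 1 + k + j : ℂ) - (1 + γ - Complex.I * τ + j) *
        (1 - Complex.exp (-(Complex.I * θ)))) * hpg k j θ) = 0 := by
  have hpi := Real.pi_pos
  have := intervalIntegral.integral_eq_sub_of_hasDerivAt_of_le (a := 0) (b := 2 * Real.pi)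
    (f := fun θ : ℝ => ((Real.exp (-(θ * τ)) * Real.sin (θ / 2) ^ (2 * γ + 1) : ℝ) : ℂ) *
      (Complex.exp (-(Complex.I * θ / 2)) * hpg k j θ))
    (f' := fun θ : ℝ => (1/2 : ℂ) * ((hpW γ τ θ : ℂ) *
      (((2 * γ + 1 + k + j : ℂ) - (1 + γ - Complex.I * τ + j) *
        (1 - Complex.exp (-(Complex.I * θ)))) * hpg k j θ)))
    (by positivity) ?_ ?_ ?_
  · rw [intervalIntegral.integral_const_mul] at this
    have h0 : 2 * γ + 1 ≠ 0 := by linarith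
    simpa [Real.zero_rpow h0] using this
  · have h1 : Continuous (fun θ : ℝ => Real.sin (θ / 2) ^ (2 * γ + 1)) :=
      hp_sin_cont _ (by linarith)
    have h2 := hpg_cont k j
    apply Continuous.continuousOn
    fun_prop
  · intro θ hθ
    obtain ⟨g', hg, hg'⟩ := hpg_deriv k j θ
    have h0 : HasDerivAt (fun θ : ℝ => (θ : ℂ)) 1 θ := Complex.ofRealCLM.hasDerivAt
    have h1 : HasDerivAt (fun θ : ℝ => Complex.exp (-(Complex.I * θ / 2)))
       (Complex.exp (-(Complex.I * θ / 2)) * (-(Complex.I * 1 / 2))) θ :=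
      (((h0.const_mul Complex.I).div_const 2).neg).cexp
    have h2 : HasDerivAt (fun θ : ℝ => Real.exp (-(θ * τ))) (Real.exp (-(θ * τ)) * (-(1 * τ))) θ :=
      (((hasDerivAt_id θ).mul_const τ).neg).exp
    have h3 := hp_sin_rpow_hasDerivAt (2 * γ) hθ
    have hs := hp_sin_pos hθ
    refine (((h2.mul h3).ofReal_comp).mul (h1.mul hg)).congr_deriv ?_
    have e1 : Real.sin (θ / 2) ^ (2 * γ + 1) = Real.sin (θ / 2) ^ (2 * γ) * Real.sin (θ / 2) := by
      rw [Real.rpow_add hs]; norm_num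
    simp only [Pi.mul_apply]
    rw [e1]
    unfold hpW
    push_cast
    have ec : Complex.cos (θ / 2 : ℂ) * Complex.exp (-(Complex.I * θ / 2)) =
        (1 + Complex.exp (-(Complex.I * θ))) / 2 := by
      rw [Complex.cos, div_mul_eq_mul_div, add_mul, ← Complex.exp_add, ← Complex.exp_add]
      congr 2
      · ring_nf; simp
      · congr 1; ring
    have es : Complex.sin (θ / 2 : ℂ) * Complex.exp (-(Complex.I * θ / 2)) =
        -(Complex.I / 2) * (1 - Complex.exp (-(Complex.I * θ))) := by
      have a1 : Complex.exp (-(θ / 2 : ℂ) * Complex.I) * Complex.exp (-(Complex.I * θ / 2)) =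
          Complex.exp (-(Complex.I * θ)) := by
        rw [← Complex.exp_add]; congr 1; ring
      have a2 : Complex.exp ((θ / 2 : ℂ) * Complex.I) * Complex.exp (-(Complex.I * θ / 2)) = 1 := by
        rw [← Complex.exp_add]; ring_nf; simp
      rw [Complex.sin, ]
      linear_combination Complex.I / 2 * a1 - Complex.I / 2 * a2
    generalize Complex.exp (-(Complex.I * θ / 2)) = q at *
    generalize Complex.exp (-(Complex.I * θ)) = v at *
    generalize ((Real.sin (θ / 2) ^ (2 * γ) : ℝ) : ℂ) = S at *
    generalize Complex.exp (-((θ : ℂ) * τ)) = E at *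
    generalize Complex.sin (θ / 2 : ℂ) = s at *
    generalize Complex.cos (θ / 2 : ℂ) = c at *
    generalize hpg k j θ = g at *
    have hI := Complex.I_mul_I
    linear_combination -((-E * S * g * ((2 * γ + 1) / 2)) * ec + (E * S * g * τ  + E * S * g * Complex.I / 2 - E * S * g') * es + (E * S * Complex.I / 2) * hg' + (-(E*S*g*(1-v)/4)+(E*S*g)/2*(k+j*v)) * hI)
  · have := hpW_mul_int γ τ hγ (f := fun θ => (((2 * γ + 1 + k + j : ℂ) - (1 + γ - Complex.I * τ + j) *
        (1 - Complex.exp (-(Complex.I * θ)))) * hpg k j θ)) (by have := hpg_cont k j; fun_prop)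
    exact this.const_mul _

def hpC (γ τ : ℝ) : ℝ := (4:ℝ) ^ γ * ‖Complex.Gamma (1 + (γ:ℂ) + Complex.I * (τ:ℂ))‖ ^ 2
      / Real.Gamma (2 * γ + 1) * Real.exp (Real.pi * τ) / (2 * Real.pi)

lemma hpC_pos (γ τ : ℝ) (hγ : -(1/2) < γ) : 0 < hpC γ τ := by
  have h1 : 0 < Real.Gamma (2 * γ + 1) := Real.Gamma_pos_of_pos (by linarith)
  have h2 : Complex.Gamma (1 + (γ:ℂ) + Complex.I * (τ:ℂ)) ≠ 0 := by
    apply Complex.Gamma_ne_zero_of_re_pos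
    simp; linarith
  have h3 := norm_pos_iff.2 h2
  have := Real.pi_pos
  unfold hpC
  positivity

lemma hpWeight_eq (γ τ θ : ℝ) : hpWeight γ τ θ / (2 * Real.pi) = hpC γ τ * hpW γ τ θ := by
  unfold hpWeight hpC hpW
  have : Real.exp ((Real.pi - θ) * τ) = Real.exp (Real.pi * τ) * Real.exp (-(θ * τ)) := by
    rw [← Real.exp_add]; congr 1; ring
  rw [this]; ring

lemma hpW_nonneg (γ τ : ℝ) {θ : ℝ} (h : θ ∈ Icc 0 (2 * Real.pi)) : 0 ≤ hpW γ τ θ :=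
  mul_nonneg (Real.exp_pos _).le (Real.rpow_nonneg (hp_sin_nonneg h) _)

lemma hpW_meas (γ τ : ℝ) : Measurable (hpW γ τ) := by
  unfold hpW
  exact (by fun_prop : Measurable fun θ : ℝ => Real.exp (-(θ * τ))).mul
    ((by fun_prop : Measurable fun θ : ℝ => Real.sin (θ / 2)).pow_const _)

lemma hp_integral (γ τ : ℝ) (hγ : -(1/2) < γ) {f : ℂ → ℂ} (hf : Continuous f) :
    Integrable f (huaPickrell γ τ) ∧ ∫ z, f z ∂(huaPickrell γ τ) =
      ∫ θ in (0:ℝ)..(2 * Real.pi), (hpC γ τ : ℂ) *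
        ((hpW γ τ θ : ℂ) * f (Complex.exp (Complex.I * θ))) := by
  have hpi := Real.pi_pos
  have hC := hpC_pos γ τ hγ
  have hphi : Continuous (fun θ : ℝ => Complex.exp (Complex.I * θ)) := by fun_prop
  have hmeas : Measurable fun θ => ENNReal.ofReal (hpC γ τ * hpW γ τ θ) :=
    ((hpW_meas γ τ).const_mul _).ennreal_ofReal
  have hae : ∀ᵐ θ ∂(volume.restrict (Icc (0:ℝ) (2 * Real.pi))),
      (ENNReal.ofReal (hpC γ τ * hpW γ τ θ)).toReal • f (Complex.exp (Complex.I * θ)) =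
      (hpC γ τ : ℂ) * ((hpW γ τ θ : ℂ) * f (Complex.exp (Complex.I * θ))) := by
    filter_upwards [ae_restrict_mem measurableSet_Icc] with θ hθ
    rw [ENNReal.toReal_ofReal (mul_nonneg hC.le (hpW_nonneg γ τ hθ)), Complex.real_smul]
    push_cast; ring
  have hint := (hpW_mul_int γ τ hγ (f := fun θ => f (Complex.exp (Complex.I * θ)))
    (hf.comp hphi)).const_mul (hpC γ τ : ℂ)
  unfold huaPickrell circleAC
  simp only [hpWeight_eq]
  constructor
  · rw [integrable_map_measure hf.aestronglyMeasurable hphi.measurable.aemeasurable,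
      integrable_withDensity_iff_integrable_smul' hmeas (by simp)]
    rw [integrable_congr (by exact hae)]
    rw [intervalIntegrable_iff_integrableOn_Icc_of_le (by positivity)] at hint
    exact hint
  · rw [integral_map hphi.measurable.aemeasurable hf.aestronglyMeasurable,
      integral_withDensity_eq_integral_toReal_smul hmeas (by simp)]
    rw [integral_congr_ae hae, intervalIntegral.integral_of_le (by positivity),
      integral_Icc_eq_integral_Ioc]

def hpM (γ τ : ℝ) (k j : ℕ) : ℂ := ∫ z, (1 - z) ^ k * conj ((1 - z) ^ j) ∂(huaPickrell γ τ)

lemma hpM_conj (γ τ : ℝ) (k j : ℕ) : hpM γ τ j k = conj (hpM γ τ k j) := by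
  unfold hpM
  rw [← integral_conj]
  congr 1; ext z
  simp [mul_comm]

lemma hpM_eq (γ τ : ℝ) (hγ : -(1/2) < γ) (k j : ℕ) : hpM γ τ k j = hpC γ τ *
    ∫ θ in (0:ℝ)..(2 * Real.pi), (hpW γ τ θ : ℂ) * hpg k j θ := by
  unfold hpM
  rw [(hp_integral γ τ hγ (by fun_prop)).2, ← intervalIntegral.integral_const_mul]
  congr 1; ext θ
  congr 2
  unfold hpg
  simp only [map_pow, map_sub, map_one, ← Complex.exp_conj, map_mul, Complex.conj_I, Complex.conj_ofReal]
  simp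

lemma hpM_rec1 (γ τ : ℝ) (hγ : -(1/2) < γ) (k j : ℕ) :
    (2 * γ + 1 + k + j) * hpM γ τ k j = (1 + γ - Complex.I * τ + j) * hpM γ τ k (j + 1) := by
  have h := hp_parts γ τ hγ k j
  have e : ∀ θ : ℝ, (hpW γ τ θ : ℂ) *
      (((2 * γ + 1 + k + j : ℂ) - (1 + γ - Complex.I * τ + j) *
        (1 - Complex.exp (-(Complex.I * θ)))) * hpg k j θ) =
      (2 * γ + 1 + k + j : ℂ) * ((hpW γ τ θ : ℂ) * hpg k j θ) -
      (1 + γ - Complex.I * τ + j) * ((hpW γ τ θ : ℂ) * hpg k (j + 1) θ) := by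
    intro θ; unfold hpg; ring
  simp_rw [e] at h
  rw [intervalIntegral.integral_sub ((hpW_mul_int γ τ hγ (hpg_cont k j)).const_mul _)
    ((hpW_mul_int γ τ hγ (hpg_cont k (j+1))).const_mul _), intervalIntegral.integral_const_mul,
    intervalIntegral.integral_const_mul] at h
  rw [hpM_eq γ τ hγ, hpM_eq γ τ hγ]
  linear_combination (hpC γ τ : ℂ) * h

lemma hpM_rec2 (γ τ : ℝ) (hγ : -(1/2) < γ) (k j : ℕ) :
    (2 * γ + 1 + k + j) * hpM γ τ k j = (1 + γ + Complex.I * τ + k) * hpM γ τ (k + 1) j := by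
  have h := congrArg conj (hpM_rec1 γ τ hγ j k)
  simp only [map_mul, map_add, map_sub, map_one, Complex.conj_ofReal, Complex.conj_I, map_natCast,
    map_ofNat, ← hpM_conj] at h
  linear_combination h

lemma hpM_zero (γ τ : ℝ) (hγ : -(1/2) < γ) : ∃ m : ℝ, 0 < m ∧ hpM γ τ 0 0 = m := by
  refine ⟨hpC γ τ * ∫ θ in (0:ℝ)..(2 * Real.pi), hpW γ τ θ, ?_, ?_⟩
  · refine mul_pos (hpC_pos γ τ hγ) ?_
    apply intervalIntegral.intervalIntegral_pos_of_pos_on (hpW_int γ τ hγ)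
    · intro θ hθ
      exact mul_pos (Real.exp_pos _) (Real.rpow_pos_of_pos (hp_sin_pos hθ) _)
    · have := Real.pi_pos; positivity
  · rw [hpM_eq γ τ hγ]
    have := intervalIntegral.integral_ofReal (a := 0) (b := 2 * Real.pi) (μ := volume)
      (f := hpW γ τ)
    simp only [hpg, pow_zero, mul_one]
    push_cast
    rw [← this]

/-- rising factorial as a product -/
def rf {R : Type*} [CommRing R] (v : R) (k : ℕ) : R := ∏ i ∈ Finset.range k, (v + i)

lemma rf_zero {R : Type*} [CommRing R] (v : R) : rf v 0 = 1 := by simp [rf]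
lemma rf_succ {R : Type*} [CommRing R] (v : R) (k : ℕ) : rf v (k + 1) = rf v k * (v + k) := by
  simp [rf, Finset.prod_range_succ]

lemma rf_add {R : Type*} [CommRing R] (v : R) (k j : ℕ) : rf v (k + j) = rf v k * rf (v + k) j := by
  induction j with
  | zero => simp [rf_zero]
  | succ j ih => rw [← add_assoc, rf_succ, ih, rf_succ]; push_cast; ring

lemma hpM_closed (γ τ : ℝ) (hγ : -(1/2) < γ) (k j : ℕ) :
    rf (1 + γ + Complex.I * τ) k * rf (1 + γ - Complex.I * τ) j * hpM γ τ k j =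
      rf (2 * γ + 1 : ℂ) (k + j) * hpM γ τ 0 0 := by
  induction k with
  | zero =>
    induction j with
    | zero => simp [rf_zero]
    | succ j ih =>
      have := hpM_rec1 γ τ hγ 0 j
      simp only [zero_add] at *
      rw [rf_succ, rf_succ]
      push_cast at *
      linear_combination (2 * γ + 1 + j : ℂ) * ih - rf (1 + γ + Complex.I * τ) 0 * rf (1 + γ - Complex.I * τ) j * this
  | succ k ih =>
    have := hpM_rec2 γ τ hγ k j
    rw [show k + 1 + j = (k + j) + 1 by ring, rf_succ, rf_succ]
    push_cast at *
    linear_combination (2 * γ + 1 + k + j : ℂ) * ih - rf (1 + γ + Complex.I * τ) k * rf (1 + γ - Complex.I * τ) j * this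

open Polynomial in
lemma rf_fwd (v : ℂ) (n j : ℕ) (hj : j ≤ n) :
    ∑ k ∈ Finset.range (n + 1), (n.choose k : ℂ) * (-1) ^ k * rf (v + k) j =
      if j = n then (-1) ^ n * (n.factorial : ℂ) else 0 := by
  set Q : ℂ[X] := ∏ i ∈ Finset.range j, (X + C (v + i)) with hQ
  have hm : ∀ i ∈ Finset.range j, (X + C (v + (i:ℂ))).Monic := fun i _ => monic_X_add_C _
  have hmon : Q.Monic := monic_prod_of_monic _ _ hm
  have hdeg : Q.natDegree = j := by
    rw [hQ, natDegree_prod_of_monic _ _ hm]; simp only [natDegree_X_add_C]; simp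
  have hev : ∀ k : ℕ, Q.eval (k : ℂ) = rf (v + k) j := by
    intro k
    rw [hQ, eval_prod, rf]
    refine Finset.prod_congr rfl fun i _ => ?_
    simp; ring
  have h2 := fwdDiff_iter_eq_sum_shift (1 : ℂ) (fun x => Q.eval x) n 0
  have h3 : ∑ k ∈ Finset.range (n + 1), (n.choose k : ℂ) * (-1) ^ k * rf (v + k) j =
      (-1) ^ n * (fwdDiff (1:ℂ))^[n] (fun x => Q.eval x) 0 := by
    rw [h2, Finset.mul_sum]
    refine Finset.sum_congr rfl fun k hk => ?_
    rw [← hev]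
    have hk' : k ≤ n := by simpa [Nat.lt_succ_iff] using hk
    have e : ((-1 : ℂ)) ^ n = (-1) ^ (n - k) * (-1) ^ k := by
      rw [← pow_add, Nat.sub_add_cancel hk']
    have e2 : ((-1 : ℂ)) ^ (n - k) * (-1) ^ (n - k) = 1 := by
      rw [← mul_pow]; simp
    simp only [nsmul_eq_mul, mul_one, zero_add, zsmul_eq_mul]
    push_cast
    rw [e]
    linear_combination (-((n.choose k : ℂ) * (-1)^k * Q.eval (k:ℂ))) * e2
  rw [h3]
  split_ifs with h
  · subst h
    have := congrFun (fwdDiff_iter_degree_eq_factorial Q) 0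
    rw [hdeg, hmon.leadingCoeff] at this
    rw [this]; simp
  · have := congrFun (fwdDiff_iter_eq_zero_of_degree_lt (P := Q) (n := n) (by omega)) 0
    rw [this]; simp

def hpA (γ τ : ℝ) (k : ℕ) : ℂ := rf (1 + γ + Complex.I * τ : ℂ) k / rf (2 * γ + 1 : ℂ) k

lemma rf_ne_zero (v : ℂ) (hv : 0 < v.re) (k : ℕ) : rf v k ≠ 0 := by
  refine Finset.prod_ne_zero_iff.2 fun i _ h => ?_
  have := congrArg Complex.re h
  simp at this
  have h2 : (0:ℝ) ≤ i := by positivity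
  linarith

lemma rf_conj (v : ℂ) (k : ℕ) : conj (rf v k) = rf (conj v) k := by
  simp [rf, map_prod]

lemma rf_ofReal (v : ℝ) (k : ℕ) : ((rf v k : ℝ) : ℂ) = rf (v : ℂ) k := by
  simp [rf]

lemma rf_pos (v : ℝ) (hv : 0 < v) (k : ℕ) : 0 < rf v k :=
  Finset.prod_pos fun i _ => by positivity

open Polynomial in
def hpP (γ τ : ℝ) (n : ℕ) : ℂ[X] :=
  ∑ k ∈ Finset.range (n + 1), C ((n.choose k : ℂ) * (-1) ^ k * hpA γ τ k) * (1 - X) ^ k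

lemma hpP_eval (γ τ : ℝ) (n : ℕ) (z : ℂ) : (hpP γ τ n).eval z =
    ∑ k ∈ Finset.range (n + 1), (n.choose k : ℂ) * (-1) ^ k * hpA γ τ k * (1 - z) ^ k := by
  simp [hpP, Polynomial.eval_finsetSum]

lemma hpP_inner_pow (γ τ : ℝ) (hγ : -(1/2) < γ) (n j : ℕ) (hj : j ≤ n) :
    ∫ z, (hpP γ τ n).eval z * conj ((1 - z) ^ j) ∂(huaPickrell γ τ) =
      if j = n then (-1) ^ n * n.factorial * hpM γ τ 0 0 / rf (1 + γ - Complex.I * τ : ℂ) n else 0 := by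
  have h1 : ∀ z : ℂ, (hpP γ τ n).eval z * conj ((1 - z) ^ j) =
      ∑ k ∈ Finset.range (n + 1), (n.choose k : ℂ) * (-1) ^ k * hpA γ τ k *
        ((1 - z) ^ k * conj ((1 - z) ^ j)) := by
    intro z
    rw [hpP_eval, Finset.sum_mul]
    refine Finset.sum_congr rfl fun k _ => ?_
    ring
  simp_rw [h1]
  rw [integral_finsetSum]
  swap
  · intro k _
    exact (hp_integral γ τ hγ (by fun_prop)).1
  simp_rw [integral_const_mul]
  have hy : ∀ k, rf (1 + γ + Complex.I * τ : ℂ) k ≠ 0 := fun k => rf_ne_zero _ (by simp; linarith) k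
  have hy' : ∀ k, rf (1 + γ - Complex.I * τ : ℂ) k ≠ 0 := fun k => rf_ne_zero _ (by simp; linarith) k
  have hc : ∀ k, rf (2 * γ + 1 : ℂ) k ≠ 0 := fun k => rf_ne_zero _ (by simp; linarith) k
  have h2 : ∀ k, (n.choose k : ℂ) * (-1) ^ k * hpA γ τ k *
      ∫ z, (1 - z) ^ k * conj ((1 - z) ^ j) ∂(huaPickrell γ τ) =
      hpM γ τ 0 0 / rf (1 + γ - Complex.I * τ : ℂ) j *
       ((n.choose k : ℂ) * (-1) ^ k * rf (2 * γ + 1 + k : ℂ) j) := by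
    intro k
    have h3 := hpM_closed γ τ hγ k j
    rw [rf_add] at h3
    change _ * hpM γ τ k j = _
    unfold hpA
    have a1 := hy k; have a2 := hy' j; have a3 := hc k
    generalize rf (1 + γ + Complex.I * τ : ℂ) k = Y at *
    generalize rf (1 + γ - Complex.I * τ : ℂ) j = Y' at *
    generalize rf (2 * γ + 1 : ℂ) k = Z at *
    generalize rf (2 * γ + 1 + k : ℂ) j = V at *
    have : Y / Z * hpM γ τ k j = hpM γ τ 0 0 / Y' * V := by
      field_simp
      linear_combination h3
    linear_combination ((n.choose k : ℂ) * (-1) ^ k) * this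
  simp_rw [h2]
  rw [← Finset.mul_sum, rf_fwd _ _ _ hj]
  split_ifs with h
  · subst h; ring
  · simp

def hph (γ τ : ℝ) (n : ℕ) : ℝ := (hpM γ τ 0 0).re * n.factorial / rf (2 * γ + 1) n

lemma hph_pos (γ τ : ℝ) (hγ : -(1/2) < γ) (n : ℕ) : 0 < hph γ τ n := by
  obtain ⟨m, hm, e⟩ := hpM_zero γ τ hγ
  have := rf_pos (2 * γ + 1) (by linarith) n
  unfold hph
  rw [e, Complex.ofReal_re]
  positivity

lemma hpP_inner_le (γ τ : ℝ) (hγ : -(1/2) < γ) (n m : ℕ) (hm : m ≤ n) :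
    ∫ z, (hpP γ τ n).eval z * conj ((hpP γ τ m).eval z) ∂(huaPickrell γ τ) =
      if n = m then (hph γ τ n : ℂ) else 0 := by
  have h1 : ∀ z : ℂ, (hpP γ τ n).eval z * conj ((hpP γ τ m).eval z) =
      ∑ k ∈ Finset.range (m + 1), conj ((m.choose k : ℂ) * (-1) ^ k * hpA γ τ k) *
        ((hpP γ τ n).eval z * conj ((1 - z) ^ k)) := by
    intro z
    rw [hpP_eval γ τ m, map_sum, Finset.mul_sum]
    refine Finset.sum_congr rfl fun k _ => ?_
    rw [map_mul _ _ ((1 - z) ^ k)]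
    ring
  simp_rw [h1]
  rw [integral_finsetSum]
  swap
  · intro k _
    exact (hp_integral γ τ hγ (by fun_prop)).1
  simp_rw [integral_const_mul]
  rw [Finset.sum_congr rfl (fun k hk => by
    rw [hpP_inner_pow γ τ hγ n k (by simp at hk; omega)])]
  split_ifs with h
  · subst h
    rw [Finset.sum_range_succ, Finset.sum_eq_zero, zero_add]
    · simp only [if_true, Nat.choose_self]
      obtain ⟨m0, hm0, e⟩ := hpM_zero γ τ hγ
      unfold hph hpA
      rw [e]
      simp only [map_mul, map_div₀, rf_conj, map_add, map_one, Complex.conj_ofReal,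
        Complex.conj_I, map_natCast, map_pow, map_neg, map_ofNat, Complex.ofReal_re]
      have hy' : rf (1 + γ - Complex.I * τ : ℂ) n ≠ 0 := rf_ne_zero _ (by simp; linarith) n
      have hc : rf (2 * γ + 1 : ℂ) n ≠ 0 := rf_ne_zero _ (by simp; linarith) n
      push_cast
      rw [rf_ofReal]
      push_cast
      rw [show (1 + γ + -Complex.I * τ : ℂ) = 1 + γ - Complex.I * τ by ring]
      have e2 : ((-1 : ℂ)) ^ n * (-1) ^ n = 1 := by
        rw [← mul_pow]; simp
      generalize rf (1 + γ - Complex.I * τ : ℂ) n = Y' at *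
      generalize rf (2 * γ + 1 : ℂ) n = Z at *
      have : Y' / Z * (n.factorial * m0 / Y') = m0 * n.factorial / Z := by
        field_simp
      linear_combination ((-1) ^ n * (-1) ^ n) * this + (m0 * n.factorial / Z) * e2
    · intro k hk
      rw [if_neg (by simp at hk; omega), mul_zero]
  · refine Finset.sum_eq_zero fun k hk => ?_
    rw [if_neg (by simp at hk; omega), mul_zero]

lemma hpP_inner (γ τ : ℝ) (hγ : -(1/2) < γ) (n m : ℕ) :
    ∫ z, (hpP γ τ n).eval z * conj ((hpP γ τ m).eval z) ∂(huaPickrell γ τ) =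
      if n = m then (hph γ τ n : ℂ) else 0 := by
  rcases le_total m n with h | h
  · exact hpP_inner_le γ τ hγ n m h
  · have := congrArg conj (hpP_inner_le γ τ hγ m n h)
    rw [← integral_conj] at this
    simp only [map_mul, Complex.conj_conj] at this
    simp_rw [mul_comm (conj _)] at this
    rw [this]
    by_cases hh : n = m
    · subst hh; simp
    · rw [if_neg hh, if_neg (Ne.symm hh)]; simp

open Polynomial in
lemma hpP_degree (γ τ : ℝ) (hγ : -(1/2) < γ) (n : ℕ) : (hpP γ τ n).degree = n := by
  have hd : ∀ k : ℕ, ((1 - X : ℂ[X]) ^ k).degree = k := by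
    intro k
    rw [degree_pow]
    have : (1 - X : ℂ[X]).degree = 1 := by
      rw [← degree_neg, neg_sub]; exact degree_X_sub_C (1:ℂ)
    rw [this]; simp
  have hA : hpA γ τ n ≠ 0 := div_ne_zero (rf_ne_zero _ (by simp; linarith) n)
    (rf_ne_zero _ (by simp; linarith) n)
  have hlast : (C ((n.choose n : ℂ) * (-1) ^ n * hpA γ τ n) * (1 - X) ^ n : ℂ[X]).degree = n := by
    rw [degree_C_mul, hd]
    simp [hA]
  unfold hpP
  rw [Finset.sum_range_succ, degree_add_eq_right_of_degree_lt, hlast]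
  rw [hlast, ← mem_degreeLT]
  refine Submodule.sum_mem _ fun k hk => ?_
  rw [mem_degreeLT]
  rw [← smul_eq_C_mul]
  refine (degree_smul_le _ _).trans_lt ?_
  rw [hd]
  exact_mod_cast Finset.mem_range.1 hk

open Polynomial in
lemma hp_expand (S : ℕ → ℂ[X]) (hS : ∀ n, (S n).degree = n) (n : ℕ) :
    ∀ P : ℂ[X], P.natDegree ≤ n → ∃ c : ℕ → ℂ, P = ∑ j ∈ Finset.range (n + 1), C (c j) * S j := by
  intro P hP
  let T : Polynomial.Sequence ℂ := ⟨S, hS⟩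
  have h := T.span_degreeLE (m := n) (fun i _ => by
    rw [isUnit_iff_ne_zero, leadingCoeff_ne_zero]; exact T.ne_zero i)
  have hm : P ∈ Submodule.span ℂ (T '' Set.Iic n) := by
    rw [h, mem_degreeLE]; exact natDegree_le_iff_degree_le.1 hP
  rw [show Set.Iic n = ((Finset.range (n + 1) : Finset ℕ) : Set ℕ) by ext; simp,
    Submodule.mem_span_image_finset_iff_exists_fun'] at hm
  obtain ⟨c, hc⟩ := hm
  refine ⟨c, ?_⟩
  rw [← hc]
  refine Finset.sum_congr rfl fun j _ => ?_
  rw [smul_eq_C_mul]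

open Polynomial in
lemma hp_normsq (μ : Measure ℂ) (hint : ∀ f : ℂ → ℂ, Continuous f → Integrable f μ)
    (S : ℕ → ℂ[X]) (h : ℕ → ℝ)
    (ho : ∀ n m, ∫ z, (S n).eval z * conj ((S m).eval z) ∂μ = if n = m then (h n : ℂ) else 0)
    (n : ℕ) (c : ℕ → ℂ) :
    ∫ w, ‖(∑ j ∈ Finset.range (n + 1), C (c j) * S j).eval w‖ ^ 2 ∂μ =
      ∑ j ∈ Finset.range (n + 1), ‖c j‖ ^ 2 * h j := by
  have key : (((∫ w, ‖(∑ j ∈ Finset.range (n + 1), C (c j) * S j).eval w‖ ^ 2 ∂μ : ℝ)) : ℂ) =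
     ((∑ j ∈ Finset.range (n + 1), ‖c j‖ ^ 2 * h j : ℝ) : ℂ) := by
    rw [← integral_complex_ofReal]
    have e : ∀ w : ℂ, ((‖(∑ j ∈ Finset.range (n + 1), C (c j) * S j).eval w‖ ^ 2 : ℝ) : ℂ) =
        ∑ i ∈ Finset.range (n + 1), ∑ j ∈ Finset.range (n + 1), (c i * conj (c j)) *
          ((S i).eval w * conj ((S j).eval w)) := by
      intro w
      push_cast
      rw [← Complex.mul_conj', eval_finsetSum, map_sum, Finset.sum_mul_sum]
      refine Finset.sum_congr rfl fun i _ => Finset.sum_congr rfl fun j _ => ?_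
      simp; ring
    simp_rw [e]
    rw [integral_finsetSum _ (fun i _ => hint _ (by fun_prop))]
    push_cast
    refine Finset.sum_congr rfl fun i hi => ?_
    rw [integral_finsetSum _ (fun i _ => hint _ (by fun_prop))]
    simp_rw [integral_const_mul, ho]
    rw [Finset.sum_eq_single i]
    · rw [if_pos rfl, Complex.mul_conj']
    · intro j _ hj; rw [if_neg (Ne.symm hj), mul_zero]
    · intro hh; exact absurd hi hh
  exact_mod_cast key

open Polynomial in
lemma hp_christoffel (μ : Measure ℂ) (hint : ∀ f : ℂ → ℂ, Continuous f → Integrable f μ)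
    (S : ℕ → ℂ[X]) (hS : ∀ n, (S n).degree = n) (h : ℕ → ℝ) (hh : ∀ n, 0 < h n)
    (ho : ∀ n m, ∫ z, (S n).eval z * conj ((S m).eval z) ∂μ = if n = m then (h n : ℂ) else 0)
    (n : ℕ) (z : ℂ) :
    christoffel μ n z = (∑ j ∈ Finset.range (n + 1), ‖(S j).eval z‖ ^ 2 / h j)⁻¹ := by
  set K := ∑ j ∈ Finset.range (n + 1), ‖(S j).eval z‖ ^ 2 / h j with hK
  have hKpos : 0 < K := by
    have h0 : 0 < ‖(S 0).eval z‖ ^ 2 / h 0 := by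
      have e : S 0 = C ((S 0).coeff 0) := eq_C_of_degree_le_zero (by rw [hS]; simp)
      have hne : (S 0).coeff 0 ≠ 0 := by
        intro hz
        rw [hz, C_0] at e
        have := hS 0
        rw [e] at this; simp at this
      rw [e, eval_C]
      have := hh 0
      have := norm_pos_iff.2 hne
      positivity
    refine h0.trans_le (Finset.single_le_sum (f := fun j => ‖(S j).eval z‖ ^ 2 / h j)
      (fun j _ => ?_) (by simp))
    have := hh j
    positivity
  unfold christoffel
  apply IsLeast.csInf_eq
  constructor
  · refine ⟨∑ j ∈ Finset.range (n + 1), C (conj ((S j).eval z) / (h j * K)) * S j, ?_, ?_, ?_⟩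
    · refine natDegree_sum_le_of_forall_le _ _ fun j hj => ?_
      refine (natDegree_C_mul_le _ _).trans ?_
      rw [natDegree_eq_of_degree_eq_some (hS j)]
      simp at hj; omega
    · rw [eval_finsetSum]
      have hKc : (K : ℂ) ≠ 0 := by exact_mod_cast hKpos.ne'
      have : ∀ j, (C (conj ((S j).eval z) / (h j * K)) * S j).eval z =
          ((‖(S j).eval z‖ ^ 2 / h j : ℝ) : ℂ) / K := by
        intro j
        simp only [eval_mul, eval_C]
        push_cast
        rw [← Complex.mul_conj']
        have : (h j : ℂ) ≠ 0 := by exact_mod_cast (hh j).ne'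
        field_simp
      simp_rw [this]
      rw [← Finset.sum_div, ← Complex.ofReal_sum, ← hK, div_self hKc]
    · rw [hp_normsq μ hint S h ho]
      have : ∀ j, ‖conj ((S j).eval z) / (h j * K)‖ ^ 2 * h j =
         (‖(S j).eval z‖ ^ 2 / h j) * (K⁻¹ ^ 2) := by
        intro j
        have := hh j
        rw [norm_div, norm_mul, RCLike.norm_conj, Complex.norm_real, Complex.norm_real,
          Real.norm_of_nonneg this.le, Real.norm_of_nonneg hKpos.le]
        field_simp
      simp_rw [this]
      rw [← Finset.sum_mul, ← hK]
      field_simp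
  · rintro x ⟨P, hP, hPz, rfl⟩
    obtain ⟨c, rfl⟩ := hp_expand S hS n P hP
    rw [hp_normsq μ hint S h ho]
    rw [eval_finsetSum] at hPz
    have h1 : 1 ≤ ∑ j ∈ Finset.range (n + 1), ‖c j‖ * ‖(S j).eval z‖ := by
      calc (1:ℝ) = ‖∑ j ∈ Finset.range (n + 1), (C (c j) * S j).eval z‖ := by rw [hPz]; simp
        _ ≤ ∑ j ∈ Finset.range (n + 1), ‖(C (c j) * S j).eval z‖ := norm_sum_le _ _
        _ = _ := by simp
    have h2 := Finset.sum_sq_le_sum_mul_sum_of_sq_le_mul (Finset.range (n + 1))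
      (r := fun j => ‖c j‖ * ‖(S j).eval z‖) (f := fun j => ‖c j‖ ^ 2 * h j)
      (g := fun j => ‖(S j).eval z‖ ^ 2 / h j) (fun j _ => by have := hh j; positivity)
      (fun j _ => by have := hh j; positivity)
      (fun j _ => by have := hh j; apply le_of_eq; field_simp)
    rw [← hK] at h2
    rw [inv_le_iff_one_le_mul₀ hKpos]
    nlinarith

lemma hp_lambda (γ τ : ℝ) (hγ : -(1/2) < γ) (n : ℕ) (z : ℂ) :
    christoffel (huaPickrell γ τ) n z =
      (∑ j ∈ Finset.range (n + 1), ‖(hpP γ τ j).eval z‖ ^ 2 / hph γ τ j)⁻¹ :=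
  hp_christoffel _ (fun _ hf => (hp_integral γ τ hγ hf).1) _ (hpP_degree γ τ hγ) _
    (hph_pos γ τ hγ) (hpP_inner γ τ hγ) n z

lemma hp_cont_of_joint {F : ℕ → ℂ → ℝ} {G : ℂ → ℝ}
    (h : ∀ a, Tendsto (fun p : ℕ × ℂ => F p.1 p.2) (atTop ×ˢ 𝓝 a) (𝓝 (G a))) : Continuous G := by
  rw [continuous_iff_continuousAt]
  intro a
  rw [ContinuousAt, Metric.tendsto_nhds]
  intro ε hε
  have h1 := (Metric.tendsto_nhds.1 (h a)) (ε / 2) (by positivity)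
  rw [eventually_prod_iff] at h1
  obtain ⟨pa, hpa, pb, hpb, hh⟩ := h1
  filter_upwards [hpb] with b hb
  have h2 : Tendsto (fun n => F n b) atTop (𝓝 (G b)) :=
    (h b).comp (tendsto_id.prodMk (tendsto_const_nhds.mono_right le_rfl))
  have h3 : Tendsto (fun n => dist (F n b) (G a)) atTop (𝓝 (dist (G b) (G a))) :=
    h2.dist tendsto_const_nhds
  have h4 : dist (G b) (G a) ≤ ε / 2 := by
    refine le_of_tendsto h3 ?_
    filter_upwards [hpa] with n hn
    exact (hh hn hb).le
  linarith

lemma hp_unif_of_joint {F : ℕ → ℂ → ℝ} {G : ℂ → ℝ}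
    (h : ∀ a, Tendsto (fun p : ℕ × ℂ => F p.1 p.2) (atTop ×ˢ 𝓝 a) (𝓝 (G a)))
    (K : Set ℂ) (hK : IsCompact K) : TendstoUniformlyOn F G atTop K := by
  rw [← tendstoLocallyUniformlyOn_iff_tendstoUniformlyOn_of_compact hK,
    tendstoLocallyUniformlyOn_iff_forall_tendsto]
  intro a _
  have hG := (hp_cont_of_joint h).continuousAt (x := a)
  have h1 : Tendsto (fun p : ℕ × ℂ => G p.2) (atTop ×ˢ 𝓝 a) (𝓝 (G a)) :=
    hG.tendsto.comp tendsto_snd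
  have h2 := (h1.prodMk_nhds (h a)).mono_right (nhds_le_uniformity (G a))
  exact h2.mono_left (Filter.prod_mono le_rfl nhdsWithin_le_nhds)

def hpB (γ τ : ℝ) : ℝ := ‖(1 + γ + Complex.I * τ : ℂ)‖ / (2 * γ + 1) + 1

lemma hpA_bound (γ τ : ℝ) (hγ : -(1/2) < γ) (k : ℕ) : ‖hpA γ τ k‖ ≤ hpB γ τ ^ k := by
  have hc : 0 < 2 * γ + 1 := by linarith
  unfold hpA rf
  rw [← Finset.prod_div_distrib, norm_prod]
  rw [show hpB γ τ ^ k = ∏ _i ∈ Finset.range k, hpB γ τ by simp]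
  refine Finset.prod_le_prod (fun _ _ => norm_nonneg _) fun i _ => ?_
  rw [norm_div]
  have e : ‖(2 * γ + 1 + i : ℂ)‖ = 2 * γ + 1 + i := by
    have : (2 * γ + 1 + i : ℂ) = ((2 * γ + 1 + i : ℝ) : ℂ) := by push_cast; rfl
    rw [this, Complex.norm_real, Real.norm_of_nonneg (by positivity)]
  rw [e, div_le_iff₀ (by positivity)]
  have h1 : ‖(1 + γ + Complex.I * τ + i : ℂ)‖ ≤ ‖(1 + γ + Complex.I * τ : ℂ)‖ + i := by
    refine (norm_add_le _ _).trans ?_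
    simp
  refine h1.trans ?_
  unfold hpB
  set q := ‖(1 + γ + Complex.I * τ : ℂ)‖
  have hq : 0 ≤ q := norm_nonneg _
  have : q / (2 * γ + 1) * (2 * γ + 1) = q := by field_simp
  have h2 : 0 ≤ q / (2 * γ + 1) * i := by positivity
  nlinarith

lemma hpB_pos (γ τ : ℝ) (hγ : -(1/2) < γ) : 0 < hpB γ τ := by
  have hc : 0 < 2 * γ + 1 := by linarith
  unfold hpB; positivity

def hpF (γ τ : ℝ) (x : ℂ) : ℂ := ∑' k : ℕ, hpA γ τ k * (x ^ k / k.factorial)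

lemma hp_summ (r R : ℝ) : Summable fun k : ℕ => r ^ k * (R ^ k / k.factorial) := by
  have := Real.summable_pow_div_factorial (r * R)
  refine this.congr fun k => ?_
  rw [mul_pow]; ring

lemma hpF_cont (γ τ : ℝ) (hγ : -(1/2) < γ) : Continuous (hpF γ τ) := by
  rw [continuous_iff_continuousAt]
  intro x
  have hB := hpB_pos γ τ hγ
  refine tendsto_tsum_of_dominated_convergence (hp_summ (hpB γ τ) (‖x‖ + 1)) ?_ ?_
  · intro k
    exact Continuous.tendsto (by fun_prop) x
  · have h1 : ∀ᶠ y in 𝓝 x, ‖y‖ < ‖x‖ + 1 :=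
      (continuous_norm.tendsto x).eventually_lt_const (by linarith)
    filter_upwards [h1] with y hy k
    rw [norm_mul, norm_div, norm_pow, Complex.norm_natCast]
    have := hpA_bound γ τ hγ k
    gcongr

lemma hpF_zero (γ τ : ℝ) : hpF γ τ 0 = 1 := by
  unfold hpF
  rw [tsum_eq_single 0]
  · simp [hpA, rf_zero]
  · intro k hk; simp [hk]

lemma hpP_eval' (γ τ : ℝ) (n : ℕ) (w : ℂ) : (hpP γ τ n).eval (1 + w) =
    ∑ k ∈ Finset.range (n + 1), hpA γ τ k * ((n.choose k : ℂ) * w ^ k) := by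
  rw [hpP_eval]
  refine Finset.sum_congr rfl fun k _ => ?_
  rw [show 1 - (1 + w) = (-1) * w by ring, mul_pow]
  have e2 : ((-1 : ℂ)) ^ k * (-1) ^ k = 1 := by
    rw [← mul_pow]; simp
  linear_combination ((n.choose k : ℂ) * hpA γ τ k * w ^ k) * e2

lemma hp_choose_bound (n k : ℕ) (w : ℂ) (R : ℝ) (hR : n * ‖w‖ ≤ R) :
    ‖(n.choose k : ℂ) * w ^ k‖ ≤ R ^ k / k.factorial := by
  rw [norm_mul, norm_pow, Complex.norm_natCast]
  have h1 : (n.choose k : ℝ) ≤ (n:ℝ) ^ k / k.factorial := Nat.choose_le_pow_div k n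
  calc (n.choose k : ℝ) * ‖w‖ ^ k ≤ (n:ℝ) ^ k / k.factorial * ‖w‖ ^ k := by gcongr
    _ = (n * ‖w‖) ^ k / k.factorial := by rw [mul_pow]; ring
    _ ≤ _ := by gcongr

lemma hpP_bound (γ τ : ℝ) (hγ : -(1/2) < γ) (n : ℕ) (w : ℂ) (R : ℝ) (hR : n * ‖w‖ ≤ R) :
    ‖(hpP γ τ n).eval (1 + w)‖ ≤ Real.exp (hpB γ τ * R) := by
  have hB := hpB_pos γ τ hγ
  have hR0 : 0 ≤ R := le_trans (by positivity) hR
  rw [hpP_eval']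
  refine (norm_sum_le _ _).trans ?_
  refine le_trans ?_ (Real.sum_le_exp_of_nonneg (by positivity) (n + 1))
  refine Finset.sum_le_sum fun k _ => ?_
  rw [norm_mul, mul_pow, mul_div_assoc]
  have := hpA_bound γ τ hγ k
  have := hp_choose_bound n k w R hR
  gcongr

lemma hp_choose_tendsto {ι : Type*} {l : Filter ι} {j : ι → ℕ} {w : ι → ℂ} {x : ℂ}
    (hw : Tendsto w l (𝓝 0)) (hj : Tendsto (fun i => (j i : ℂ) * w i) l (𝓝 x)) (k : ℕ) :
    Tendsto (fun i => ((j i).choose k : ℂ) * w i ^ k) l (𝓝 (x ^ k / k.factorial)) := by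
  induction k with
  | zero => simpa using tendsto_const_nhds
  | succ k ih =>
    have h1 : Tendsto (fun i => ((j i).choose k : ℂ) * w i ^ k * ((j i : ℂ) * w i - k * w i) / (k + 1)) l
        (𝓝 (x ^ k / k.factorial * (x - k * 0) / (k + 1))) :=
      (ih.mul (hj.sub (hw.const_mul _))).div_const _
    have hk : (k + 1 : ℂ) ≠ 0 := by exact_mod_cast Nat.succ_ne_zero k
    have hf : (k.factorial : ℂ) ≠ 0 := by exact_mod_cast Nat.factorial_ne_zero k
    convert h1 using 2 with i
    · have h2 : ((j i).choose (k + 1) : ℂ) * (k + 1) = (j i).choose k * ((j i : ℂ) - k) := by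
        have := Nat.choose_succ_right_eq (j i) k
        rcases le_or_gt k (j i) with hkj | hkj
        · rw [← Nat.cast_sub hkj]; exact_mod_cast this
        · rw [Nat.choose_eq_zero_of_lt hkj, Nat.choose_eq_zero_of_lt (by omega)]; simp
      rw [eq_div_iff hk]
      linear_combination w i ^ (k + 1) * h2
    · rw [Nat.factorial_succ]; push_cast
      field_simp
      ring

lemma hpP_tendsto (γ τ : ℝ) (hγ : -(1/2) < γ) {ι : Type*} {l : Filter ι} {j : ι → ℕ} {w : ι → ℂ}
    {x : ℂ} (hw : Tendsto w l (𝓝 0)) (hj : Tendsto (fun i => (j i : ℂ) * w i) l (𝓝 x)) :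
    Tendsto (fun i => (hpP γ τ (j i)).eval (1 + w i)) l (𝓝 (hpF γ τ x)) := by
  have hB := hpB_pos γ τ hγ
  have e : ∀ i, (hpP γ τ (j i)).eval (1 + w i) =
      ∑' k : ℕ, hpA γ τ k * (((j i).choose k : ℂ) * w i ^ k) := by
    intro i
    rw [hpP_eval', tsum_eq_sum]
    intro k hk
    rw [Nat.choose_eq_zero_of_lt (by simpa using hk)]; simp
  simp_rw [e]
  refine tendsto_tsum_of_dominated_convergence (hp_summ (hpB γ τ) (‖x‖ + 1)) ?_ ?_
  · intro k
    exact (hp_choose_tendsto hw hj k).const_mul _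
  · have h1 : ∀ᶠ i in l, ‖(j i : ℂ) * w i‖ < ‖x‖ + 1 :=
      hj.norm.eventually_lt_const (by linarith)
    filter_upwards [h1] with i hi k
    rw [norm_mul, Complex.norm_natCast] at hi
    rw [norm_mul]
    have := hpA_bound γ τ hγ k
    have := hp_choose_bound (j i) k (w i) _ hi.le
    gcongr

lemma hp_w_tendsto (a : ℂ) :
    Tendsto (fun p : ℕ × ℂ => Complex.exp (Complex.I * p.2 / p.1) - 1) (atTop ×ˢ 𝓝 a) (𝓝 0) ∧
    Tendsto (fun p : ℕ × ℂ => ((p.1 : ℂ) + 1) * (Complex.exp (Complex.I * p.2 / p.1) - 1))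
      (atTop ×ˢ 𝓝 a) (𝓝 (Complex.I * a)) := by
  have hinv : Tendsto (fun n : ℕ => ((n : ℂ))⁻¹) atTop (𝓝 0) := tendsto_inv_atTop_nhds_zero_nat
  have h0 : Tendsto (fun p : ℕ × ℂ => ((p.1 : ℂ))⁻¹) (atTop ×ˢ 𝓝 a) (𝓝 0) := hinv.comp tendsto_fst
  have hb : Tendsto (fun p : ℕ × ℂ => p.2) (atTop ×ˢ 𝓝 a) (𝓝 a) := tendsto_snd
  have h1 : Tendsto (fun p : ℕ × ℂ => Complex.I * p.2 / p.1) (atTop ×ˢ 𝓝 a) (𝓝 0) := by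
    have := (hb.const_mul Complex.I).mul h0
    simpa [div_eq_mul_inv] using this
  have hw : Tendsto (fun p : ℕ × ℂ => Complex.exp (Complex.I * p.2 / p.1) - 1) (atTop ×ˢ 𝓝 a) (𝓝 0) := by
    have := ((Complex.continuous_exp.tendsto 0).comp h1).sub_const 1
    simpa using this
  refine ⟨hw, ?_⟩
  have hE : Tendsto (dslope Complex.exp 0) (𝓝 0) (𝓝 1) := by
    have : ContinuousAt (dslope Complex.exp 0) 0 :=
      continuousAt_dslope_same.2 Complex.differentiable_exp.differentiableAt
    have h := this.tendsto
    rw [dslope_same] at h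
    simpa using h
  have h2 : Tendsto (fun p : ℕ × ℂ => Complex.I * p.2 * dslope Complex.exp 0 (Complex.I * p.2 / p.1) +
      (Complex.exp (Complex.I * p.2 / p.1) - 1))
      (atTop ×ˢ 𝓝 a) (𝓝 (Complex.I * a * 1 + 0)) :=
    ((hb.const_mul _).mul (hE.comp h1)).add hw
  rw [mul_one, add_zero] at h2
  refine h2.congr' ?_
  have hn : ∀ᶠ p : ℕ × ℂ in atTop ×ˢ 𝓝 a, p.1 ≠ 0 :=
    tendsto_fst.eventually (eventually_ne_atTop 0)
  filter_upwards [hn] with p hp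
  have hp' : (p.1 : ℂ) ≠ 0 := by exact_mod_cast hp
  have h3 := sub_smul_dslope Complex.exp 0 (Complex.I * p.2 / p.1)
  simp only [sub_zero, smul_eq_mul, Complex.exp_zero] at h3
  rw [add_mul, ← h3]
  field_simp

def hpd (γ : ℝ) (j : ℕ) : ℝ := rf (2 * γ + 1) j / j.factorial

lemma hpd_pos (γ : ℝ) (hγ : -(1/2) < γ) (j : ℕ) : 0 < hpd γ j := by
  have := rf_pos (2 * γ + 1) (by linarith) j
  unfold hpd; positivity

lemma hpd_tendsto (γ : ℝ) (hγ : -(1/2) < γ) :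
    Tendsto (fun j : ℕ => hpd γ j / ((j : ℝ) + 1) ^ (2 * γ)) atTop
      (𝓝 (Real.Gamma (2 * γ + 1))⁻¹) := by
  have hc : 0 < 2 * γ + 1 := by linarith
  have hG := Real.Gamma_pos_of_pos hc
  have h1 := (Real.GammaSeq_tendsto_Gamma (2 * γ + 1)).inv₀ hG.ne'
  have h2 : Tendsto (fun j : ℕ => (j : ℝ) / (j + (2 * γ + 1))) atTop (𝓝 1) :=
    tendsto_natCast_div_add_atTop _
  have h3 : Tendsto (fun j : ℕ => ((j : ℝ) / (j + 1)) ^ (2 * γ)) atTop (𝓝 1) := by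
    have := (tendsto_natCast_div_add_atTop (1:ℝ)).rpow_const (p := 2 * γ) (Or.inl one_ne_zero)
    simpa using this
  have h4 := (h1.mul h2).mul h3
  rw [mul_one, mul_one] at h4
  refine h4.congr' ?_
  filter_upwards [eventually_ge_atTop 1] with j hj
  have hj' : (0:ℝ) < j := by exact_mod_cast hj
  have hr := rf_pos (2 * γ + 1) hc j
  have hr2 : ∏ i ∈ Finset.range (j + 1), (2 * γ + 1 + (i:ℝ)) = rf (2 * γ + 1) j * (2 * γ + 1 + j) :=
    rf_succ _ _
  unfold hpd Real.GammaSeq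
  rw [hr2, Real.rpow_add hj', Real.rpow_one, Real.div_rpow hj'.le (by positivity)]
  have p1 : 0 < (j:ℝ) ^ (2 * γ) := by positivity
  have p2 : 0 < ((j:ℝ) + 1) ^ (2 * γ) := by positivity
  have p3 : 0 < (j:ℝ) + (2 * γ + 1) := by positivity
  have p4 : 0 < (2 * γ + 1) + (j:ℝ) := by positivity
  have p5 : (0:ℝ) < j.factorial := by positivity
  generalize (j:ℝ) ^ (2 * γ) = X at *
  generalize ((j:ℝ) + 1) ^ (2 * γ) = Y at *
  generalize rf (2 * γ + 1) j = Z at *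
  rw [show (j:ℝ) + (2 * γ + 1) = 2 * γ + 1 + j by ring] at *
  generalize 2 * γ + 1 + (j:ℝ) = V at *
  field_simp

lemma hp_floor_integral (f : ℕ → ℝ) (N : ℕ) (hN : 0 < N) :
    ∫ t in (0:ℝ)..1, f ⌊(N:ℝ) * t⌋₊ = (N:ℝ)⁻¹ * ∑ j ∈ Finset.range N, f j := by
  have hN' : (N:ℝ) ≠ 0 := by exact_mod_cast hN.ne'
  have h1 := intervalIntegral.integral_comp_mul_left (a := 0) (b := 1)
    (fun x : ℝ => f ⌊x⌋₊) hN'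
  rw [h1, mul_zero, mul_one, smul_eq_mul]
  congr 1
  have hpiece : ∀ j : ℕ, EqOn (fun x : ℝ => f ⌊x⌋₊) (fun _ => f j) (Ioo (j:ℝ) ((j+1 : ℕ):ℝ)) := by
    intro j x hx
    have : ⌊x⌋₊ = j := by
      rw [Nat.floor_eq_iff (le_trans (by positivity) hx.1.le)]
      refine ⟨hx.1.le, ?_⟩
      have := hx.2; push_cast at this; exact this
    simp [this]
  have hint : ∀ j < N, IntervalIntegrable (fun x : ℝ => f ⌊x⌋₊) volume (j:ℝ) ((j+1 : ℕ):ℝ) := by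
    intro j _
    have hle : (j:ℝ) ≤ ((j+1 : ℕ):ℝ) := by push_cast; linarith
    rw [intervalIntegrable_iff_integrableOn_Ioo_of_le hle, integrableOn_congr_fun (hpiece j) measurableSet_Ioo]
    exact integrableOn_const (by simp)
  have h2 := intervalIntegral.sum_integral_adjacent_intervals (a := fun j : ℕ => (j:ℝ)) hint
  rw [Nat.cast_zero] at h2
  rw [← h2]
  refine Finset.sum_congr rfl fun j _ => ?_
  have hle : (j:ℝ) ≤ ((j+1 : ℕ):ℝ) := by push_cast; linarith
  rw [intervalIntegral.integral_of_le hle, integral_Ioc_eq_integral_Ioo,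
    setIntegral_congr_fun measurableSet_Ioo (hpiece j)]
  simp

def hpS (γ τ : ℝ) (a : ℂ) : ℝ :=
  ∫ t in (0:ℝ)..1, (Real.Gamma (2 * γ + 1))⁻¹ * t ^ (2 * γ) * ‖hpF γ τ (t * (Complex.I * a))‖ ^ 2

lemma hpS_pos (γ τ : ℝ) (hγ : -(1/2) < γ) (a : ℂ) : 0 < hpS γ τ a := by
  have hG := Real.Gamma_pos_of_pos (show 0 < 2 * γ + 1 by linarith)
  have hFc := hpF_cont γ τ hγ
  have hc : Continuous fun t : ℝ => ‖hpF γ τ (t * (Complex.I * a))‖ ^ 2 := by fun_prop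
  have hint : IntervalIntegrable (fun t : ℝ => (Real.Gamma (2 * γ + 1))⁻¹ * t ^ (2 * γ) *
      ‖hpF γ τ (t * (Complex.I * a))‖ ^ 2) volume 0 1 :=
    ((intervalIntegral.intervalIntegrable_rpow' (by linarith)).const_mul _).mul_continuousOn
      hc.continuousOn
  have h0 : ∀ᶠ t : ℝ in 𝓝 0, 0 < ‖hpF γ τ (t * (Complex.I * a))‖ ^ 2 := by
    have := hc.tendsto 0
    refine this.eventually_const_lt ?_
    simp [hpF_zero]
  obtain ⟨δ, hδ, hball⟩ := Metric.eventually_nhds_iff.1 h0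
  set δ' := min (δ / 2) 1 with hδ'
  have hd0 : 0 < δ' := by positivity
  have hd1 : δ' ≤ 1 := min_le_right _ _
  have hint' := hint.mono_set (c := 0) (d := δ') (by
    rw [uIcc_of_le hd0.le, uIcc_of_le zero_le_one]; exact Icc_subset_Icc le_rfl hd1)
  have hpos := intervalIntegral.intervalIntegral_pos_of_pos_on hint' (fun t ht => by
    have h1 := hball (y := t) (by
      rw [dist_zero_right, Real.norm_of_nonneg ht.1.le]
      have := ht.2.trans_le (min_le_left (δ / 2) 1); linarith)
    have h2 := Real.rpow_pos_of_pos ht.1 (2 * γ)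
    positivity) hd0
  refine hpos.trans_le ?_
  unfold hpS
  refine intervalIntegral.integral_mono_interval le_rfl hd0.le hd1 ?_ hint
  filter_upwards [ae_restrict_mem measurableSet_Ioc] with t ht
  have h2 := Real.rpow_nonneg ht.1.le (2 * γ)
  simp only [Pi.zero_apply]
  positivity

lemma hp_floor_lim (t : ℝ) (ht : 0 ≤ t) :
    Tendsto (fun n : ℕ => (⌊((n + 1 : ℕ) : ℝ) * t⌋₊ : ℝ) / ((n + 1 : ℕ) : ℝ)) atTop (𝓝 t) := by
  have h := (tendsto_nat_floor_mul_div_atTop ht).comp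
    ((tendsto_natCast_atTop_atTop (R := ℝ)).comp (tendsto_add_atTop_nat 1))
  refine h.congr fun n => ?_
  simp [mul_comm]

lemma hp_int_lim (γ τ : ℝ) (hγ : -(1/2) < γ) (a : ℂ) :
    Tendsto (fun p : ℕ × ℂ => ∫ t in (0:ℝ)..1,
        (fun j : ℕ => hpd γ j / ((p.1 + 1 : ℕ) : ℝ) ^ (2 * γ) *
          ‖(hpP γ τ j).eval (Complex.exp (Complex.I * p.2 / p.1))‖ ^ 2) ⌊((p.1 + 1 : ℕ) : ℝ) * t⌋₊)
      (atTop ×ˢ 𝓝 a) (𝓝 (hpS γ τ a)) := by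
  obtain ⟨hw, hnw⟩ := hp_w_tendsto a
  obtain ⟨D, hD⟩ := (hpd_tendsto γ hγ).bddAbove_range
  have hD' : ∀ j : ℕ, hpd γ j / ((j : ℝ) + 1) ^ (2 * γ) ≤ D := fun j => hD ⟨j, rfl⟩
  have hD0 : 0 ≤ D := le_trans (by have := hpd_pos γ hγ 0; positivity) (hD' 0)
  set R := ‖Complex.I * a‖ + 1 with hR
  have hxe : ∀ (j N : ℕ), 0 < N → hpd γ j / (N : ℝ) ^ (2 * γ) =
      hpd γ j / ((j : ℝ) + 1) ^ (2 * γ) * (((j:ℝ) + 1) / N) ^ (2 * γ) := by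
    intro j N hN
    have hN' : (0:ℝ) < N := by exact_mod_cast hN
    rw [Real.div_rpow (by positivity) hN'.le]
    have p1 : 0 < ((j:ℝ) + 1) ^ (2 * γ) := by positivity
    have p2 : 0 < (N:ℝ) ^ (2 * γ) := by positivity
    field_simp
  refine intervalIntegral.tendsto_integral_filter_of_dominated_convergence
    (fun t => D * (t ^ (2 * γ) + 2 ^ (2 * γ)) * Real.exp (hpB γ τ * R) ^ 2) ?_ ?_ ?_ ?_
  · refine Eventually.of_forall fun p => ?_
    exact ((measurable_from_top (f := (fun j : ℕ => hpd γ j / ((p.1 + 1 : ℕ) : ℝ) ^ (2 * γ) *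
          ‖(hpP γ τ j).eval (Complex.exp (Complex.I * p.2 / p.1))‖ ^ 2))).comp
      (Nat.measurable_floor.comp (measurable_const_mul _))).aestronglyMeasurable
  · have h1 : ∀ᶠ p : ℕ × ℂ in atTop ×ˢ 𝓝 a,
        ‖((p.1 : ℂ) + 1) * (Complex.exp (Complex.I * p.2 / p.1) - 1)‖ < R :=
      hnw.norm.eventually_lt_const (by linarith)
    filter_upwards [h1] with p hp
    refine Eventually.of_forall fun t ht => ?_
    rw [uIoc_of_le zero_le_one] at ht
    set N := p.1 + 1 with hN
    have hNpos : (0:ℝ) < N := by positivity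
    have hNt : 0 ≤ (N:ℝ) * t := mul_nonneg hNpos.le ht.1.le
    set j := ⌊(N : ℝ) * t⌋₊ with hj
    have hj1 : (j:ℝ) ≤ N * t := Nat.floor_le hNt
    have hj2 : (N:ℝ) * t < j + 1 := Nat.lt_floor_add_one _
    have hjN : (j:ℝ) ≤ N := hj1.trans (by nlinarith [ht.2])
    rw [hxe j N (by omega), Real.norm_of_nonneg (by have := hpd_pos γ hγ j; positivity)]
    have hP : ‖(hpP γ τ j).eval (Complex.exp (Complex.I * p.2 / p.1))‖ ≤ Real.exp (hpB γ τ * R) := by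
      have := hpP_bound γ τ hγ j (Complex.exp (Complex.I * p.2 / p.1) - 1) R (by
        refine le_trans ?_ hp.le
        rw [norm_mul]
        have e : ‖(p.1 : ℂ) + 1‖ = (N:ℝ) := by
          rw [hN, ← Complex.norm_natCast]; push_cast; rfl
        rw [e]; gcongr)
      rwa [add_sub_cancel] at this
    have hx1 : t ≤ ((j:ℝ) + 1) / N := by
      rw [le_div_iff₀ hNpos]; linarith
    have hx2 : ((j:ℝ) + 1) / N ≤ 2 := by
      rw [div_le_iff₀ hNpos]
      have : (1:ℝ) ≤ N := by rw [hN]; push_cast; linarith [Nat.cast_nonneg (α := ℝ) p.1]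
      linarith
    have hx : (((j:ℝ) + 1) / N) ^ (2 * γ) ≤ t ^ (2 * γ) + 2 ^ (2 * γ) := by
      have q1 : (0:ℝ) ≤ t ^ (2 * γ) := Real.rpow_nonneg ht.1.le _
      have q2 : (0:ℝ) ≤ 2 ^ (2 * γ) := by positivity
      rcases le_total 0 γ with hg | hg
      · have := Real.rpow_le_rpow (by positivity) hx2 (show 0 ≤ 2 * γ by linarith)
        linarith
      · have := Real.rpow_le_rpow_of_nonpos ht.1 hx1 (show 2 * γ ≤ 0 by linarith)
        linarith
    have := hD' j
    have q0 : (0:ℝ) ≤ t ^ (2 * γ) + 2 ^ (2 * γ) := le_trans (by positivity) hx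
    have q5 : (0:ℝ) ≤ D * (t ^ (2 * γ) + 2 ^ (2 * γ)) := mul_nonneg hD0 q0
    gcongr
  · refine IntervalIntegrable.mul_const (IntervalIntegrable.const_mul ?_ _) _
    exact (intervalIntegral.intervalIntegrable_rpow' (by linarith)).add intervalIntegrable_const
  · refine Eventually.of_forall fun t ht => ?_
    rw [uIoc_of_le zero_le_one] at ht
    have hfl := hp_floor_lim t ht.1.le
    have hfl' : Tendsto (fun p : ℕ × ℂ => (⌊((p.1 + 1 : ℕ) : ℝ) * t⌋₊ : ℝ) / ((p.1 + 1 : ℕ) : ℝ))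
      (atTop ×ˢ 𝓝 a) (𝓝 t) := hfl.comp tendsto_fst
    have hinf : Tendsto (fun p : ℕ × ℂ => ⌊((p.1 + 1 : ℕ) : ℝ) * t⌋₊) (atTop ×ˢ 𝓝 a) atTop := by
      have : Tendsto (fun n : ℕ => ((n + 1 : ℕ) : ℝ) * t) atTop atTop :=
        ((tendsto_natCast_atTop_atTop (R := ℝ)).comp (tendsto_add_atTop_nat 1)).atTop_mul_const ht.1
      exact (tendsto_nat_floor_atTop.comp this).comp tendsto_fst
    have hd := (hpd_tendsto γ hγ).comp hinf
    have hone : Tendsto (fun p : ℕ × ℂ => (((p.1 + 1 : ℕ) : ℝ))⁻¹) (atTop ×ˢ 𝓝 a) (𝓝 0) :=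
      ((tendsto_inv_atTop_nhds_zero_nat (𝕜 := ℝ)).comp (tendsto_add_atTop_nat 1)).comp tendsto_fst
    have hx : Tendsto (fun p : ℕ × ℂ => (((⌊((p.1 + 1 : ℕ) : ℝ) * t⌋₊ : ℝ) + 1) / ((p.1 + 1 : ℕ) : ℝ)) ^ (2 * γ))
      (atTop ×ˢ 𝓝 a) (𝓝 (t ^ (2 * γ))) := by
      have := (hfl'.add hone).rpow_const (p := 2 * γ) (Or.inl (by simpa using ht.1.ne'))
      rw [add_zero] at this
      refine this.congr fun p => ?_
      congr 1; ring
    have hP : Tendsto (fun p : ℕ × ℂ => (hpP γ τ ⌊((p.1 + 1 : ℕ) : ℝ) * t⌋₊).eval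
        (1 + (Complex.exp (Complex.I * p.2 / p.1) - 1))) (atTop ×ˢ 𝓝 a)
        (𝓝 (hpF γ τ (t * (Complex.I * a)))) := by
      refine hpP_tendsto γ τ hγ hw ?_
      have h1 : Tendsto (fun p : ℕ × ℂ => (((⌊((p.1 + 1 : ℕ) : ℝ) * t⌋₊ : ℝ) / ((p.1 + 1 : ℕ) : ℝ) : ℝ) : ℂ))
        (atTop ×ˢ 𝓝 a) (𝓝 (t : ℂ)) := (Complex.continuous_ofReal.tendsto t).comp hfl'
      refine (h1.mul hnw).congr fun p => ?_
      have : (p.1 : ℂ) + 1 ≠ 0 := by exact_mod_cast Nat.succ_ne_zero p.1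
      push_cast
      field_simp
    simp only [add_sub_cancel] at hP
    refine ((hd.mul hx).mul (hP.norm.pow 2)).congr fun p => ?_
    simp only [Function.comp]
    rw [hxe _ (p.1 + 1) (by omega)]

lemma hp_main (γ τ : ℝ) (hγ : -(1/2) < γ) (a : ℂ) :
    Tendsto (fun p : ℕ × ℂ => (p.1 : ℝ) ^ (2 * γ + 1) *
        christoffel (huaPickrell γ τ) p.1 (Complex.exp (Complex.I * p.2 / (p.1:ℂ))))
      (atTop ×ˢ 𝓝 a) (𝓝 ((hpM γ τ 0 0).re * (hpS γ τ a)⁻¹)) := by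
  obtain ⟨m, hm, em⟩ := hpM_zero γ τ hγ
  have h1 := (hp_int_lim γ τ hγ a).inv₀ (hpS_pos γ τ hγ a).ne'
  have h2 : Tendsto (fun p : ℕ × ℂ => ((p.1 : ℝ) / (p.1 + 1)) ^ (2 * γ + 1)) (atTop ×ˢ 𝓝 a) (𝓝 1) := by
    have := (tendsto_natCast_div_add_atTop (1:ℝ)).rpow_const (p := 2 * γ + 1) (Or.inl one_ne_zero)
    rw [Real.one_rpow] at this
    exact this.comp tendsto_fst
  have h3 := (h2.mul h1).const_mul m
  rw [one_mul] at h3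
  rw [em, Complex.ofReal_re]
  refine h3.congr fun p => ?_
  rw [hp_floor_integral (fun j : ℕ => hpd γ j / ((p.1 + 1 : ℕ) : ℝ) ^ (2 * γ) *
    ‖(hpP γ τ j).eval (Complex.exp (Complex.I * p.2 / p.1))‖ ^ 2) (p.1 + 1) (Nat.succ_pos _),
    hp_lambda γ τ hγ]
  have e : ∀ j, ‖(hpP γ τ j).eval (Complex.exp (Complex.I * p.2 / p.1))‖ ^ 2 / hph γ τ j =
      m⁻¹ * (hpd γ j * ‖(hpP γ τ j).eval (Complex.exp (Complex.I * p.2 / p.1))‖ ^ 2) := by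
    intro j
    have := rf_pos (2 * γ + 1) (by linarith) j
    unfold hph hpd
    rw [em, Complex.ofReal_re]
    field_simp
  simp_rw [e]
  have e2 : ∀ j, hpd γ j / ((p.1 + 1 : ℕ) : ℝ) ^ (2 * γ) *
      ‖(hpP γ τ j).eval (Complex.exp (Complex.I * p.2 / p.1))‖ ^ 2 =
      (((p.1 + 1 : ℕ) : ℝ) ^ (2 * γ))⁻¹ *
        (hpd γ j * ‖(hpP γ τ j).eval (Complex.exp (Complex.I * p.2 / p.1))‖ ^ 2) := by
    intro j; ring
  simp_rw [e2]
  rw [← Finset.mul_sum, ← Finset.mul_sum]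
  have hp : (0:ℝ) < (p.1 : ℝ) + 1 := by positivity
  push_cast
  rw [Real.div_rpow (by positivity) hp.le, Real.rpow_add hp, Real.rpow_one]
  have p1 : 0 < ((p.1 : ℝ) + 1) ^ (2 * γ) := by positivity
  simp only [mul_inv, inv_inv]
  field_simp

end HPaux

/-- **Lemma 2.5.** Uniform asymptotics of the Christoffel function of the Hua–Pickrell
measure. -/
theorem statement_10 (γ τ : ℝ) (hγ : -(1/2) < γ) :
    ∃ G : ℂ → ℝ, Continuous G ∧ (∀ a, 0 < G a) ∧
      ∀ K : Set ℂ, IsCompact K →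
        TendstoUniformlyOn
          (fun (n : ℕ) (a : ℂ) =>
            (n : ℝ) ^ (2 * γ + 1) *
              christoffel (huaPickrell γ τ) n (Complex.exp (Complex.I * a / (n:ℂ))))
          G atTop K := by
  exact ⟨fun a => (hpM γ τ 0 0).re * (hpS γ τ a)⁻¹, hp_cont_of_joint (F := fun (n : ℕ) (a : ℂ) => (n : ℝ) ^ (2 * γ + 1) *
      christoffel (huaPickrell γ τ) n (Complex.exp (Complex.I * a / (n:ℂ)))) (hp_main γ τ hγ), fun a => by
    obtain ⟨m, hm, em⟩ := hpM_zero γ τ hγ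
    have := hpS_pos γ τ hγ a
    rw [em, Complex.ofReal_re]
    positivity, fun K hK => hp_unif_of_joint (F := fun (n : ℕ) (a : ℂ) => (n : ℝ) ^ (2 * γ + 1) *
      christoffel (huaPickrell γ τ) n (Complex.exp (Complex.I * a / (n:ℂ)))) (hp_main γ τ hγ) K hK⟩
end

section
/- For every compact set K ⊆ ℂ there is a constant C_K > 0 such that for all a ∈ K, all n ∈ ℕ, all θ ∈ ℝ, and all r > 0, |(e^{iθ} + e^{ia/n})/(2e^{ia/n})|^{rn} ≤ e^{C_K·r·|a|/2}. -/
open MeasureTheory Filter Set Topology ComplexConjugate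

/-- **Lemma 2.7.** A uniform elementary bound. -/
theorem statement_11 :
    ∀ K : Set ℂ, IsCompact K → ∃ C : ℝ, 0 < C ∧
      ∀ a ∈ K, ∀ n : ℕ, 0 < n → ∀ θ : ℝ, ∀ r : ℝ, 0 < r →
        ‖(Complex.exp (Complex.I * (θ:ℂ)) + Complex.exp (Complex.I * a / (n:ℂ)))
            / (2 * Complex.exp (Complex.I * a / (n:ℂ)))‖ ^ (r * (n:ℝ))
          ≤ Real.exp (C * r * ‖a‖ / 2) := by
  intro K _
  refine ⟨2, by norm_num, ?_⟩
  intro a _ n hn θ r hr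
  have hn' : (0:ℝ) < n := by exact_mod_cast hn
  set w : ℂ := Complex.I * a / (n:ℂ) with hw
  have hwn : ‖w‖ = ‖a‖ / n := by simp [hw]
  have h1 : ‖(Complex.exp (Complex.I * (θ:ℂ)) + Complex.exp w) / (2 * Complex.exp w)‖
      ≤ Real.exp (‖a‖ / n) := by
    have e : (Complex.exp (Complex.I * (θ:ℂ)) + Complex.exp w) / (2 * Complex.exp w)
        = (Complex.exp (Complex.I * (θ:ℂ)) * Complex.exp (-w) + 1) / 2 := by
      rw [Complex.exp_neg]
      have := Complex.exp_ne_zero w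
      field_simp
    have hE : ‖Complex.exp (Complex.I * (θ:ℂ))‖ = 1 := by
      rw [mul_comm]; exact Complex.norm_exp_ofReal_mul_I θ
    have hF : ‖Complex.exp (-w)‖ ≤ Real.exp (‖a‖ / n) := by
      have := Complex.norm_exp_le_exp_norm (-w)
      rwa [norm_neg, hwn] at this
    have h1 : 1 ≤ Real.exp (‖a‖ / n) := Real.one_le_exp (by positivity)
    have h3 := norm_add_le (Complex.exp (Complex.I * (θ:ℂ)) * Complex.exp (-w)) 1
    rw [norm_mul, hE, norm_one] at h3
    rw [e, norm_div, Complex.norm_ofNat]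
    linarith
  calc _ ≤ (Real.exp (‖a‖ / n)) ^ (r * (n:ℝ)) :=
        Real.rpow_le_rpow (norm_nonneg _) h1 (by positivity)
    _ = Real.exp (2 * r * ‖a‖ / 2) := by
        rw [← Real.exp_mul]
        congr 1
        field_simp
end

section
/- Fix r ∈ (0,1) and m ∈ ℕ, and let μ₀ be the restriction of planar Lebesgue (area) measure to G_{r,m}. Then for every z₀ ∈ ∂G_{r,m}, lim_{n→∞} K_n(z₀, z₀; μ₀) = ∞. -/
open MeasureTheory Filter Set Topology ComplexConjugate

theorem aux_expand (φ : ℕ → Polynomial ℂ) (hd : ∀ n, (φ n).natDegree = n)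
    (h0 : ∀ n, φ n ≠ 0) : ∀ (n : ℕ) (P : Polynomial ℂ), P.degree < n →
    ∃ c : ℕ → ℂ, P = ∑ j ∈ Finset.range n, Polynomial.C (c j) * φ j := by
  intro n
  induction n with
  | zero =>
    intro P hP
    refine ⟨fun _ => 0, ?_⟩
    simpa using hP
  | succ n ih =>
    intro P hP
    have hl : (φ n).coeff n ≠ 0 := by
      have := Polynomial.leadingCoeff_ne_zero.mpr (h0 n)
      rwa [Polynomial.leadingCoeff, hd n] at this
    set a := P.coeff n / (φ n).coeff n with ha
    have hQ : (P - Polynomial.C a * φ n).degree < n := by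
      rw [Polynomial.degree_lt_iff_coeff_zero] at hP ⊢
      intro k hk
      rcases Nat.eq_or_lt_of_le hk with rfl | hk
      · simp [ha, hl]
      · rw [Polynomial.coeff_sub, Polynomial.coeff_C_mul, hP k hk,
          Polynomial.coeff_eq_zero_of_natDegree_lt (by rw [hd]; exact hk)]
        simp
    obtain ⟨c, hc⟩ := ih _ hQ
    refine ⟨fun j => if j = n then a else c j, ?_⟩
    simp only [Finset.sum_range_succ, if_true]
    rw [← sub_eq_iff_eq_add, hc]
    refine Finset.sum_congr rfl fun j hj => ?_
    rw [if_neg (Finset.mem_range.mp hj).ne]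

theorem aux_kernel_re (φ : ℕ → Polynomial ℂ) (n : ℕ) (z : ℂ) :
    (repKernel φ n z z).re = ∑ j ∈ Finset.range (n + 1), ‖(φ j).eval z‖ ^ 2 := by
  unfold repKernel
  rw [Complex.re_sum]
  refine Finset.sum_congr rfl fun j _ => ?_
  rw [Complex.mul_conj, Complex.ofReal_re, Complex.normSq_eq_norm_sq]

theorem aux_bounded (r : ℝ) (hr0 : 0 < r) (hr1 : r < 1) (m : ℕ) (hm : 1 ≤ m) :
    lemniscate r m ⊆ Metric.closedBall 0 2 := by
  intro z hz
  have hz : ‖z ^ m - 1‖ < r ^ m := hz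
  have hR : r ^ m ≤ 1 := pow_le_one₀ hr0.le hr1.le
  have h1 : ‖z ^ m‖ ≤ 2 := by
    have := norm_sub_norm_le (z ^ m) 1
    rw [norm_one] at this
    linarith
  rw [mem_closedBall_zero_iff]
  by_contra! h
  have : ‖z‖ ≤ ‖z‖ ^ m := le_self_pow₀ (by linarith) (by omega)
  rw [norm_pow] at h1
  linarith

theorem aux_integrable (r : ℝ) (hr0 : 0 < r) (hr1 : r < 1) (m : ℕ) (hm : 1 ≤ m)
    {f : ℂ → ℂ} (hf : Continuous f) : Integrable f (volume.restrict (lemniscate r m)) :=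
  (hf.continuousOn.integrableOn_compact (isCompact_closedBall (0:ℂ) 2)).mono_set
    (aux_bounded r hr0 hr1 m hm)

theorem aux_cs (μ : Measure ℂ) (hint : ∀ f : ℂ → ℂ, Continuous f → Integrable f μ)
    (φ : ℕ → Polynomial ℂ) (κ : ℕ → ℝ) (hON : IsOrthonormalPolys μ φ κ)
    (n : ℕ) (P : Polynomial ℂ) (hP : P.natDegree ≤ n) (z : ℂ) :
    ‖P.eval z‖ ^ 2 ≤ (repKernel φ n z z).re * ∫ w, ‖P.eval w‖ ^ 2 ∂μ := by
  have h0 : ∀ n, φ n ≠ 0 := by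
    intro n h
    have h1 := hON.lead_eq n
    have h2 := hON.lead_pos n
    rw [h, Polynomial.leadingCoeff_zero] at h1
    have : κ n = 0 := by exact_mod_cast h1.symm
    linarith
  obtain ⟨c, hc⟩ := aux_expand φ hON.natDegree_eq h0 (n + 1) P
    ((Polynomial.degree_lt_iff_coeff_zero _ _).2 fun k hk =>
      Polynomial.coeff_eq_zero_of_natDegree_lt (by omega))
  have hev : ∀ w, P.eval w = ∑ j ∈ Finset.range (n + 1), c j * (φ j).eval w := by
    intro w
    conv_lhs => rw [hc]
    simp [Polynomial.eval_finsetSum]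
  have hI : ∫ w, ‖P.eval w‖ ^ 2 ∂μ = ∑ j ∈ Finset.range (n + 1), ‖c j‖ ^ 2 := by
    have key : ∫ w, P.eval w * conj (P.eval w) ∂μ
        = ∑ j ∈ Finset.range (n + 1), c j * conj (c j) := by
      have e : ∀ w, P.eval w * conj (P.eval w) = ∑ i ∈ Finset.range (n + 1),
          ∑ j ∈ Finset.range (n + 1),
          (c i * conj (c j)) * ((φ i).eval w * conj ((φ j).eval w)) := by
        intro w
        rw [hev, map_sum, Finset.sum_mul_sum]
        refine Finset.sum_congr rfl fun i _ => Finset.sum_congr rfl fun j _ => ?_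
        rw [map_mul]; ring
      have hi : ∀ i j, Integrable
          (fun w => (c i * conj (c j)) * ((φ i).eval w * conj ((φ j).eval w))) μ := by
        intro i j
        apply hint
        exact continuous_const.mul ((φ i).continuous.mul
          (Complex.continuous_conj.comp (φ j).continuous))
      simp_rw [e]
      rw [integral_finsetSum _ fun i _ => integrable_finsetSum _ fun j _ => hi i j]
      refine Finset.sum_congr rfl fun i hi' => ?_
      rw [integral_finsetSum _ fun j _ => hi i j]
      simp_rw [integral_const_mul, hON.orthonormal]
      simp only [mul_ite, mul_one, mul_zero]
      rw [Finset.sum_ite_eq, if_pos hi']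
    have e2 : ∀ x : ℂ, x * conj x = ((‖x‖ ^ 2 : ℝ) : ℂ) := by
      intro x
      rw [Complex.mul_conj, Complex.normSq_eq_norm_sq]
    simp_rw [e2] at key
    rw [integral_complex_ofReal] at key
    exact_mod_cast key
  rw [hI, aux_kernel_re, hev]
  calc ‖∑ j ∈ Finset.range (n + 1), c j * (φ j).eval z‖ ^ 2
      ≤ (∑ j ∈ Finset.range (n + 1), ‖(φ j).eval z‖ * ‖c j‖) ^ 2 := by
        gcongr
        refine (norm_sum_le _ _).trans (le_of_eq ?_)
        refine Finset.sum_congr rfl fun j _ => ?_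
        rw [norm_mul, mul_comm]
    _ ≤ _ := Finset.sum_mul_sq_le_sq_mul_sq _ _ _

/-- **Lemma 3.1.** The diagonal reproducing kernel of area measure on the lemniscate
`G_{r,m}` blows up at boundary points. -/
theorem statement_15
    (r : ℝ) (hr0 : 0 < r) (hr1 : r < 1) (m : ℕ) (hm : 1 ≤ m)
    (φ : ℕ → Polynomial ℂ) (κ : ℕ → ℝ)
    (hON : IsOrthonormalPolys (volume.restrict (lemniscate r m)) φ κ) :
    ∀ z₀ ∈ frontier (lemniscate r m),
      Tendsto (fun n : ℕ => (repKernel φ n z₀ z₀).re) atTop atTop := by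
  intro z₀ hz₀
  have hR : 0 < r ^ m := pow_pos hr0 m
  have hu : ‖z₀ ^ m - 1‖ = r ^ m :=
    frontier_lt_subset_eq (f := fun z : ℂ => ‖z ^ m - 1‖) (g := fun _ => r ^ m)
      (by fun_prop) (by fun_prop) hz₀
  set u := z₀ ^ m - 1 with hu_def
  have hu0 : u ≠ 0 := by
    intro h
    rw [h, norm_zero] at hu
    linarith
  let q : Polynomial ℂ := Polynomial.C (2 * u)⁻¹ * (Polynomial.X ^ m - 1 + Polynomial.C u)
  have hq : ∀ z, q.eval z = (2 * u)⁻¹ * (z ^ m - 1 + u) := by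
    intro z; simp [q]
  have hq0 : q.eval z₀ = 1 := by
    rw [hq, ← hu_def]; field_simp; ring
  have hq1 : ∀ z ∈ lemniscate r m, ‖q.eval z‖ < 1 := by
    intro z hz
    have hz : ‖z ^ m - 1‖ < r ^ m := hz
    rw [hq, norm_mul, norm_inv, norm_mul, hu, inv_mul_lt_iff₀ (by simpa using hR)]
    have := norm_add_le (z ^ m - 1) u
    rw [hu] at this
    rw [Complex.norm_ofNat]
    linarith
  have hmeas : MeasurableSet (lemniscate r m) :=
    (isOpen_lt (f := fun z : ℂ => ‖z ^ m - 1‖) (g := fun _ => r ^ m)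
      (by fun_prop) (by fun_prop)).measurableSet
  have hlim : Tendsto (fun k : ℕ => ∫ w in lemniscate r m, ‖(q ^ k).eval w‖ ^ 2) atTop
      (𝓝 (∫ w in lemniscate r m, (0 : ℝ))) := by
    refine tendsto_integral_of_dominated_convergence (fun _ => (1 : ℝ)) ?_ ?_ ?_ ?_
    · intro k
      exact ((q ^ k).continuous.norm.pow 2).aestronglyMeasurable
    · have := (aux_integrable r hr0 hr1 m hm (f := fun _ => (1 : ℂ)) continuous_const).norm
      simpa using this
    · intro k
      refine (ae_restrict_iff' hmeas).2 (Eventually.of_forall fun z hz => ?_)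
      rw [Polynomial.eval_pow, Real.norm_of_nonneg (by positivity), norm_pow]
      exact pow_le_one₀ (by positivity) (pow_le_one₀ (norm_nonneg _) (hq1 z hz).le)
    · refine (ae_restrict_iff' hmeas).2 (Eventually.of_forall fun z hz => ?_)
      have := (tendsto_pow_atTop_nhds_zero_of_lt_one (norm_nonneg _) (hq1 z hz)).pow 2
      simpa using this
  rw [integral_zero] at hlim
  rw [tendsto_atTop]
  intro b
  have hb : 0 < |b| + 1 := by positivity
  obtain ⟨k, hk⟩ := (hlim.eventually (gt_mem_nhds (inv_pos.mpr hb))).exists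
  filter_upwards [eventually_ge_atTop (q ^ k).natDegree] with n hn
  have hcs := aux_cs _ (fun f hf => aux_integrable r hr0 hr1 m hm hf) φ κ hON n (q ^ k) hn z₀
  rw [Polynomial.eval_pow, hq0, one_pow, norm_one, one_pow] at hcs
  by_contra! hlt
  have h1 : (repKernel φ n z₀ z₀).re < |b| + 1 := by linarith [le_abs_self b]
  have hI0 : 0 ≤ ∫ w in lemniscate r m, ‖(q ^ k).eval w‖ ^ 2 :=
    integral_nonneg fun w => by positivity
  have h2 : (|b| + 1) * ∫ w in lemniscate r m, ‖(q ^ k).eval w‖ ^ 2 < 1 := by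
    calc _ < (|b| + 1) * (|b| + 1)⁻¹ := by gcongr
      _ = 1 := mul_inv_cancel₀ hb.ne'
  have h3 := mul_le_mul_of_nonneg_right h1.le hI0
  linarith
end

section
/- Fix r ∈ (0,1), an integer m ≥ 2, and s ∈ {0,1,…,m−2}, and set v = 2 − 2/m − 2s/m. Let μ₀ be the restriction of planar Lebesgue (area) measure to G_{r,m} and let κ_n(μ₀) denote the leading coefficient of the degree-n orthonormal polynomial for μ₀. Then as k → ∞, κ_{km+s}(μ₀)² = ((mk+1+s)·(1 + v/(2k))/(π·r^{2km+2m}))·(1 + O(k^{−2})). -/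
open MeasureTheory Filter Set Topology ComplexConjugate

noncomputable section
def Hx (h : ℕ → ℝ) (z : ℤ) : ℝ := if 0 ≤ z then h z.toNat else 0
def bx (a h : ℕ → ℝ) (n : ℤ) : ℝ := ∑' i : ℕ, a i * Hx h (n + i)
end

structure GoodPair (a h : ℕ → ℝ) (σ : ℝ) : Prop where
  pos : 0 < σ
  lt : σ < 1
  ha : ∀ n, |a n| ≤ σ ^ (2 * n)
  hh : ∀ n, |h n| ≤ σ ^ (2 * n)
  a0 : a 0 = 1
  h0 : h 0 = 1
  conv : ∀ n, ∑ p ∈ Finset.HasAntidiagonal.antidiagonal n, h p.1 * a p.2 = if n = 0 then 1 else 0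

namespace GoodPair
variable {a h : ℕ → ℝ} {σ : ℝ}

lemma Hx_natCast (n : ℕ) : Hx h n = h n := by simp [Hx]
lemma Hx_neg {z : ℤ} (hz : z < 0) : Hx h z = 0 := by simp [Hx, hz]

lemma Hx_le_one (g : GoodPair a h σ) (z : ℤ) : |Hx h z| ≤ 1 := by
  unfold Hx
  split_ifs
  · exact (g.hh _).trans (pow_le_one₀ g.pos.le g.lt.le)
  · simp

lemma term_le (g : GoodPair a h σ) (n : ℤ) (i : ℕ) :
    |a i * Hx h (n + i)| ≤ σ ^ n.natAbs * σ ^ i := by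
  by_cases hz : n + i < 0
  · rw [Hx_neg hz]; simp; exact mul_nonneg (pow_nonneg g.pos.le _) (pow_nonneg g.pos.le _)
  · obtain ⟨t, ht⟩ := Int.eq_ofNat_of_zero_le (not_lt.mp hz)
    rw [ht, abs_mul]
    have : Hx h (Int.ofNat t) = h t := Hx_natCast t
    have e : Hx h (t:ℤ) = h t := Hx_natCast t
    rw [e]
    calc |a i| * |h t| ≤ σ ^ (2 * i) * σ ^ (2 * t) :=
          mul_le_mul (g.ha i) (g.hh t) (abs_nonneg _) (pow_nonneg g.pos.le _)
      _ = σ ^ (2 * i + 2 * t) := by rw [pow_add]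
      _ ≤ σ ^ (n.natAbs + i) := pow_le_pow_of_le_one g.pos.le g.lt.le (by omega)
      _ = _ := by rw [pow_add]

lemma summ_geo (g : GoodPair a h σ) : Summable (fun i : ℕ => σ ^ i) :=
  summable_geometric_of_lt_one g.pos.le g.lt

lemma summ_a (g : GoodPair a h σ) : Summable (fun i => |a i|) :=
  Summable.of_nonneg_of_le (fun _ => abs_nonneg _) (fun i => (g.ha i).trans
    (pow_le_pow_of_le_one g.pos.le g.lt.le (by omega))) g.summ_geo

lemma summ_h (g : GoodPair a h σ) : Summable (fun i => |h i|) :=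
  Summable.of_nonneg_of_le (fun _ => abs_nonneg _) (fun i => (g.hh i).trans
    (pow_le_pow_of_le_one g.pos.le g.lt.le (by omega))) g.summ_geo

lemma summ_nh (g : GoodPair a h σ) : Summable (fun i : ℕ => |(i:ℝ) * h i|) := by
  have := summable_pow_mul_geometric_of_norm_lt_one (R := ℝ) 1 (r := σ)
    (by rw [Real.norm_of_nonneg g.pos.le]; exact g.lt)
  refine Summable.of_nonneg_of_le (fun _ => abs_nonneg _) (fun i => ?_) this
  rw [abs_mul, pow_one, Nat.abs_cast]
  exact mul_le_mul_of_nonneg_left ((g.hh i).trans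
    (pow_le_pow_of_le_one g.pos.le g.lt.le (by omega))) (Nat.cast_nonneg _)

lemma summ_term (g : GoodPair a h σ) (n : ℤ) : Summable (fun i : ℕ => a i * Hx h (n + i)) :=
  Summable.of_norm_bounded (g.summ_geo.mul_left (σ ^ n.natAbs)) (fun i => g.term_le n i)

lemma bx_le (g : GoodPair a h σ) (n : ℤ) : |bx a h n| ≤ σ ^ n.natAbs * (1 - σ)⁻¹ := by
  rw [← tsum_geometric_of_lt_one g.pos.le g.lt, ← tsum_mul_left]
  exact tsum_of_norm_bounded (f := fun i : ℕ => a i * Hx h (n + i))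
    (g.summ_geo.mul_left (σ ^ n.natAbs)).hasSum (fun i => g.term_le n i)

lemma bx_le' (g : GoodPair a h σ) (n : ℤ) : |bx a h n| ≤ (1 - σ)⁻¹ := by
  refine (g.bx_le n).trans (mul_le_of_le_one_left (inv_nonneg.mpr (by linarith [g.lt]))
    (pow_le_one₀ g.pos.le g.lt.le))

lemma summ_int (g : GoodPair a h σ) (p : ℕ) :
    Summable (fun n : ℤ => |(n:ℝ)| ^ p * bx a h n ^ 2) := by
  have h1 : Summable (fun n : ℕ => (n:ℝ) ^ p * (σ ^ n * (1-σ)⁻¹ * (1-σ)⁻¹)) := by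
    have := (summable_pow_mul_geometric_of_norm_lt_one (R := ℝ) p (r := σ)
      (by rw [Real.norm_of_nonneg g.pos.le]; exact g.lt)).mul_right ((1-σ)⁻¹ * (1-σ)⁻¹)
    refine this.congr (fun n => by ring)
  have h2 : Summable (fun n : ℤ => |(n:ℝ)| ^ p * (σ ^ n.natAbs * (1-σ)⁻¹ * (1-σ)⁻¹)) := by
    apply Summable.of_nat_of_neg
    · simpa using h1
    · simpa using h1
  refine Summable.of_nonneg_of_le (fun n => by positivity) (fun n => ?_) h2
  refine mul_le_mul_of_nonneg_left ?_ (by positivity)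
  rw [← sq_abs, sq]
  exact mul_le_mul (g.bx_le n) (g.bx_le' n) (abs_nonneg _) ((abs_nonneg _).trans (g.bx_le n))

lemma summ_int1 (g : GoodPair a h σ) (p : ℕ) :
    Summable (fun n : ℤ => |(n:ℝ)| ^ p * |bx a h n|) := by
  have h1 : Summable (fun n : ℕ => (n:ℝ) ^ p * (σ ^ n * (1-σ)⁻¹)) := by
    have := (summable_pow_mul_geometric_of_norm_lt_one (R := ℝ) p (r := σ)
      (by rw [Real.norm_of_nonneg g.pos.le]; exact g.lt)).mul_right ((1-σ)⁻¹)
    refine this.congr (fun n => by ring)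
  have h2 : Summable (fun n : ℤ => |(n:ℝ)| ^ p * (σ ^ n.natAbs * (1-σ)⁻¹)) := by
    apply Summable.of_nat_of_neg
    · simpa using h1
    · simpa using h1
  refine Summable.of_nonneg_of_le (fun n => by positivity) (fun n => ?_) h2
  exact mul_le_mul_of_nonneg_left (g.bx_le n) (by positivity)

/-- shifted sums -/
lemma tsum_shift (f : ℤ → ℝ) (i : ℤ) :
    ∑' n : ℤ, Hx h (n + i) * f n = ∑' t : ℕ, h t * f (t - i) := by
  have hinj : Function.Injective (fun t : ℕ => (t:ℤ) - i) := fun x y hxy => by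
    simp at hxy; exact hxy
  rw [← hinj.tsum_eq (f := fun n : ℤ => Hx h (n + i) * f n)]
  · refine tsum_congr fun t => ?_
    simp [Hx_natCast]
  · intro n hn
    by_cases hz : n + i < 0
    · simp [Hx_neg hz] at hn
    · exact ⟨(n+i).toNat, by simp; omega⟩

lemma tsum_anti (g : GoodPair a h σ) (x : ℕ → ℝ) (hx : Summable (fun t => |x t|)) (m : ℤ) :
    ∑' t : ℕ, x t * bx a h (t + m)
      = ∑' N : ℕ, (∑ p ∈ Finset.HasAntidiagonal.antidiagonal N, x p.1 * a p.2) * Hx h (N + m) := by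
  have hs : Summable (fun p : ℕ × ℕ => x p.1 * a p.2 * Hx h ((p.1 + p.2 : ℕ) + m)) := by
    have := hx.mul_of_nonneg g.summ_a (fun _ => abs_nonneg _) (fun _ => abs_nonneg _)
    refine Summable.of_norm_bounded this fun p => ?_
    rw [Real.norm_eq_abs, abs_mul, abs_mul]
    exact mul_le_of_le_one_right (by positivity) (g.Hx_le_one _)
  have h1 : ∑' t : ℕ, x t * bx a h (t + m)
      = ∑' p : ℕ × ℕ, x p.1 * a p.2 * Hx h ((p.1 + p.2 : ℕ) + m) := by
    rw [hs.tsum_prod]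
    refine tsum_congr fun t => ?_
    unfold bx
    rw [← tsum_mul_left]
    refine tsum_congr fun i => ?_
    rw [mul_assoc]; congr 3; push_cast; ring
  rw [h1, ← Finset.HasAntidiagonal.sigmaAntidiagonalEquivProd.tsum_eq (_ : ℕ × ℕ → ℝ)]
  have hs' := (Finset.HasAntidiagonal.sigmaAntidiagonalEquivProd (A := ℕ)).summable_iff.mpr hs
  have := hs'.tsum_sigma
  refine this.trans (tsum_congr fun N => ?_)
  rw [tsum_fintype, Finset.sum_mul, ← Finset.sum_coe_sort (Finset.HasAntidiagonal.antidiagonal N)]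
  refine Finset.sum_congr rfl fun p _ => ?_
  have := Finset.HasAntidiagonal.mem_antidiagonal.mp p.2
  simp only [Function.comp]
  congr 2
  simp [Finset.HasAntidiagonal.sigmaAntidiagonalEquivProd, this]

lemma tsum_delta (g : GoodPair a h σ) (m : ℤ) :
    ∑' t : ℕ, h t * bx a h (t + m) = Hx h m := by
  rw [g.tsum_anti h g.summ_h m, tsum_eq_single 0]
  · simp [g.a0, g.h0]
  · intro N hN
    simp [g.conv, hN]

lemma tsum_w (g : GoodPair a h σ) (w : ℤ → ℝ) (hw : Summable (fun n => |w n * bx a h n|)) :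
    ∑' n : ℤ, w n * bx a h n ^ 2
      = ∑' i : ℕ, a i * ∑' t : ℕ, h t * (w (t - i) * bx a h (t - i)) := by
  have hs : Summable (fun p : ℤ × ℕ => (w p.1 * bx a h p.1) * (a p.2 * Hx h (p.1 + p.2))) := by
    have := hw.mul_of_nonneg g.summ_a (fun _ => abs_nonneg _) (fun _ => abs_nonneg _)
    refine Summable.of_norm_bounded this fun p => ?_
    rw [Real.norm_eq_abs, abs_mul, abs_mul (a p.2)]
    exact mul_le_mul_of_nonneg_left (mul_le_of_le_one_right (by positivity) (g.Hx_le_one _))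
      (abs_nonneg _)
  calc ∑' n : ℤ, w n * bx a h n ^ 2
      = ∑' n : ℤ, ∑' i : ℕ, (w n * bx a h n) * (a i * Hx h (n + i)) := by
        refine tsum_congr fun n => ?_
        rw [tsum_mul_left, ← bx]; ring
    _ = ∑' i : ℕ, ∑' n : ℤ, (w n * bx a h n) * (a i * Hx h (n + i)) :=
        (Summable.tsum_comm (f := fun (n : ℤ) (i : ℕ) => (w n * bx a h n) * (a i * Hx h (n + i))) hs).symm
    _ = _ := by
        refine tsum_congr fun i => ?_
        rw [← tsum_shift (fun n => w n * bx a h n) i, ← tsum_mul_left]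
        exact tsum_congr fun n => by ring

lemma sum_sq (g : GoodPair a h σ) : ∑' n : ℤ, bx a h n ^ 2 = 1 := by
  have := g.tsum_w (fun _ => 1) (by simpa using g.summ_int1 0)
  simp only [one_mul] at this
  rw [this, tsum_eq_single 0]
  · have := g.tsum_delta 0
    simp only [add_zero] at this
    have e : Hx h 0 = 1 := by simpa [g.h0] using Hx_natCast (h := h) 0
    simp [this, g.a0, e]
  · intro i hi
    have := g.tsum_delta (-i)
    simp only [← sub_eq_add_neg] at this
    rw [this, Hx_neg (by omega), mul_zero]

lemma sum_lin (g : GoodPair a h σ) : ∑' n : ℤ, (n:ℝ) * bx a h n ^ 2 = 0 := by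
  rw [g.tsum_w (fun n => (n:ℝ)) (by simpa [abs_mul] using g.summ_int1 1)]
  set y : ℕ → ℝ := fun N => ∑ p ∈ Finset.HasAntidiagonal.antidiagonal N, ((p.1:ℝ) * h p.1) * a p.2 with hy
  have hyS : Summable (fun N => |y N|) := by
    have := summable_norm_sum_mul_antidiagonal_of_summable_norm (f := fun i : ℕ => (i:ℝ) * h i)
      (g := a) g.summ_nh g.summ_a
    simpa [hy] using this
  have key : ∀ i : ℕ, a i * ∑' t : ℕ, h t * (((t - i : ℤ):ℝ) * bx a h (t - i))
      = ∑' N : ℕ, y N * (a i * Hx h (N - i)) := by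
    intro i
    have h1 := g.tsum_anti (fun t => (t:ℝ) * h t) g.summ_nh (-i)
    have h2 := g.tsum_delta (-i)
    simp only [← sub_eq_add_neg] at h1 h2
    have s1 : Summable (fun t : ℕ => (t:ℝ) * h t * bx a h (t - i)) := by
      refine Summable.of_norm_bounded (g.summ_nh.mul_right (1-σ)⁻¹) fun t => ?_
      rw [Real.norm_eq_abs, abs_mul]
      exact mul_le_mul_of_nonneg_left (g.bx_le' _) (abs_nonneg _)
    have s2 : Summable (fun t : ℕ => h t * bx a h (t - i)) := by
      refine Summable.of_norm_bounded (g.summ_h.mul_right (1-σ)⁻¹) fun t => ?_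
      rw [Real.norm_eq_abs, abs_mul]
      exact mul_le_mul_of_nonneg_left (g.bx_le' _) (abs_nonneg _)
    have : ∑' t : ℕ, h t * (((t - i : ℤ):ℝ) * bx a h (t - i))
        = (∑' t : ℕ, (t:ℝ) * h t * bx a h (t - i)) - i * ∑' t : ℕ, h t * bx a h (t - i) := by
      rw [← tsum_mul_left, ← s1.tsum_sub (s2.mul_left _)]
      refine tsum_congr fun t => ?_
      push_cast; ring
    rw [this, h1, h2]
    have : (i:ℝ) * Hx h (-i) = 0 := by
      rcases Nat.eq_zero_or_pos i with rfl | hi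
      · simp
      · rw [Hx_neg (by omega), mul_zero]
    rw [this, sub_zero, ← tsum_mul_left]
    exact tsum_congr fun N => by rw [hy]; ring
  rw [tsum_congr key]
  have hs : Summable (fun p : ℕ × ℕ => y p.1 * (a p.2 * Hx h (p.1 - p.2))) := by
    have := hyS.mul_of_nonneg g.summ_a (fun _ => abs_nonneg _) (fun _ => abs_nonneg _)
    refine Summable.of_norm_bounded this fun p => ?_
    rw [Real.norm_eq_abs, abs_mul, abs_mul (a p.2)]
    exact mul_le_mul_of_nonneg_left (mul_le_of_le_one_right (by positivity) (g.Hx_le_one _))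
      (abs_nonneg _)
  rw [Summable.tsum_comm (f := fun N i : ℕ => y N * (a i * Hx h (N - i))) hs]
  refine (tsum_congr fun N => ?_).trans tsum_zero
  rw [tsum_mul_left]
  rcases Nat.eq_zero_or_pos N with rfl | hN
  · simp [hy]
  · have : ∑' i : ℕ, a i * Hx h (N - i) = ∑ p ∈ Finset.HasAntidiagonal.antidiagonal N, h p.1 * a p.2 := by
      rw [tsum_eq_sum (s := Finset.range (N+1)), Finset.Nat.sum_antidiagonal_eq_sum_range_succ_mk]
      · rw [← Finset.sum_range_reflect]
        refine Finset.sum_congr rfl fun i hi => ?_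
        have := Finset.mem_range.mp hi
        have e : ((N:ℤ) - ((N + 1 - 1 - i : ℕ):ℤ)) = (i:ℕ) := by omega
        rw [e, Hx_natCast, mul_comm]; congr 2
      · intro i hi
        rw [Finset.mem_range] at hi
        rw [Hx_neg (by omega), mul_zero]
    rw [this, g.conv, if_neg hN.ne', mul_zero]

lemma tsum_shift_nat (f : ℕ → ℝ) (l : ℕ) :
    ∑' n : ℕ, Hx h (n - l) * f n = ∑' t : ℕ, h t * f (t + l) := by
  have hinj : Function.Injective (fun t : ℕ => t + l) := fun x y hxy => by
    simpa using hxy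
  rw [← hinj.tsum_eq (f := fun n : ℕ => Hx h (n - l) * f n)]
  · refine tsum_congr fun t => ?_
    simp [Hx_natCast]
  · intro n hn
    by_cases hz : (n:ℤ) - l < 0
    · simp [Hx_neg hz] at hn
    · exact ⟨n - l, by simp; omega⟩

lemma Hx_sub_le (g : GoodPair a h σ) (n l : ℕ) : |Hx h (n - l)| ≤ (σ ^ l)⁻¹ * σ ^ n := by
  have hp := pow_pos g.pos l
  by_cases hz : (n:ℤ) - l < 0
  · rw [Hx_neg hz]; simp; exact mul_nonneg (inv_nonneg.mpr hp.le) (pow_nonneg g.pos.le _)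
  · obtain ⟨t, rfl⟩ : ∃ t, n = t + l := ⟨n - l, by omega⟩
    have : ((t + l : ℕ):ℤ) - l = t := by push_cast; ring
    rw [this, Hx_natCast, pow_add, ← mul_assoc, mul_comm _ (σ ^ l), ← mul_assoc,
      mul_inv_cancel₀ hp.ne', one_mul]
    exact (g.hh t).trans (pow_le_pow_of_le_one g.pos.le g.lt.le (by omega))

lemma conv_le (g : GoodPair a h σ) (q : ℕ → ℂ) (k : ℕ) :
    ∃ C, ∀ n : ℕ, ‖∑ l ∈ Finset.range (k+1), q l * (Hx h (n - l) : ℂ)‖ ≤ C * σ ^ n := by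
  refine ⟨∑ l ∈ Finset.range (k+1), ‖q l‖ * (σ ^ l)⁻¹, fun n => ?_⟩
  rw [Finset.sum_mul]
  refine (norm_sum_le _ _).trans (Finset.sum_le_sum fun l _ => ?_)
  rw [norm_mul, Complex.norm_real, Real.norm_eq_abs, mul_assoc]
  exact mul_le_mul_of_nonneg_left (g.Hx_sub_le n l) (norm_nonneg _)

lemma dual (g : GoodPair a h σ) (q : ℕ → ℂ) (k : ℕ) :
    ∑' n : ℕ, (∑ l ∈ Finset.range (k+1), q l * (Hx h (n - l) : ℂ)) * (bx a h (n - k) : ℂ)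
      = q k := by
  have hl : ∀ l ∈ Finset.range (k+1), HasSum (fun n : ℕ => q l * (Hx h (n - l) : ℂ)
      * (bx a h (n - k) : ℂ)) (q l * (Hx h (l - k) : ℂ)) := by
    intro l _
    have hs : Summable (fun n : ℕ => Hx h (n - l) * bx a h (n - k)) := by
      refine Summable.of_norm_bounded ((g.summ_geo.mul_left (σ ^ l)⁻¹).mul_right (1-σ)⁻¹)
        fun n => ?_
      rw [Real.norm_eq_abs, abs_mul]
      exact mul_le_mul (g.Hx_sub_le n l) (g.bx_le' _) (abs_nonneg _)
        ((abs_nonneg _).trans (g.Hx_sub_le n l))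
    have e := hs.hasSum
    rw [tsum_shift_nat (fun n => bx a h (n - k)) l] at e
    have e2 := g.tsum_delta (l - k)
    have e3 : ∀ t : ℕ, bx a h ((t + l : ℕ) - k) = bx a h (t + (l - k)) := by
      intro t; congr 1; push_cast; ring
    simp only [e3, e2] at e
    have e4 := (Complex.hasSum_ofReal.mpr e).mul_left (q l)
    simpa [mul_assoc] using e4
  have := hasSum_sum hl
  simp only [← Finset.sum_mul] at this
  rw [this.tsum_eq, Finset.sum_eq_single k]
  · have e : Hx h 0 = 1 := by simpa [g.h0] using Hx_natCast (h := h) 0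
    simp [e]
  · intro l hl hlk
    rw [Finset.mem_range] at hl
    rw [Hx_neg (by omega)]; simp
  · simp

lemma summ_c {c : ℕ → ℂ} {C : ℝ} (g : GoodPair a h σ) (hc : ∀ n, ‖c n‖ ≤ C * σ ^ n) :
    Summable (fun n : ℕ => ‖c n‖ ^ 2 / (n + 1)) := by
  refine Summable.of_nonneg_of_le (fun n => by positivity) (fun n => ?_)
    (g.summ_geo.mul_left (C * C))
  have hC : 0 ≤ C := by simpa using (norm_nonneg _).trans (hc 0)
  have h1 : ‖c n‖ ≤ C := (hc n).trans (mul_le_of_le_one_right hC (pow_le_one₀ g.pos.le g.lt.le))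
  calc ‖c n‖ ^ 2 / (n + 1) ≤ ‖c n‖ ^ 2 := div_le_self (by positivity) (by
        have : (0:ℝ) ≤ n := Nat.cast_nonneg n
        linarith)
    _ ≤ C * (C * σ ^ n) := by
        rw [sq]; exact mul_le_mul h1 (hc n) (norm_nonneg _) hC
    _ = _ := by ring

/-- injection of the naturals in the integers, shifted -/
lemma shift_inj (k : ℕ) : Function.Injective (fun n : ℕ => (n:ℤ) - k) := fun x y hxy => by
  simpa using hxy

/-- A sum over shifted naturals is the sum over all integers minus the rest. -/
lemma tsum_split (k : ℕ) (f : ℤ → ℝ) (hf : Summable f) :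
    ∑' n : ℕ, f (n - k) = ∑' z : ℤ, f z - ∑' z : ℤ, (if z < -k then f z else 0) := by
  have h1 : ∑' n : ℕ, f (n - k) = ∑' z : ℤ, (if z < -k then 0 else f z) := by
    rw [← (shift_inj k).tsum_eq (f := fun z : ℤ => (if z < -k then 0 else f z))]
    · refine tsum_congr fun n => ?_
      rw [if_neg (by omega)]
    · intro z hz
      by_cases h : z < -k
      · simp [h] at hz
      · exact ⟨(z + k).toNat, by simp; omega⟩
  have s1 : Summable (fun z : ℤ => if z < -k then f z else 0) := by
    have := hf.indicator {z : ℤ | z < -k}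
    refine this.congr fun z => ?_
    simp [Set.indicator]
  rw [h1, ← hf.tsum_sub s1]
  refine tsum_congr fun z => ?_
  split_ifs <;> simp

lemma tsum_cs (x y : ℕ → ℝ) (hx : ∀ n, 0 ≤ x n) (hy : ∀ n, 0 ≤ y n)
    (sx : Summable (fun n => x n ^ 2)) (sy : Summable (fun n => y n ^ 2)) :
    Summable (fun n => x n * y n) ∧
    (∑' n, x n * y n) ^ 2 ≤ (∑' n, x n ^ 2) * ∑' n, y n ^ 2 := by
  have h := Real.summable_and_inner_le_Lp_mul_Lq_tsum_of_nonneg (p := 2) (q := 2)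
    (f := x) (g := y) (Real.HolderConjugate.two_two) hx hy (by simpa using sx) (by simpa using sy)
  refine ⟨h.1, ?_⟩
  have h2 := h.2
  simp only [Real.rpow_two, ← Real.sqrt_eq_rpow] at h2
  have hX : 0 ≤ ∑' n, x n ^ 2 := tsum_nonneg fun n => sq_nonneg _
  have hY : 0 ≤ ∑' n, y n ^ 2 := tsum_nonneg fun n => sq_nonneg _
  calc _ ≤ _ := pow_le_pow_left₀ (tsum_nonneg fun n => mul_nonneg (hx n) (hy n)) h2 2
    _ = _ := by rw [mul_pow, Real.sq_sqrt hX, Real.sq_sqrt hY]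

lemma core1 (g : GoodPair a h σ) : ∃ C : ℝ, 0 ≤ C ∧ ∀ (k : ℕ) (q : ℕ → ℂ),
    ‖q k‖ ^ 2 ≤ ((k:ℝ) + 1 + C / (k + 1)) *
      ∑' n : ℕ, ‖∑ l ∈ Finset.range (k+1), q l * (Hx h (n - l) : ℂ)‖ ^ 2 / ((n:ℝ) + 1) := by
  refine ⟨∑' z : ℤ, |(z:ℝ)| ^ 2 * bx a h z ^ 2, tsum_nonneg fun z => by positivity, fun k q => ?_⟩
  set M := ∑' z : ℤ, |(z:ℝ)| ^ 2 * bx a h z ^ 2 with hM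
  set c : ℕ → ℂ := fun n => ∑ l ∈ Finset.range (k+1), q l * (Hx h (n - l) : ℂ) with hc
  obtain ⟨C, hC⟩ := g.conv_le q k
  have hX : Summable (fun n : ℕ => ‖c n‖ ^ 2 / ((n:ℝ) + 1)) := g.summ_c hC
  have s0 := g.summ_int 0
  have s1 := g.summ_int 1
  have s2 := g.summ_int 2
  simp only [pow_zero, one_mul, pow_one] at s0 s1
  have s1' : Summable (fun z : ℤ => (z:ℝ) * bx a h z ^ 2) := by
    refine Summable.of_norm_bounded s1 fun z => ?_
    rw [Real.norm_eq_abs, abs_mul, abs_of_nonneg (sq_nonneg (bx a h z))]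
  set f : ℤ → ℝ := fun z => ((k:ℝ) + 1) * bx a h z ^ 2 + z * bx a h z ^ 2 with hf
  have sf : Summable f := (s0.mul_left _).add s1'
  have tf : ∑' z, f z = k + 1 := by
    rw [hf, (s0.mul_left _).tsum_add s1', tsum_mul_left, g.sum_sq, g.sum_lin]; ring
  have hY : Summable (fun n : ℕ => ((n:ℝ) + 1) * bx a h (n - k) ^ 2) := by
    refine (sf.comp_injective (shift_inj k)).congr fun n => ?_
    simp [hf]; ring
  have hYle : ∑' n : ℕ, ((n:ℝ) + 1) * bx a h (n - k) ^ 2 ≤ (k:ℝ) + 1 + M / (k + 1) := by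
    have e := tsum_split k f sf
    have e1 : ∀ n : ℕ, f (n - k) = ((n:ℝ) + 1) * bx a h (n - k) ^ 2 := fun n => by
      simp [hf]; ring
    simp only [e1] at e
    rw [e, tf, hM, ← tsum_div_const, sub_eq_add_neg, ← tsum_neg]
    refine add_le_add le_rfl (Summable.tsum_le_tsum (fun z => ?_) ?_ (s2.div_const _))
    · split_ifs with hz
      · have hz' : (z:ℝ) ≤ -(k + 1) := by
          have : z ≤ -((k:ℤ) + 1) := by omega
          exact_mod_cast this
        have hk : (0:ℝ) < (k:ℝ) + 1 := by positivity
        rw [le_div_iff₀ hk, hf, sq_abs]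
        have := sq_nonneg (bx a h z)
        have h2 : (-((k:ℝ) + 1 + z)) * (k+1) ≤ (z:ℝ)^2 := by nlinarith
        nlinarith
      · simp; positivity
    · have := (sf.indicator {z : ℤ | z < -k}).neg
      refine this.congr fun z => ?_
      simp [Set.indicator]
  have sq1 : ∀ n : ℕ, √((n:ℝ) + 1) ^ 2 = (n:ℝ) + 1 := fun n => Real.sq_sqrt (by positivity)
  have hcs := tsum_cs (fun n : ℕ => ‖c n‖ / √((n:ℝ) + 1))
    (fun n : ℕ => √((n:ℝ) + 1) * |bx a h (n - k)|)
    (fun n => by positivity) (fun n => by positivity)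
    (by simpa [div_pow, sq1] using hX) (by simpa [mul_pow, sq1] using hY)
  simp only [div_pow, mul_pow, sq1, sq_abs] at hcs
  have e : ∀ n : ℕ, ‖c n‖ / √((n:ℝ) + 1) * (√((n:ℝ) + 1) * |bx a h (n - k)|)
      = ‖c n * (bx a h (n - k) : ℂ)‖ := fun n => by
    have : √((n:ℝ) + 1) ≠ 0 := (Real.sqrt_pos.mpr (by positivity)).ne'
    rw [norm_mul, Complex.norm_real, Real.norm_eq_abs]
    field_simp
  simp only [e] at hcs
  have hn := norm_tsum_le_tsum_norm hcs.1
  rw [g.dual q k] at hn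
  calc ‖q k‖ ^ 2 ≤ _ := pow_le_pow_left₀ (norm_nonneg _) hn 2
    _ ≤ _ := hcs.2
    _ ≤ _ := by
      rw [mul_comm]
      exact mul_le_mul_of_nonneg_right hYle (tsum_nonneg fun n => by positivity)

lemma geo_bound (g : GoodPair a h σ) : ∃ C : ℝ, 0 ≤ C ∧ ∀ k : ℕ, σ ^ k ≤ C / ((k:ℝ) + 1) ^ 3 := by
  have h1 := (summable_pow_mul_geometric_of_norm_lt_one (R := ℝ) 3 (r := σ)
      (by rw [Real.norm_of_nonneg g.pos.le]; exact g.lt))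
  have h2 := ((summable_nat_add_iff 1).mpr h1).mul_right σ⁻¹
  have hp := g.pos
  have h3 : ∀ k : ℕ, (((k + 1 : ℕ):ℝ) ^ 3 * σ ^ (k+1)) * σ⁻¹ = ((k:ℝ) + 1) ^ 3 * σ ^ k := by
    intro k; push_cast; field_simp; ring
  simp only [h3] at h2
  refine ⟨∑' k : ℕ, ((k:ℝ) + 1) ^ 3 * σ ^ k, tsum_nonneg (fun k => by positivity), fun k => ?_⟩
  rw [le_div_iff₀ (by positivity), mul_comm]
  exact h2.le_tsum k (fun j _ => by positivity)

lemma summ_geo_int (g : GoodPair a h σ) : Summable (fun z : ℤ => σ ^ z.natAbs) := by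
  apply Summable.of_nat_of_neg
  · simpa using g.summ_geo
  · simpa using g.summ_geo

lemma trial_le (g : GoodPair a h σ) (k n : ℕ) :
    |bx a h (n - k) - ∑ l ∈ Finset.range (k+1), a (k - l) * Hx h (n - l)|
      ≤ σ ^ ((n:ℤ) - k).natAbs * σ ^ k * (1 - σ)⁻¹ := by
  have e1 : ∑ l ∈ Finset.range (k+1), a (k - l) * Hx h (n - l)
      = ∑ i ∈ Finset.range (k+1), a i * Hx h (((n:ℤ) - k) + i) := by
    rw [← Finset.sum_range_reflect]
    refine Finset.sum_congr rfl fun i hi => ?_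
    rw [Finset.mem_range] at hi
    have : k - (k + 1 - 1 - i) = i := by omega
    rw [this]; congr 2; omega
  have e2 := (g.summ_term ((n:ℤ) - k)).sum_add_tsum_nat_add (k+1)
  have e3 : bx a h (n - k) - ∑ l ∈ Finset.range (k+1), a (k - l) * Hx h (n - l)
      = ∑' i : ℕ, a (i + (k+1)) * Hx h (((n:ℤ) - k) + (i + (k+1) : ℕ)) := by
    rw [e1, bx, ← e2]; ring
  rw [e3, ← tsum_geometric_of_lt_one g.pos.le g.lt, ← tsum_mul_left]
  refine tsum_of_norm_bounded (f := fun i : ℕ =>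
    a (i + (k+1)) * Hx h (((n:ℤ) - k) + (i + (k+1) : ℕ)))
    (g.summ_geo.mul_left (σ ^ ((n:ℤ) - k).natAbs * σ ^ k)).hasSum (fun i => ?_)
  refine (g.term_le ((n:ℤ) - k) (i + (k+1))).trans ?_
  rw [mul_assoc, ← pow_add σ k i]
  exact mul_le_mul_of_nonneg_left (pow_le_pow_of_le_one g.pos.le g.lt.le (by omega))
    (pow_nonneg g.pos.le _)

lemma core2 (g : GoodPair a h σ) : ∃ C : ℝ, 0 ≤ C ∧ ∀ (k : ℕ),
    ∑' n : ℕ, (∑ l ∈ Finset.range (k+1), a (k - l) * Hx h (n - l)) ^ 2 / ((n:ℝ) + 1)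
      ≤ (1 + C / ((k:ℝ) + 1)^2) / ((k:ℝ) + 1) := by
  obtain ⟨C3, hC3, hgeo⟩ := g.geo_bound
  set D := (1 - σ)⁻¹ with hD
  have hD0 : 0 ≤ D := inv_nonneg.mpr (by linarith [g.lt])
  set W := ∑' z : ℤ, σ ^ z.natAbs with hW
  have hW0 : 0 ≤ W := tsum_nonneg fun z => pow_nonneg g.pos.le _
  have s0 := g.summ_int 0
  have s1 := g.summ_int 1
  have s2 := g.summ_int 2
  have s3 := g.summ_int 3
  simp only [pow_zero, one_mul, pow_one] at s0 s1
  have s1' : Summable (fun z : ℤ => (z:ℝ) * bx a h z ^ 2) := by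
    refine Summable.of_norm_bounded s1 fun z => ?_
    rw [Real.norm_eq_abs, abs_mul, abs_of_nonneg (sq_nonneg (bx a h z))]
  set M2 := ∑' z : ℤ, |(z:ℝ)| ^ 2 * bx a h z ^ 2 with hM2
  set M3 := ∑' z : ℤ, |(z:ℝ)| ^ 3 * bx a h z ^ 2 with hM3
  have hM20 : 0 ≤ M2 := tsum_nonneg fun z => by positivity
  have hM30 : 0 ≤ M3 := tsum_nonneg fun z => by positivity
  refine ⟨M2 + M3 + 3 * D ^ 2 * W * C3, by positivity, fun k => ?_⟩
  set K : ℝ := (k:ℝ) + 1 with hK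
  have hK0 : 0 < K := by positivity
  set F : ℤ → ℝ := fun z => (K⁻¹ * bx a h z ^ 2 + (-(K ^ 2)⁻¹) * (z * bx a h z ^ 2))
    + ((K ^ 3)⁻¹ * (|(z:ℝ)| ^ 2 * bx a h z ^ 2) + (K ^ 3)⁻¹ * (|(z:ℝ)| ^ 3 * bx a h z ^ 2))
    + (3 * D ^ 2 * σ ^ k) * σ ^ z.natAbs with hF
  have t1 := (s0.hasSum.mul_left K⁻¹).add (s1'.hasSum.mul_left (-(K ^ 2)⁻¹))
  have t2 := (s2.hasSum.mul_left (K ^ 3)⁻¹).add (s3.hasSum.mul_left (K ^ 3)⁻¹)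
  have tF : HasSum F _ := (t1.add t2).add (g.summ_geo_int.hasSum.mul_left (3 * D ^ 2 * σ ^ k))
  rw [g.sum_sq, g.sum_lin, ← hM2, ← hM3, ← hW] at tF
  have hFle : ∑' n : ℕ, F (n - k) ≤ K⁻¹ + (K^3)⁻¹ * (M2 + M3) + 3 * D ^ 2 * σ ^ k * W := by
    rw [tsum_split k F tF.summable, tF.tsum_eq]
    have : 0 ≤ ∑' z : ℤ, (if z < -k then F z else 0) := by
      refine tsum_nonneg fun z => ?_
      split_ifs with hz
      · have hz' : (z:ℝ) ≤ 0 := by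
          have : z ≤ 0 := by omega
          exact_mod_cast this
        have hs := pow_nonneg g.pos.le k
        have hs' := pow_nonneg g.pos.le z.natAbs
        have : 0 ≤ (-(K ^ 2)⁻¹) * (z * bx a h z ^ 2) := by
          have : 0 ≤ (K^2)⁻¹ * ((-z) * bx a h z ^ 2) :=
            mul_nonneg (by positivity) (mul_nonneg (by linarith) (sq_nonneg _))
          linarith
        simp only [hF]
        positivity
      · exact le_rfl
    linarith
  have hterm : ∀ n : ℕ, (∑ l ∈ Finset.range (k+1), a (k - l) * Hx h (n - l)) ^ 2 / ((n:ℝ) + 1)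
      ≤ F (n - k) := by
    intro n
    set z : ℤ := (n:ℤ) - k with hz
    have hzr : (n:ℝ) + 1 = K + z := by simp [hz, hK]; ring
    have hE := g.trial_le k n
    rw [← hz, ← hD] at hE
    set b := bx a h z with hb
    set c := ∑ l ∈ Finset.range (k+1), a (k - l) * Hx h (n - l) with hc
    set S := σ ^ z.natAbs with hS
    have hb1 : |b| ≤ S * D := g.bx_le z
    have hS0 : 0 ≤ S := pow_nonneg g.pos.le _
    have hS1 : S ≤ 1 := pow_le_one₀ g.pos.le g.lt.le
    have hk0 : 0 ≤ σ ^ k := pow_nonneg g.pos.le _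
    have hk1 : σ ^ k ≤ 1 := pow_le_one₀ g.pos.le g.lt.le
    have h1 : c ^ 2 ≤ b ^ 2 + 3 * D ^ 2 * σ ^ k * S := by
      have hA : c ^ 2 = b ^ 2 + (2 * b * (c - b) + (b - c) ^ 2) := by ring
      have hB : 2 * b * (c - b) ≤ 2 * ((S * D) * (S * σ ^ k * D)) := by
        have : b * (c - b) ≤ |b| * |b - c| := by
          rw [← abs_mul, ← abs_neg, show -(b * (b - c)) = b * (c - b) by ring]
          exact le_abs_self _
        have h' : |b| * |b - c| ≤ (S * D) * (S * σ ^ k * D) :=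
          mul_le_mul hb1 hE (abs_nonneg _) (by positivity)
        linarith
      have hC : (b - c) ^ 2 ≤ (S * σ ^ k * D) ^ 2 := by
        rw [← sq_abs]; exact pow_le_pow_left₀ (abs_nonneg _) hE 2
      have h5 : 2 * ((S * D) * (S * σ ^ k * D)) = 2 * D ^ 2 * σ ^ k * S * S := by ring
      have h6 : (S * σ ^ k * D) ^ 2 = D ^ 2 * σ ^ k * S * (S * σ ^ k) := by ring
      have h7 : 2 * D ^ 2 * σ ^ k * S * S ≤ 2 * D ^ 2 * σ ^ k * S :=
        mul_le_of_le_one_right (by positivity) hS1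
      have h8 : D ^ 2 * σ ^ k * S * (S * σ ^ k) ≤ D ^ 2 * σ ^ k * S :=
        mul_le_of_le_one_right (by positivity) (mul_le_one₀ hS1 hk0 hk1)
      linarith
    have hpos : 1 ≤ (n:ℝ) + 1 := by
      have : (0:ℝ) ≤ n := Nat.cast_nonneg n
      linarith
    have h2 : c ^ 2 / ((n:ℝ) + 1) ≤ b ^ 2 / (K + z) + 3 * D ^ 2 * σ ^ k * S := by
      rw [← hzr]
      calc c ^ 2 / ((n:ℝ) + 1) ≤ (b ^ 2 + 3 * D ^ 2 * σ ^ k * S) / ((n:ℝ) + 1) :=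
            div_le_div_of_nonneg_right h1 (by linarith)
        _ = b ^ 2 / ((n:ℝ) + 1) + 3 * D ^ 2 * σ ^ k * S / ((n:ℝ) + 1) := by ring
        _ ≤ _ := add_le_add le_rfl (div_le_self (by positivity) hpos)
    have h3 : (K + z)⁻¹ ≤ K⁻¹ - (K^2)⁻¹ * z + (K^3)⁻¹ * (|(z:ℝ)| ^ 2 + |(z:ℝ)| ^ 3) := by
      rw [hzr] at hpos
      set y : ℝ := (z:ℝ) with hy
      have hQ : K ≤ (K + y) * (1 + |y|) := by
        rcases abs_cases y with ⟨h, h'⟩ | ⟨h, h'⟩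
        · rw [h]; nlinarith
        · rw [h]; nlinarith
      have hid : K⁻¹ - (K^2)⁻¹ * y + (K^3)⁻¹ * (|y| ^ 2 + |y| ^ 3) - (K + y)⁻¹
          = (y ^ 2 * ((K + y) * (1 + |y|) - K)) / (K ^ 3 * (K + y)) := by
        have h3 : |y| ^ 3 = y ^ 2 * |y| := by rw [← sq_abs y]; ring
        have : K + y ≠ 0 := by linarith
        rw [h3, sq_abs]
        field_simp
        ring
      have : 0 ≤ (y ^ 2 * ((K + y) * (1 + |y|) - K)) / (K ^ 3 * (K + y)) :=
        div_nonneg (mul_nonneg (sq_nonneg _) (by linarith)) (by positivity)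
      linarith
    have h4 := mul_le_mul_of_nonneg_left h3 (sq_nonneg b)
    rw [← div_eq_mul_inv] at h4
    simp only [hF]
    rw [← hb, ← hS]
    nlinarith
  have sFn : Summable (fun n : ℕ => F (n - k)) := tF.summable.comp_injective (shift_inj k)
  have h5 : ∑' n : ℕ, (∑ l ∈ Finset.range (k+1), a (k - l) * Hx h (n - l)) ^ 2 / ((n:ℝ) + 1)
      ≤ ∑' n : ℕ, F (n - k) :=
    Summable.tsum_le_tsum hterm (Summable.of_nonneg_of_le (fun n => by positivity) hterm sFn) sFn
  refine h5.trans (hFle.trans ?_)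
  have h6 : 3 * D ^ 2 * σ ^ k * W ≤ 3 * D ^ 2 * (C3 / K ^ 3) * W := by
    have := hgeo k
    gcongr
  have h7 : (1 + (M2 + M3 + 3 * D ^ 2 * W * C3) / K ^ 2) / K
      = K⁻¹ + (K^3)⁻¹ * (M2 + M3) + 3 * D ^ 2 * (C3 / K ^ 3) * W := by
    field_simp
    ring
  linarith

end GoodPair

lemma disk_offdiag (i j : ℕ) (hij : i ≠ j) :
    ∫ u in Metric.ball (0:ℂ) 1, u ^ i * conj u ^ j = 0 := by
  have hd : ((i:ℝ) - j) ≠ 0 := sub_ne_zero.mpr (by exact_mod_cast hij)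
  set θ : ℝ := Real.pi / ((i:ℝ) - j) with hθ
  set e : Circle := Circle.exp θ with he
  have hmp := (rotation e).measurePreserving
  have hpre : (rotation e) ⁻¹' Metric.ball (0:ℂ) 1 = Metric.ball 0 1 := by
    ext u; simp only [Set.mem_preimage, mem_ball_zero_iff, LinearIsometryEquiv.norm_map]
  have h1 := hmp.setIntegral_preimage_emb (rotation e).toHomeomorph.measurableEmbedding
    (fun u : ℂ => u ^ i * conj u ^ j) (Metric.ball 0 1)
  rw [hpre] at h1
  have h2 : ∀ u : ℂ, (rotation e u) ^ i * conj (rotation e u) ^ j = -(u ^ i * conj u ^ j) := by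
    intro u
    have h3 : (e:ℂ) ^ i * conj (e:ℂ) ^ j = -1 := by
      rw [he, Circle.coe_exp, ← Complex.exp_conj, ← Complex.exp_nat_mul, ← Complex.exp_nat_mul,
        ← Complex.exp_add, ← Complex.exp_pi_mul_I]
      congr 1
      have hd' : ((i:ℂ) - j) ≠ 0 := by exact_mod_cast hd
      simp [hθ]
      field_simp
      ring
    rw [rotation_apply, map_mul, mul_pow, mul_pow]
    linear_combination (u ^ i * conj u ^ j) * h3
  simp only [h2] at h1
  rw [integral_neg] at h1
  exact self_eq_neg.mp h1.symm

lemma disk_diag (i : ℕ) :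
    ∫ u in Metric.ball (0:ℂ) 1, u ^ i * conj u ^ i = ((Real.pi / (i + 1) : ℝ) : ℂ) := by
  have h0 : ∀ u : ℂ, u ^ i * conj u ^ i = ((‖u‖ ^ (2 * i) : ℝ) : ℂ) := by
    intro u
    rw [← mul_pow, Complex.mul_conj, Complex.normSq_eq_norm_sq, pow_mul]; push_cast; rfl
  simp only [h0]
  rw [integral_complex_ofReal]
  congr 1
  have h1 := integral_fun_norm_addHaar (volume : Measure ℂ)
    (fun x : ℝ => (Set.Iio (1:ℝ)).indicator (fun x => x ^ (2 * i)) x)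
  have h2 : ∀ u : ℂ, (Set.Iio (1:ℝ)).indicator (fun x => x ^ (2 * i)) ‖u‖
      = (Metric.ball (0:ℂ) 1).indicator (fun u => ‖u‖ ^ (2 * i)) u := by
    intro u; simp [Set.indicator]
  simp only [h2] at h1
  rw [integral_indicator Metric.isOpen_ball.measurableSet] at h1
  rw [h1]
  have h3 : ∀ y : ℝ, y ^ (Module.finrank ℝ ℂ - 1) • (Set.Iio (1:ℝ)).indicator (fun x => x ^ (2 * i)) y
      = (Set.Iio (1:ℝ)).indicator (fun x => x ^ (2 * i + 1)) y := by
    intro y; simp [Set.indicator, Complex.finrank_real_complex]; congr 1; ring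
  simp only [h3]
  rw [setIntegral_indicator measurableSet_Iio, Set.Ioi_inter_Iio, ← integral_Ioc_eq_integral_Ioo,
    ← intervalIntegral.integral_of_le zero_le_one, integral_pow]
  simp [Complex.finrank_real_complex, Measure.real, Complex.volume_ball]
  field_simp
  ring

lemma hasSum_mul_prod (x y : ℕ → ℂ) (X Y : ℂ) (hx : HasSum x X) (hy : HasSum y Y)
    (hs : Summable (fun p : ℕ × ℕ => x p.1 * y p.2)) :
    HasSum (fun p : ℕ × ℕ => x p.1 * y p.2) (X * Y) := by
  rw [← hx.tsum_eq, ← hy.tsum_eq, hx.summable.tsum_mul_tsum hy.summable hs]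
  exact hs.hasSum

lemma disk_parseval (c : ℕ → ℂ) (C σ : ℝ) (h0 : 0 ≤ σ) (h1 : σ < 1) (hc : ∀ n, ‖c n‖ ≤ C * σ ^ n)
    (f : ℂ → ℂ) (hf : ∀ u ∈ Metric.ball (0:ℂ) 1, HasSum (fun n => c n * u ^ n) (f u)) :
    ∫ u in Metric.ball (0:ℂ) 1, ‖f u‖ ^ 2 = Real.pi * ∑' n : ℕ, ‖c n‖ ^ 2 / ((n:ℝ) + 1) := by
  have hC : 0 ≤ C := by simpa using (norm_nonneg _).trans (hc 0)
  set F : ℕ × ℕ → ℂ → ℂ := fun p u => (c p.1 * u ^ p.1) * conj (c p.2 * u ^ p.2) with hF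
  have hgeo := (summable_geometric_of_lt_one h0 h1).mul_left C
  have hb := hgeo.mul_of_nonneg hgeo (fun n => by positivity) (fun n => by positivity)
  have hterm : ∀ u ∈ Metric.ball (0:ℂ) 1, ∀ n, ‖c n * u ^ n‖ ≤ C * σ ^ n := by
    intro u hu n
    rw [norm_mul, norm_pow]
    have : ‖u‖ ≤ 1 := by simpa using (mem_ball_zero_iff.mp hu).le
    exact (mul_le_of_le_one_right (norm_nonneg _) (pow_le_one₀ (norm_nonneg _) this)).trans (hc n)
  have : IsFiniteMeasure (volume.restrict (Metric.ball (0:ℂ) 1)) :=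
    ⟨by rw [Measure.restrict_apply_univ]; exact measure_ball_lt_top⟩
  have k1 : ∀ p : ℕ × ℕ, AEStronglyMeasurable (F p) (volume.restrict (Metric.ball (0:ℂ) 1)) := by
    intro p
    have : Continuous (F p) :=
      (continuous_const.mul (continuous_id.pow _)).mul
        (Complex.continuous_conj.comp (continuous_const.mul (continuous_id.pow _)))
    exact this.aestronglyMeasurable
  have k2 : ∀ p : ℕ × ℕ, ∀ᵐ u ∂(volume.restrict (Metric.ball (0:ℂ) 1)),
      ‖F p u‖ ≤ (C * σ ^ p.1) * (C * σ ^ p.2) := by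
    intro p
    filter_upwards [ae_restrict_mem Metric.isOpen_ball.measurableSet] with u hu
    simp only [hF]
    rw [norm_mul, RCLike.norm_conj]
    exact mul_le_mul (hterm u hu _) (hterm u hu _) (norm_nonneg _) (by positivity)
  have k3 : ∀ᵐ u ∂(volume.restrict (Metric.ball (0:ℂ) 1)),
      HasSum (fun p => F p u) (f u * conj (f u)) := by
    filter_upwards [ae_restrict_mem Metric.isOpen_ball.measurableSet] with u hu
    have hs := hf u hu
    have hn : Summable (fun n => ‖c n * u ^ n‖) :=
      Summable.of_nonneg_of_le (fun _ => norm_nonneg _) (hterm u hu) hgeo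
    have hs' : HasSum (fun n => conj (c n * u ^ n)) (conj (f u)) := hs.star
    have hn' : Summable (fun n => ‖conj (c n * u ^ n)‖) := by
      refine hn.congr fun n => ?_
      rw [RCLike.norm_conj]
    have hsm := summable_mul_of_summable_norm hn hn'
    have fin := hasSum_mul_prod (fun n => c n * u ^ n) (fun n => conj (c n * u ^ n)) (f u)
      (conj (f u)) hs hs' hsm
    simp only [hF]
    exact fin
  have key := hasSum_integral_of_dominated_convergence (μ := volume.restrict (Metric.ball (0:ℂ) 1))
    (F := F) (f := fun u => f u * conj (f u)) (fun p _ => (C * σ ^ p.1) * (C * σ ^ p.2))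
    k1 k2 (ae_of_all _ fun _ => hb) (integrable_const _) k3
  have hint : ∀ p : ℕ × ℕ, ∫ u in Metric.ball (0:ℂ) 1, F p u
      = if p.1 = p.2 then ((Real.pi * (‖c p.1‖ ^ 2 / ((p.1:ℝ) + 1)) : ℝ) : ℂ) else 0 := by
    intro p
    have : ∀ u, F p u = (c p.1 * conj (c p.2)) * (u ^ p.1 * conj u ^ p.2) := by
      intro u; simp only [hF, map_mul, map_pow]; ring
    simp only [this]
    rw [integral_const_mul]
    split_ifs with h
    · rw [← h, disk_diag, Complex.mul_conj, Complex.normSq_eq_norm_sq]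
      push_cast; ring
    · rw [disk_offdiag _ _ h, mul_zero]
  simp only [hint] at key
  have hinj : Function.Injective (fun n : ℕ => (n, n)) := fun x y h => (Prod.mk.inj h).1
  rw [← hinj.hasSum_iff] at key
  · simp only [Function.comp_def, if_true] at key
    have e : ∫ u in Metric.ball (0:ℂ) 1, f u * conj (f u)
        = ((∫ u in Metric.ball (0:ℂ) 1, ‖f u‖ ^ 2 : ℝ) : ℂ) := by
      rw [← integral_complex_ofReal]
      congr 1; ext u
      rw [Complex.mul_conj, Complex.normSq_eq_norm_sq]
    rw [e, Complex.hasSum_ofReal] at key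
    rw [← key.tsum_eq, tsum_mul_left]
  · intro p hp
    rw [if_neg]
    intro h
    exact hp ⟨p.1, Prod.ext rfl h⟩
lemma one_add_slit {R : ℝ} (hR0 : 0 < R) (hR1 : R < 1) {u : ℂ} (hu : u ∈ Metric.ball (0:ℂ) 1) :
    1 + (R:ℂ) * u ∈ Complex.slitPlane := by
  apply Complex.mem_slitPlane_of_norm_lt_one
  rw [norm_mul, Complex.norm_real, Real.norm_of_nonneg hR0.le]
  have := mem_ball_zero_iff.mp hu
  have := norm_nonneg u
  nlinarith

noncomputable section
def psi (R : ℝ) (m : ℕ) (u : ℂ) : ℂ := (1 + (R:ℂ) * u) ^ ((m:ℂ)⁻¹)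
def dpsi (R : ℝ) (m : ℕ) (u : ℂ) : ℂ := ((R:ℂ) / m) * (1 + (R:ℂ) * u) ^ ((m:ℂ)⁻¹ - 1)
def zet (m : ℕ) : ℂ := Complex.exp (2 * Real.pi * Complex.I / m)
end

lemma zet_prim (m : ℕ) (hm : m ≠ 0) : IsPrimitiveRoot (zet m) m := Complex.isPrimitiveRoot_exp m hm

lemma psi_pow {R : ℝ} {m : ℕ} (hm : m ≠ 0) (u : ℂ) : psi R m u ^ m = 1 + (R:ℂ) * u :=
  Complex.cpow_nat_inv_pow _ hm

lemma psi_deriv {R : ℝ} (hR0 : 0 < R) (hR1 : R < 1) {m : ℕ} {u : ℂ}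
    (hu : u ∈ Metric.ball (0:ℂ) 1) : HasDerivAt (psi R m) (dpsi R m u) u := by
  have h1 : HasDerivAt (fun u : ℂ => 1 + (R:ℂ) * u) (R:ℂ) u := by
    simpa using ((hasDerivAt_id u).const_mul (R:ℂ)).const_add 1
  have h2 := h1.cpow_const (c := (m:ℂ)⁻¹) (one_add_slit hR0 hR1 hu)
  have e : (m:ℂ)⁻¹ * (1 + (R:ℂ) * u) ^ ((m:ℂ)⁻¹ - 1) * R = dpsi R m u := by
    unfold dpsi; ring
  rw [e] at h2
  exact h2

lemma det_mul (c : ℂ) : (((ContinuousLinearMap.toSpanSingleton ℂ c).restrictScalars ℝ :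
    ℂ →L[ℝ] ℂ)).det = ‖c‖ ^ 2 := by
  simp [ContinuousLinearMap.det, LinearMap.det_restrictScalars,
      Algebra.norm_complex_eq, Complex.normSq_eq_norm_sq]

lemma lem_bdd (r : ℝ) (hr0 : 0 < r) (hr1 : r < 1) (m : ℕ) (hm : m ≠ 0) :
    lemniscate r m ⊆ Metric.closedBall 0 2 := by
  intro z hz
  have hz : ‖z ^ m - 1‖ < r ^ m := hz
  have h1 : r ^ m ≤ 1 := pow_le_one₀ hr0.le hr1.le
  have h2 : ‖z ^ m‖ ≤ 2 := by
    have := norm_add_le (z ^ m - 1) 1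
    simp at this
    rw [norm_pow]
    linarith
  rw [mem_closedBall_zero_iff]
  by_contra hc
  push Not at hc
  rw [norm_pow] at h2
  have : ‖z‖ ^ 1 ≤ ‖z‖ ^ m := pow_le_pow_right₀ (by linarith) (by omega)
  linarith

lemma lem_integral (r : ℝ) (hr0 : 0 < r) (hr1 : r < 1) (m : ℕ) (hm : m ≠ 0)
    (f : ℂ → ℝ) (hf : Continuous f) :
    (∀ j : Fin m, IntegrableOn (fun u => ‖dpsi (r ^ m) m u‖ ^ 2
        * f (zet m ^ (j:ℕ) * psi (r ^ m) m u)) (Metric.ball 0 1)) ∧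
    ∫ z in lemniscate r m, f z = ∑ j : Fin m, ∫ u in Metric.ball (0:ℂ) 1,
      ‖dpsi (r ^ m) m u‖ ^ 2 * f (zet m ^ (j:ℕ) * psi (r ^ m) m u) := by
  set R := r ^ m with hR
  have hR0 : 0 < R := pow_pos hr0 m
  have hR1 : R < 1 := pow_lt_one₀ hr0.le hr1 hm
  have hRc : (R:ℂ) ≠ 0 := by exact_mod_cast hR0.ne'
  have hζ := zet_prim m hm
  have hζn : ∀ j : ℕ, ‖zet m ^ j‖ = 1 := fun j => by
    rw [norm_pow, hζ.norm'_eq_one hm, one_pow]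
  have hζm : ∀ j : ℕ, (zet m ^ j) ^ m = 1 := fun j => by
    rw [← pow_mul, mul_comm, pow_mul, hζ.pow_eq_one, one_pow]
  set Ψ : Fin m → ℂ → ℂ := fun j u => zet m ^ (j:ℕ) * psi R m u with hΨ
  have hΨm : ∀ j u, Ψ j u ^ m = 1 + (R:ℂ) * u := fun j u => by
    simp only [hΨ]; rw [mul_pow, hζm, psi_pow hm, one_mul]
  have hinj' : ∀ i j u v, Ψ i u = Ψ j v → u = v := by
    intro i j u v h
    have h1 := hΨm i u
    rw [h, hΨm j v] at h1
    exact (mul_left_cancel₀ hRc (add_left_cancel h1)).symm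
  have hinj : ∀ j, InjOn (Ψ j) (Metric.ball 0 1) := fun j u _ v _ h => hinj' j j u v h
  have hder : ∀ j, ∀ u ∈ Metric.ball (0:ℂ) 1, HasFDerivWithinAt (Ψ j)
      ((ContinuousLinearMap.toSpanSingleton ℂ (zet m ^ (j:ℕ) * dpsi R m u)).restrictScalars ℝ)
      (Metric.ball 0 1) u := by
    intro j u hu
    have h1 : HasDerivAt (Ψ j) (zet m ^ (j:ℕ) * dpsi R m u) u :=
      (psi_deriv hR0 hR1 hu).const_mul _
    exact (h1.hasFDerivAt.restrictScalars ℝ).hasFDerivWithinAt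
  have hms : MeasurableSet (Metric.ball (0:ℂ) 1) := Metric.isOpen_ball.measurableSet
  have hunion : lemniscate r m = ⋃ j : Fin m, Ψ j '' Metric.ball 0 1 := by
    ext z
    simp only [Set.mem_iUnion, Set.mem_image]
    constructor
    · intro hz
      have hz : ‖z ^ m - 1‖ < r ^ m := hz
      set u : ℂ := (z ^ m - 1) / R with hu
      have hub : u ∈ Metric.ball (0:ℂ) 1 := by
        rw [mem_ball_zero_iff, hu, norm_div, Complex.norm_real, Real.norm_of_nonneg hR0.le,
          div_lt_one hR0]
        exact hz
      have hzu : z ^ m = 1 + (R:ℂ) * u := by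
        rw [hu]; field_simp; ring
      have hp0 : psi R m u ≠ 0 := by
        intro h0
        have := psi_pow (R := R) hm u
        rw [h0, zero_pow hm] at this
        exact Complex.slitPlane_ne_zero (one_add_slit hR0 hR1 hub) this.symm
      have : NeZero m := ⟨hm⟩
      obtain ⟨i, hi, hie⟩ := hζ.eq_pow_of_pow_eq_one (ξ := z / psi R m u) (by
        rw [div_pow, psi_pow hm, hzu]
        exact div_self (Complex.slitPlane_ne_zero (one_add_slit hR0 hR1 hub)))
      refine ⟨⟨i, hi⟩, u, hub, ?_⟩
      simp only [hΨ]
      rw [hie]; field_simp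
    · rintro ⟨j, u, hu, rfl⟩
      change ‖Ψ j u ^ m - 1‖ < r ^ m
      rw [hΨm, add_sub_cancel_left, norm_mul, Complex.norm_real, Real.norm_of_nonneg hR0.le]
      exact mul_lt_of_lt_one_right hR0 (mem_ball_zero_iff.mp hu)
  have hdisj : Pairwise (Function.onFun Disjoint fun j : Fin m => Ψ j '' Metric.ball 0 1) := by
    intro i j hij
    rw [Function.onFun, Set.disjoint_left]
    rintro z ⟨u, hu, rfl⟩ ⟨v, hv, hvu⟩
    have := hinj' j i v u hvu
    subst this
    have hp0 : psi R m v ≠ 0 := by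
      intro h0
      have := psi_pow (R := R) hm v
      rw [h0, zero_pow hm] at this
      exact Complex.slitPlane_ne_zero (one_add_slit hR0 hR1 hu) this.symm
    simp only [hΨ] at hvu
    have h2 := mul_right_cancel₀ hp0 hvu
    exact hij (Fin.ext (hζ.pow_inj j.2 i.2 h2)).symm
  have hIm : ∀ j, MeasurableSet (Ψ j '' Metric.ball 0 1) := fun j =>
    measurable_image_of_fderivWithin hms (hder j) (hinj j)
  have hI : IntegrableOn f (lemniscate r m) :=
    (hf.continuousOn.integrableOn_compact (isCompact_closedBall 0 2)).mono_set
      (lem_bdd r hr0 hr1 m hm)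
  have hIj : ∀ j, IntegrableOn f (Ψ j '' Metric.ball 0 1) := fun j =>
    hI.mono_set (by rw [hunion]; exact Set.subset_iUnion (fun j => Ψ j '' Metric.ball 0 1) j)
  have hdet : ∀ (j : Fin m) (u : ℂ), |((ContinuousLinearMap.toSpanSingleton ℂ
      (zet m ^ (j:ℕ) * dpsi R m u)).restrictScalars ℝ : ℂ →L[ℝ] ℂ).det| = ‖dpsi R m u‖ ^ 2 := by
    intro j u
    rw [det_mul, norm_mul, hζn, one_mul, abs_of_nonneg (by positivity)]
  constructor
  · intro j
    have := (integrableOn_image_iff_integrableOn_abs_det_fderiv_smul volume hms (hder j) (hinj j)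
      f).mp (hIj j)
    simpa only [hdet, smul_eq_mul] using this
  · rw [hunion, integral_iUnion_fintype hIm hdisj hIj]
    refine Finset.sum_congr rfl fun j _ => ?_
    rw [integral_image_eq_integral_abs_det_fderiv_smul volume hms (hder j) (hinj j)]
    simp only [hdet, smul_eq_mul, hΨ]

lemma sum_range_blocks (m K : ℕ) (f : ℕ → ℂ) :
    ∑ i ∈ Finset.range (K * m), f i
      = ∑ l ∈ Finset.range K, ∑ t ∈ Finset.range m, f (l * m + t) := by
  induction K with
  | zero => simp
  | succ K ih =>
    rw [Finset.sum_range_succ, ← ih, add_mul, one_mul, Finset.sum_range_add]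

lemma root_orth (m : ℕ) (hm : m ≠ 0) (s t : ℕ) (hs : s < m) (ht : t < m) :
    ∑ j ∈ Finset.range m, ((zet m ^ j)⁻¹) ^ s * (zet m ^ j) ^ t = if t = s then (m:ℂ) else 0 := by
  have hζ := zet_prim m hm
  have h0 : zet m ≠ 0 := hζ.ne_zero hm
  split_ifs with h
  · subst h
    have : ∀ j ∈ Finset.range m, ((zet m ^ j)⁻¹) ^ t * (zet m ^ j) ^ t = 1 := by
      intro j _
      rw [← mul_pow, inv_mul_cancel₀ (pow_ne_zero _ h0), one_pow]
    rw [Finset.sum_congr rfl this]; simp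
  · set w := (zet m ^ s)⁻¹ * zet m ^ t with hw
    have e : ∀ j ∈ Finset.range m, ((zet m ^ j)⁻¹) ^ s * (zet m ^ j) ^ t = w ^ j := by
      intro j _
      rw [hw, mul_pow, inv_pow, inv_pow, ← pow_mul, ← pow_mul, ← pow_mul, ← pow_mul,
        mul_comm j s, mul_comm j t]
    rw [Finset.sum_congr rfl e]
    have hw1 : w ≠ 1 := by
      intro h1
      rw [hw, inv_mul_eq_one₀ (pow_ne_zero _ h0)] at h1
      exact h (hζ.pow_inj hs ht h1).symm
    have hwm : w ^ m = 1 := by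
      rw [hw, mul_pow, inv_pow, ← pow_mul, ← pow_mul, mul_comm s, mul_comm t, pow_mul, pow_mul,
        hζ.pow_eq_one]; simp
    have := geom_sum_mul w m
    rw [hwm, sub_self] at this
    exact (mul_eq_zero.mp this).resolve_right (sub_ne_zero.mpr hw1)

lemma avg_poly (m : ℕ) (hm : m ≠ 0) (s k : ℕ) (hs : s < m) (P : Polynomial ℂ)
    (hP : P.natDegree ≤ k * m + s) (z : ℂ) :
    ∑ j ∈ Finset.range m, ((zet m ^ j)⁻¹) ^ s * P.eval (zet m ^ j * z)
      = m * (z ^ s * ∑ l ∈ Finset.range (k+1), P.coeff (l * m + s) * (z ^ m) ^ l) := by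
  have hζ := zet_prim m hm
  have hlt : P.natDegree < (k + 1) * m := by rw [add_mul]; omega
  have h1 : ∀ j ∈ Finset.range m, ((zet m ^ j)⁻¹) ^ s * P.eval (zet m ^ j * z)
      = ∑ l ∈ Finset.range (k+1), ∑ t ∈ Finset.range m,
        (P.coeff (l * m + t) * z ^ (l * m + t)) * (((zet m ^ j)⁻¹) ^ s * (zet m ^ j) ^ t) := by
    intro j _
    rw [Polynomial.eval_eq_sum_range' hlt, sum_range_blocks, Finset.mul_sum]
    refine Finset.sum_congr rfl fun l _ => ?_
    rw [Finset.mul_sum]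
    refine Finset.sum_congr rfl fun t _ => ?_
    have : (zet m ^ j) ^ (l * m + t) = (zet m ^ j) ^ t := by
      rw [pow_add, mul_comm l m, pow_mul, ← pow_mul _ j m, mul_comm j m, pow_mul _ m j,
        hζ.pow_eq_one]; simp
    rw [mul_pow, this]; ring
  rw [Finset.sum_congr rfl h1, Finset.sum_comm, Finset.mul_sum, Finset.mul_sum]
  refine Finset.sum_congr rfl fun l _ => ?_
  rw [Finset.sum_comm]
  simp only [← Finset.mul_sum]
  rw [Finset.sum_congr rfl (fun t ht => by
    rw [root_orth m hm s t hs (Finset.mem_range.mp ht)])]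
  simp only [mul_ite, mul_zero]
  rw [Finset.sum_ite_eq' (Finset.range m) s, if_pos (Finset.mem_range.mpr hs), pow_add,
    mul_comm l m, pow_mul]
  ring

lemma psi_dpsi {R : ℝ} (hR0 : 0 < R) (hR1 : R < 1) {m : ℕ} (s : ℕ) {u : ℂ}
    (hu : u ∈ Metric.ball (0:ℂ) 1) (α : ℝ) (hα : α = 1 - (1 + s) / m) :
    psi R m u ^ s * dpsi R m u = ((R:ℂ) / m) * (1 + (R:ℂ) * u) ^ (((-α : ℝ)) : ℂ) := by
  unfold psi dpsi
  have h0 := Complex.slitPlane_ne_zero (one_add_slit hR0 hR1 hu)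
  rw [← Complex.cpow_nat_mul, mul_left_comm, ← Complex.cpow_add _ _ h0]
  congr 2
  rw [hα]; push_cast; ring

lemma rchoose_succ (x : ℝ) (n : ℕ) :
    Ring.choose x (n+1) = Ring.choose x n * (x - n) / (n+1) := by
  have h1 := Ring.descPochhammer_eq_factorial_smul_choose x n
  have h2 := Ring.descPochhammer_eq_factorial_smul_choose x (n+1)
  rw [descPochhammer_succ_right, Polynomial.smeval_mul, h1] at h2
  simp [Nat.factorial_succ, Polynomial.smeval_sub, Polynomial.smeval_natCast] at h2
  have : (n.factorial : ℝ) ≠ 0 := by positivity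
  have h3 : ((n:ℝ) + 1) ≠ 0 := by positivity
  field_simp
  apply mul_left_cancel₀ this
  linarith

lemma rchoose_le (x : ℝ) (hx : |x| ≤ 1) (n : ℕ) : |Ring.choose x n| ≤ 1 := by
  induction n with
  | zero => simp
  | succ n ih =>
    rw [rchoose_succ, abs_div, abs_mul, abs_of_pos (by positivity : (0:ℝ) < n+1)]
    rw [div_le_one (by positivity)]
    have : |x - n| ≤ n + 1 := by
      rw [abs_le] at hx ⊢
      have : (0:ℝ) ≤ n := by positivity
      constructor <;> linarith [hx.1, hx.2]
    nlinarith [abs_nonneg (x-n), abs_nonneg (Ring.choose x n)]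

lemma good_binom (α R : ℝ) (h0 : 0 ≤ α) (h1 : α ≤ 1) (hR0 : 0 < R) (hR1 : R < 1) :
    GoodPair (fun n => Ring.choose α n * R ^ n) (fun n => Ring.choose (-α) n * R ^ n)
      (Real.sqrt R) where
  pos := Real.sqrt_pos.2 hR0
  lt := by rw [Real.sqrt_lt' one_pos]; simpa
  ha n := by
    rw [pow_mul, Real.sq_sqrt hR0.le, abs_mul, abs_of_pos (pow_pos hR0 n)]
    exact mul_le_of_le_one_left (by positivity) (rchoose_le _ (by rw [abs_le]; constructor <;> linarith) _)
  hh n := by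
    rw [pow_mul, Real.sq_sqrt hR0.le, abs_mul, abs_of_pos (pow_pos hR0 n)]
    exact mul_le_of_le_one_left (by positivity) (rchoose_le _ (by rw [abs_le]; constructor <;> linarith) _)
  a0 := by simp
  h0 := by simp
  conv n := by
    have h := Ring.add_choose_eq (r := -α) (s := α) n (Commute.all _ _)
    rw [neg_add_cancel, Ring.choose_zero_ite] at h
    have : ∑ p ∈ Finset.HasAntidiagonal.antidiagonal n, (Ring.choose (-α) p.1 * R ^ p.1) * (Ring.choose α p.2 * R ^ p.2)
      = (∑ p ∈ Finset.HasAntidiagonal.antidiagonal n, Ring.choose (-α) p.1 * Ring.choose α p.2) * R ^ n := by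
      rw [Finset.sum_mul]
      apply Finset.sum_congr rfl
      intro p hp
      rw [← Finset.HasAntidiagonal.mem_antidiagonal.1 hp, pow_add]; ring
    rw [this, ← h]
    split_ifs with h
    · simp [h]
    · simp

lemma binom_hasSum (α R : ℝ) (hR0 : 0 < R) (hR1 : R < 1) (u : ℂ) (hu : u ∈ Metric.ball (0:ℂ) 1) :
    HasSum (fun n => ((Ring.choose (-α) n * R ^ n : ℝ) : ℂ) * u ^ n)
      ((1 + (R:ℂ) * u) ^ (((-α : ℝ)) : ℂ)) := by
  have h := (Complex.one_add_cpow_hasFPowerSeriesOnBall_zero (a := ((-α:ℝ):ℂ))).hasSum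
    (y := (R:ℂ) * u) (by
      rw [mem_ball_zero_iff] at hu
      rw [show (1:ENNReal) = ENNReal.ofReal 1 by simp, Metric.eball_ofReal, mem_ball_zero_iff, norm_mul, Complex.norm_real,
        Real.norm_of_nonneg hR0.le]
      nlinarith [norm_nonneg u])
  rw [zero_add] at h
  refine h.congr_fun ?_
  intro n
  rw [binomialSeries_apply, ← Complex.ofReal_choose]
  simp [mul_pow]
  ring

lemma hasSum_shift (h : ℕ → ℝ) (u F : ℂ) (hF : HasSum (fun n => (h n : ℂ) * u ^ n) F) (l : ℕ) :
    HasSum (fun n : ℕ => (Hx h ((n:ℤ) - l) : ℂ) * u ^ n) (u ^ l * F) := by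
  have h1 := hF.mul_left (u ^ l)
  rw [← hasSum_nat_add_iff' l]
  have e : ∑ i ∈ Finset.range l, (Hx h ((i:ℤ) - l) : ℂ) * u ^ i = 0 := by
    apply Finset.sum_eq_zero
    intro i hi
    have : (i:ℤ) - l < 0 := by have := Finset.mem_range.1 hi; omega
    rw [Hx, if_neg (not_le.2 this)]; simp
  rw [e, sub_zero]
  refine h1.congr_fun ?_
  intro n
  have : (((n + l : ℕ) : ℤ) - l) = (n:ℤ) := by push_cast; ring
  rw [this]
  simp [Hx, pow_add]
  ring

lemma poly_hasSum (h : ℕ → ℝ) (u F : ℂ) (hF : HasSum (fun n => (h n : ℂ) * u ^ n) F) (Q : ℕ → ℂ) (k : ℕ) :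
    HasSum (fun n : ℕ => (∑ l ∈ Finset.range (k+1), Q l * (Hx h ((n:ℤ) - l) : ℂ)) * u ^ n)
      ((∑ l ∈ Finset.range (k+1), Q l * u ^ l) * F) := by
  have := hasSum_sum (s := Finset.range (k+1)) (fun l _ => (hasSum_shift h u F hF l).mul_left (Q l))
  simp only [← mul_assoc, ← Finset.sum_mul] at this
  exact this

lemma weighted_parseval (α R : ℝ) (h0 : 0 ≤ α) (h1 : α ≤ 1) (hR0 : 0 < R) (hR1 : R < 1) (Q : ℕ → ℂ) (k : ℕ) :
    ∫ u in Metric.ball (0:ℂ) 1,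
      ‖(∑ l ∈ Finset.range (k+1), Q l * u ^ l) * (1 + (R:ℂ) * u) ^ (((-α : ℝ)) : ℂ)‖ ^ 2
    = Real.pi * ∑' n : ℕ, ‖∑ l ∈ Finset.range (k+1),
      Q l * (Hx (fun n => Ring.choose (-α) n * R ^ n) ((n:ℤ) - l) : ℂ)‖ ^ 2 / ((n:ℝ) + 1) := by
  have g := good_binom α R h0 h1 hR0 hR1
  obtain ⟨C, hC⟩ := g.conv_le Q k
  exact disk_parseval _ C _ g.pos.le g.lt hC _
    (fun u hu => poly_hasSum _ u _ (binom_hasSum α R hR0 hR1 u hu) Q k)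

lemma lem_intble {r : ℝ} (hr0 : 0 < r) (hr1 : r < 1) {m : ℕ} (hm : m ≠ 0) {E : Type*} [NormedAddCommGroup E] (f : ℂ → E)
    (hf : Continuous f) : Integrable f (volume.restrict (lemniscate r m)) := by
  have : IntegrableOn f (Metric.closedBall (0:ℂ) 2) :=
    hf.continuousOn.integrableOn_compact (isCompact_closedBall _ _)
  exact this.mono_set (lem_bdd r hr0 hr1 m hm)

lemma orth_low {r : ℝ} (hr0 : 0 < r) (hr1 : r < 1) {m : ℕ} (hm : m ≠ 0)
    {φ : ℕ → Polynomial ℂ} {κ : ℕ → ℝ}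
    (hON : IsOrthonormalPolys (volume.restrict (lemniscate r m)) φ κ) (n : ℕ) :
    ∀ d ≤ n, ∀ q : Polynomial ℂ, q.degree < d →
      ∫ z in lemniscate r m, q.eval z * conj ((φ n).eval z) = 0 := by
  intro d
  induction d with
  | zero =>
    intro _ q hq
    have : q = 0 := by
      rw [← Polynomial.degree_eq_bot]; exact Nat.WithBot.lt_zero_iff.1 (by simpa using hq)
    simp [this]
  | succ d ih =>
    intro hd q hq
    have hκ : (κ d : ℂ) ≠ 0 := by exact_mod_cast (hON.lead_pos d).ne'
    have hcoef : (φ d).coeff d = κ d := by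
      have := hON.lead_eq d
      rw [Polynomial.leadingCoeff, hON.natDegree_eq] at this
      exact this
    set c : ℂ := q.coeff d / κ d with hc
    have h1 : (q - Polynomial.C c * φ d).degree < (d:ℕ) := by
      rw [Polynomial.degree_lt_iff_coeff_zero]
      intro i hi
      rcases hi.eq_or_lt with h | h
      · subst h
        simp [hcoef, hc, hκ]
      · have e1 : q.coeff i = 0 := by
          apply Polynomial.coeff_eq_zero_of_degree_lt
          refine hq.trans_le ?_
          exact_mod_cast h
        have e2 : (φ d).coeff i = 0 := by
          apply Polynomial.coeff_eq_zero_of_natDegree_lt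
          rw [hON.natDegree_eq]; exact h
        simp [e1, e2]
    have h2 := ih (by omega) _ h1
    have h3 := hON.orthonormal d n
    rw [if_neg (by omega)] at h3
    have e : ∀ z, q.eval z * conj ((φ n).eval z) =
        (q - Polynomial.C c * φ d).eval z * conj ((φ n).eval z)
        + c * ((φ d).eval z * conj ((φ n).eval z)) := by
      intro z; simp; ring
    simp_rw [e]
    rw [integral_add, integral_const_mul, h2, h3]
    · simp
    · exact lem_intble hr0 hr1 hm _ (by fun_prop)
    · exact lem_intble hr0 hr1 hm _ (by fun_prop)

lemma extremal {r : ℝ} (hr0 : 0 < r) (hr1 : r < 1) {m : ℕ} (hm : m ≠ 0)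
    {φ : ℕ → Polynomial ℂ} {κ : ℕ → ℝ}
    (hON : IsOrthonormalPolys (volume.restrict (lemniscate r m)) φ κ) (n : ℕ)
    (p : Polynomial ℂ) (hp : p.natDegree ≤ n) (hpn : p.coeff n = 1) :
    1 / κ n ^ 2 ≤ ∫ z in lemniscate r m, ‖p.eval z‖ ^ 2 := by
  have hk := hON.lead_pos n
  have hκ : (κ n : ℂ) ≠ 0 := by exact_mod_cast hk.ne'
  have hcoef : (φ n).coeff n = κ n := by
    have := hON.lead_eq n
    rw [Polynomial.leadingCoeff, hON.natDegree_eq] at this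
    exact this
  set q : Polynomial ℂ := p - Polynomial.C (1 / (κ n : ℂ)) * φ n with hq
  have h1 : q.degree < (n:ℕ) := by
    rw [Polynomial.degree_lt_iff_coeff_zero]
    intro i hi
    rcases hi.eq_or_lt with h | h
    · subst h
      simp [hq, hcoef, hpn, hκ]
    · have e1 : p.coeff i = 0 := Polynomial.coeff_eq_zero_of_natDegree_lt (by omega)
      have e2 : (φ n).coeff i = 0 := by
        apply Polynomial.coeff_eq_zero_of_natDegree_lt
        rw [hON.natDegree_eq]; exact h
      simp [hq, e1, e2]
  have h2 := orth_low hr0 hr1 hm hON n n le_rfl q h1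
  have h3 := hON.orthonormal n n
  rw [if_pos rfl] at h3
  have hpt : ∀ z, ((1 / (κ n:ℂ) ^ 2) * ((φ n).eval z * conj ((φ n).eval z))
      + (2 / (κ n : ℂ)) * (q.eval z * conj ((φ n).eval z))).re ≤ ‖p.eval z‖ ^ 2 := by
    intro z
    have e : p.eval z = q.eval z + ((1 / κ n : ℝ) : ℂ) * (φ n).eval z := by
      simp [hq]
    rw [e, ← Complex.normSq_eq_norm_sq, Complex.normSq_apply]
    have e1 : (1 / (κ n:ℂ) ^ 2) = (((1 / κ n) ^ 2 : ℝ) : ℂ) := by push_cast; ring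
    have e2 : (2 / (κ n:ℂ)) = ((2 * (1 / κ n) : ℝ) : ℂ) := by push_cast; ring
    rw [e1, e2]
    simp only [Complex.add_re, Complex.add_im, Complex.ofReal_re, Complex.ofReal_im, Complex.mul_re, Complex.mul_im, Complex.conj_re, Complex.conj_im]
    generalize 1 / κ n = t
    nlinarith [sq_nonneg (q.eval z).re, sq_nonneg (q.eval z).im]
  have hi : Integrable (fun z => (1 / (κ n:ℂ) ^ 2) * ((φ n).eval z * conj ((φ n).eval z))
      + (2 / (κ n : ℂ)) * (q.eval z * conj ((φ n).eval z))) (volume.restrict (lemniscate r m)) :=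
    lem_intble hr0 hr1 hm _ (by fun_prop)
  have hval : ∫ z in lemniscate r m, ((1 / (κ n:ℂ) ^ 2) * ((φ n).eval z * conj ((φ n).eval z))
      + (2 / (κ n : ℂ)) * (q.eval z * conj ((φ n).eval z))) = 1 / (κ n : ℂ) ^ 2 := by
    rw [integral_add, integral_const_mul, integral_const_mul, h2, h3]
    · simp
    · exact lem_intble hr0 hr1 hm _ (by fun_prop)
    · exact lem_intble hr0 hr1 hm _ (by fun_prop)
  have hre := integral_re hi
  have : (1 / (κ n : ℂ) ^ 2).re = 1 / κ n ^ 2 := by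
    rw [show (1 / (κ n:ℂ) ^ 2) = ((1 / κ n ^ 2 : ℝ) : ℂ) by push_cast; ring, Complex.ofReal_re]
  rw [hval] at hre
  rw [← this]
  change _ = (1 / (κ n : ℂ) ^ 2).re at hre
  rw [← hre]
  exact integral_mono hi.re (lem_intble hr0 hr1 hm _ (by fun_prop)) hpt

lemma op_norm_one {r : ℝ} {m : ℕ}
    {φ : ℕ → Polynomial ℂ} {κ : ℕ → ℝ}
    (hON : IsOrthonormalPolys (volume.restrict (lemniscate r m)) φ κ) (n : ℕ) :
    ∫ z in lemniscate r m, ‖(φ n).eval z‖ ^ 2 = 1 := by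
  have h3 := hON.orthonormal n n
  rw [if_pos rfl] at h3
  have e : ∀ z, (φ n).eval z * conj ((φ n).eval z) = ((‖(φ n).eval z‖ ^ 2 : ℝ) : ℂ) := by
    intro z; rw [Complex.mul_conj, Complex.normSq_eq_norm_sq]
  simp_rw [e] at h3
  rw [integral_complex_ofReal] at h3
  exact_mod_cast h3

lemma upper_key {r : ℝ} (hr0 : 0 < r) (hr1 : r < 1) {m : ℕ} (hm : m ≠ 0) (s k : ℕ) (hs : s < m)
    (α : ℝ) (hα : α = 1 - (1 + s) / m) (h0 : 0 ≤ α) (h1 : α ≤ 1)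
    (P : Polynomial ℂ) (hP : P.natDegree ≤ k * m + s) :
    ∃ Q : ℕ → ℂ, Q k = P.coeff (k * m + s) * ((r ^ m : ℝ) : ℂ) ^ k ∧
      (r ^ m) ^ 2 * (Real.pi * ∑' n : ℕ, ‖∑ l ∈ Finset.range (k+1),
      Q l * (Hx (fun n => Ring.choose (-α) n * (r ^ m) ^ n) ((n:ℤ) - l) : ℂ)‖ ^ 2 / ((n:ℝ) + 1))
      ≤ m * ∫ z in lemniscate r m, ‖P.eval z‖ ^ 2 := by
  have hR0 : 0 < r ^ m := by positivity
  have hR1 : r ^ m < 1 := pow_lt_one₀ hr0.le hr1 hm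
  obtain ⟨hI, hE⟩ := lem_integral r hr0 hr1 m hm (fun z => ‖P.eval z‖ ^ 2) (by fun_prop)
  generalize hRdef : r ^ m = R at *
  set L : Polynomial ℂ := Polynomial.C (R:ℂ) * Polynomial.X + Polynomial.C 1 with hL
  have hLd : L.natDegree ≤ 1 := Polynomial.natDegree_linear_le
  set qp : Polynomial ℂ := ∑ l ∈ Finset.range (k+1), Polynomial.C (P.coeff (l * m + s)) * L ^ l with hqp
  have hLpd : ∀ l, (L ^ l).natDegree ≤ l := fun l => by
    simpa using Polynomial.natDegree_pow_le_of_le l hLd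
  have hqd : qp.natDegree ≤ k := by
    apply Polynomial.natDegree_sum_le_of_forall_le
    intro l hl
    refine (Polynomial.natDegree_C_mul_le _ _).trans ((hLpd l).trans ?_)
    have := Finset.mem_range.1 hl; omega
  have hqe : ∀ u : ℂ, ∑ l ∈ Finset.range (k+1), P.coeff (l * m + s) * (1 + (R:ℂ) * u) ^ l
      = ∑ l ∈ Finset.range (k+1), qp.coeff l * u ^ l := by
    intro u
    rw [← Polynomial.eval_eq_sum_range' (by omega : qp.natDegree < k+1), hqp, Polynomial.eval_finsetSum]
    simp [hL, add_comm]
  refine ⟨fun l => qp.coeff l, ?_, ?_⟩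
  · have hRL : (L ^ k).coeff k = (R:ℂ) ^ k := by
      have := Polynomial.coeff_pow_of_natDegree_le (n := 1) (m := k) hLd
      rw [mul_one] at this
      rw [this, hL]
      simp [Polynomial.coeff_one]
    simp only [hqp, Polynomial.finsetSum_coeff, Polynomial.coeff_C_mul]
    rw [Finset.sum_range_succ, hRL, Finset.sum_eq_zero, zero_add]
    intro l hl
    rw [Polynomial.coeff_eq_zero_of_natDegree_lt (p := L ^ l), mul_zero]
    exact (hLpd l).trans_lt (Finset.mem_range.1 hl)
  · rw [← weighted_parseval α R h0 h1 hR0 hR1, ← integral_const_mul, hE,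
      ← integral_finsetSum _ (fun j _ => hI j), ← integral_const_mul]
    apply integral_mono_of_nonneg
    · exact Eventually.of_forall fun u => by positivity
    · exact (integrable_finsetSum _ (fun j _ => hI j)).const_mul _
    · refine (ae_restrict_iff' measurableSet_ball).2 (Eventually.of_forall fun u hu => ?_)
      have ha := avg_poly m hm s k hs P hP (psi R m u)
      rw [psi_pow hm, hqe] at ha
      have hd := psi_dpsi hR0 hR1 (m := m) s hu α hα
      have hm' : (m:ℂ) ≠ 0 := by exact_mod_cast hm
      have key : (R:ℂ) * ((∑ l ∈ Finset.range (k+1), qp.coeff l * u ^ l) * (1 + (R:ℂ) * u) ^ (((-α : ℝ)) : ℂ))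
          = ∑ j ∈ Finset.range m, ((zet m ^ j)⁻¹) ^ s * P.eval (zet m ^ j * psi R m u) * dpsi R m u := by
        rw [← Finset.sum_mul, ha]
        have : (R:ℂ) * (1 + (R:ℂ) * u) ^ (((-α : ℝ)) : ℂ) = m * (psi R m u ^ s * dpsi R m u) := by
          rw [hd]; field_simp
        linear_combination (∑ l ∈ Finset.range (k+1), qp.coeff l * u ^ l) * this
      have hz : ‖zet m‖ = 1 := (zet_prim m hm).norm'_eq_one hm
      have hn : R * ‖((∑ l ∈ Finset.range (k+1), qp.coeff l * u ^ l) * (1 + (R:ℂ) * u) ^ (((-α : ℝ)) : ℂ))‖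
          ≤ ∑ j ∈ Finset.range m, ‖P.eval (zet m ^ j * psi R m u)‖ * ‖dpsi R m u‖ := by
        have e : R * ‖((∑ l ∈ Finset.range (k+1), qp.coeff l * u ^ l) * (1 + (R:ℂ) * u) ^ (((-α : ℝ)) : ℂ))‖
          = ‖(R:ℂ) * ((∑ l ∈ Finset.range (k+1), qp.coeff l * u ^ l) * (1 + (R:ℂ) * u) ^ (((-α : ℝ)) : ℂ))‖ := by
          rw [norm_mul (R:ℂ), Complex.norm_real, Real.norm_of_nonneg hR0.le]
        rw [e, key]
        refine (norm_sum_le _ _).trans (Finset.sum_le_sum fun j _ => ?_)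
        simp [hz]
      have hcs := sq_sum_le_card_mul_sum_sq (s := Finset.range m)
        (f := fun j => ‖P.eval (zet m ^ j * psi R m u)‖ * ‖dpsi R m u‖)
      have hsq := pow_le_pow_left₀ (by positivity) hn 2
      rw [mul_pow] at hsq
      refine hsq.trans (hcs.trans_eq ?_)
      rw [Finset.card_range, Finset.sum_range]
      congr 1
      apply Finset.sum_congr rfl
      intro j _
      rw [mul_pow, mul_comm]

lemma lower_key {r : ℝ} (hr0 : 0 < r) (hr1 : r < 1) {m : ℕ} (hm : m ≠ 0) (s k : ℕ)
    (α : ℝ) (hα : α = 1 - (1 + s) / m) (h0 : 0 ≤ α) (h1 : α ≤ 1) (a : ℕ → ℝ) (ha0 : a 0 = 1) :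
    ∃ p : Polynomial ℂ, p.natDegree ≤ k * m + s ∧ p.coeff (k * m + s) = 1 ∧
      ∫ z in lemniscate r m, ‖p.eval z‖ ^ 2 =
       (r ^ m) ^ (2 * k + 2) / m * (Real.pi * ∑' n : ℕ, (∑ l ∈ Finset.range (k+1),
      a (k - l) * Hx (fun n => Ring.choose (-α) n * (r ^ m) ^ n) ((n:ℤ) - l)) ^ 2 / ((n:ℝ) + 1)) := by
  have hR0 : 0 < r ^ m := by positivity
  have hR1 : r ^ m < 1 := pow_lt_one₀ hr0.le hr1 hm
  have hI := fun p : Polynomial ℂ => (lem_integral r hr0 hr1 m hm (fun z => ‖p.eval z‖ ^ 2) (by fun_prop)).2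
  generalize hRdef : r ^ m = R at *
  set L : Polynomial ℂ := Polynomial.X ^ m - Polynomial.C 1 with hL
  have hLm : L.Monic := Polynomial.monic_X_pow_sub_C _ hm
  have hLd : L.natDegree = m := Polynomial.natDegree_X_pow_sub_C
  have hLpd : ∀ l, (L ^ l).natDegree = l * m := fun l => by rw [hLm.natDegree_pow, hLd]
  set q : Polynomial ℂ := ∑ l ∈ Finset.range (k+1), Polynomial.C ((a (k-l) * R ^ (k-l) : ℝ) : ℂ) * L ^ l with hq
  have hqd : q.natDegree ≤ k * m := by
    apply Polynomial.natDegree_sum_le_of_forall_le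
    intro l hl
    refine (Polynomial.natDegree_C_mul_le _ _).trans ((hLpd l).le.trans ?_)
    have := Finset.mem_range.1 hl
    exact Nat.mul_le_mul_right _ (by omega)
  have hqk : q.coeff (k * m) = 1 := by
    simp only [hq, Polynomial.finsetSum_coeff, Polynomial.coeff_C_mul]
    rw [Finset.sum_range_succ, Finset.sum_eq_zero, zero_add]
    · have := (hLm.pow k).coeff_natDegree
      rw [hLpd] at this
      rw [this]; simp [ha0]
    · intro l hl
      rw [Polynomial.coeff_eq_zero_of_natDegree_lt, mul_zero]
      rw [hLpd]
      exact Nat.mul_lt_mul_of_pos_right (Finset.mem_range.1 hl) (by omega)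
  refine ⟨Polynomial.X ^ s * q, ?_, ?_, ?_⟩
  · refine Polynomial.natDegree_mul_le.trans ?_
    rw [Polynomial.natDegree_X_pow]; omega
  · rw [Polynomial.coeff_X_pow_mul, hqk]
  · rw [hI]
    have hz : ‖zet m‖ = 1 := (zet_prim m hm).norm'_eq_one hm
    have hm' : (m:ℝ) ≠ 0 := by exact_mod_cast hm
    have e : ∀ j : Fin m, ∫ u in Metric.ball (0:ℂ) 1, ‖dpsi R m u‖ ^ 2 *
        ‖(Polynomial.X ^ s * q).eval (zet m ^ (j:ℕ) * psi R m u)‖ ^ 2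
        = (R ^ (k+1) / m) ^ 2 * (Real.pi * ∑' n : ℕ, (∑ l ∈ Finset.range (k+1),
      a (k - l) * Hx (fun n => Ring.choose (-α) n * R ^ n) ((n:ℤ) - l)) ^ 2 / ((n:ℝ) + 1)) := by
      intro j
      have hw := weighted_parseval α R h0 h1 hR0 hR1 (fun l => (a (k-l) : ℂ)) k
      have e2 : ∀ n : ℕ, ‖∑ l ∈ Finset.range (k+1),
        (a (k-l) : ℂ) * (Hx (fun n => Ring.choose (-α) n * R ^ n) ((n:ℤ) - l) : ℂ)‖ ^ 2
        = (∑ l ∈ Finset.range (k+1),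
          a (k - l) * Hx (fun n => Ring.choose (-α) n * R ^ n) ((n:ℤ) - l)) ^ 2 := by
        intro n
        rw [← sq_abs (∑ l ∈ Finset.range (k+1), _), ← Real.norm_eq_abs, ← Complex.norm_real]
        push_cast
        rfl
      simp only [e2] at hw
      rw [← hw, ← integral_const_mul]
      apply setIntegral_congr_fun measurableSet_ball
      intro u hu
      have hd := psi_dpsi hR0 hR1 (m := m) s hu α hα
      have hzj : (zet m ^ (j:ℕ)) ^ m = 1 := by
        rw [← pow_mul, mul_comm, pow_mul, (zet_prim m hm).pow_eq_one, one_pow]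
      have hqv : q.eval (zet m ^ (j:ℕ) * psi R m u) = (R:ℂ) ^ k * ∑ l ∈ Finset.range (k+1), (a (k-l) : ℂ) * u ^ l := by
        rw [hq, Polynomial.eval_finsetSum, Finset.mul_sum]
        apply Finset.sum_congr rfl
        intro l hl
        have : l ≤ k := by have := Finset.mem_range.1 hl; omega
        simp only [hL, Polynomial.eval_mul, Polynomial.eval_C, Polynomial.eval_pow, Polynomial.eval_sub,
          Polynomial.eval_X, mul_pow, hzj, psi_pow hm]
        rw [show (R:ℂ) ^ k = (R:ℂ) ^ (k-l) * (R:ℂ) ^ l by rw [← pow_add]; congr 1; omega]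
        push_cast
        ring
      change ‖dpsi R m u‖ ^ 2 * ‖(Polynomial.X ^ s * q).eval (zet m ^ (j:ℕ) * psi R m u)‖ ^ 2
        = (R ^ (k+1) / m) ^ 2 * ‖(∑ l ∈ Finset.range (k+1), (a (k-l) : ℂ) * u ^ l) * (1 + (R:ℂ) * u) ^ (((-α : ℝ)) : ℂ)‖ ^ 2
      rw [Polynomial.eval_mul, hqv]
      rw [← mul_pow, ← mul_pow]
      congr 1
      have hn := congrArg norm hd
      simp only [norm_mul, norm_pow, norm_div, Complex.norm_real, Complex.norm_natCast,
        Real.norm_of_nonneg hR0.le, Polynomial.eval_pow, Polynomial.eval_X, hz, one_pow, one_mul] at hn ⊢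
      generalize ‖∑ l ∈ Finset.range (k+1), (a (k-l) : ℂ) * u ^ l‖ = A at *
      rw [pow_succ]
      linear_combination (R ^ k * A) * hn
    simp_rw [e]
    rw [Finset.sum_const, Finset.card_univ, Fintype.card_fin, nsmul_eq_mul]
    field_simp
    ring

lemma final_bound {κ2 M C D α k T : ℝ} (hk : 1 ≤ k) (hM : 0 < M) (hC : 0 ≤ C) (hD : 0 ≤ D)
    (h0 : 0 ≤ α) (h1 : α ≤ 1) (hκ : 0 ≤ κ2)
    (hT : T = M * ((k + 1 - α) * (1 + α / k)))
    (hu : κ2 ≤ M * (k + 1 + C / (k + 1))) (hl : M * (k + 1) ≤ κ2 * (1 + D / (k + 1) ^ 2)) :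
    |κ2 - T| ≤ (C + D + 1) * |T / k ^ 2| := by
  have hk0 : 0 < k := by linarith
  have hT2 : T = M * (k + 1 + α * (1 - α) / k) := by rw [hT]; field_simp; ring
  have hl2 : M * (k + 1 - D / (k + 1)) ≤ κ2 := by
    by_cases hx : 1 ≤ D / (k + 1) ^ 2
    · have : k + 1 - D / (k + 1) ≤ 0 := by
        have e : D / (k + 1) = (k + 1) * (D / (k + 1) ^ 2) := by field_simp
        rw [e]; nlinarith
      nlinarith
    · push Not at hx
      have hx0 : 0 ≤ D / (k + 1) ^ 2 := by positivity
      have e : k + 1 - D / (k + 1) = (k + 1) * (1 - D / (k + 1) ^ 2) := by field_simp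
      rw [e]
      generalize D / (k + 1) ^ 2 = x at *
      have := mul_le_mul_of_nonneg_right hl (by linarith : 0 ≤ 1 - x)
      nlinarith [mul_nonneg hκ (sq_nonneg x)]
  have hC1 : C / (k + 1) ≤ C / k := by gcongr; linarith
  have hD1 : D / (k + 1) ≤ D / k := by gcongr; linarith
  have ha1 : α * (1 - α) / k ≤ 1 / k := by gcongr; nlinarith
  have ha0 : 0 ≤ α * (1 - α) / k := by
    have : 0 ≤ 1 - α := by linarith
    positivity
  have hA : |κ2 - T| ≤ M * ((C + D + 1) / k) := by
    have e : (C + D + 1) / k = C / k + D / k + 1 / k := by ring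
    have c0 : 0 ≤ C / k := by positivity
    have d0 : 0 ≤ D / k := by positivity
    have i0 : 0 ≤ 1 / k := by positivity
    rw [abs_le, hT2, e]
    constructor <;> nlinarith
  have hTk : M / k ≤ T / k ^ 2 := by
    rw [hT2, div_le_div_iff₀ hk0 (by positivity)]
    have : k ≤ k + 1 + α * (1 - α) / k := by linarith
    have := mul_le_mul_of_nonneg_left this (by positivity : 0 ≤ M * k)
    nlinarith
  refine hA.trans ?_
  have : M * ((C + D + 1) / k) = (C + D + 1) * (M / k) := by ring
  rw [this]
  exact mul_le_mul_of_nonneg_left (hTk.trans (le_abs_self _)) (by positivity)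

/-- **Proposition 3.4.** Asymptotics of the leading coefficients of the orthonormal
polynomials of area measure on the lemniscate `G_{r,m}`. -/
theorem statement_16
    (r : ℝ) (hr0 : 0 < r) (hr1 : r < 1) (m : ℕ) (hm : 2 ≤ m)
    (s : ℕ) (hs : s ≤ m - 2) (v : ℝ) (hv : v = 2 - 2 / (m:ℝ) - 2 * (s:ℝ) / (m:ℝ))
    (φ : ℕ → Polynomial ℂ) (κ : ℕ → ℝ)
    (hON : IsOrthonormalPolys (volume.restrict (lemniscate r m)) φ κ) :
    (fun k : ℕ => κ (k * m + s) ^ 2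
        - ((m:ℝ) * k + 1 + s) * (1 + v / (2 * (k:ℝ))) / (Real.pi * r ^ (2 * k * m + 2 * m)))
      =O[atTop]
    (fun k : ℕ =>
      ((m:ℝ) * k + 1 + s) * (1 + v / (2 * (k:ℝ)))
        / (Real.pi * r ^ (2 * k * m + 2 * m)) / (k:ℝ) ^ 2) := by
  have hm0 : m ≠ 0 := by omega
  have hsm : s < m := by omega
  have hmR : (0:ℝ) < m := by positivity
  have hR0 : 0 < r ^ m := by positivity
  have hR1 : r ^ m < 1 := pow_lt_one₀ hr0.le hr1 hm0
  obtain ⟨α, hα⟩ : ∃ α : ℝ, α = 1 - (1 + s) / m := ⟨_, rfl⟩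
  have h1 : α ≤ 1 := by
    have : (0:ℝ) ≤ (1 + s) / m := by positivity
    linarith
  have h0 : 0 ≤ α := by
    have : ((1:ℝ) + s) / m ≤ 1 := by
      rw [div_le_one hmR]
      have : 1 + s ≤ m := by omega
      exact_mod_cast this
    linarith
  have g := good_binom α (r ^ m) h0 h1 hR0 hR1
  obtain ⟨C, hC, hcore1⟩ := g.core1
  obtain ⟨D, hD, hcore2⟩ := g.core2
  apply Asymptotics.IsBigO.of_bound (C + D + 1)
  filter_upwards [eventually_ge_atTop 1] with k hk
  rw [Real.norm_eq_abs, Real.norm_eq_abs]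
  have hk1 : (1:ℝ) ≤ k := by exact_mod_cast hk
  have hkp := hON.lead_pos (k * m + s)
  have hcoef : (φ (k * m + s)).coeff (k * m + s) = κ (k * m + s) := by
    have := hON.lead_eq (k * m + s)
    rw [Polynomial.leadingCoeff, hON.natDegree_eq] at this
    exact this
  have hu : κ (k * m + s) ^ 2 ≤ (m / (Real.pi * (r ^ m) ^ (2 * k + 2))) * (k + 1 + C / (k + 1)) := by
    obtain ⟨Q, hQ, hle⟩ := upper_key hr0 hr1 hm0 s k hsm α hα h0 h1 (φ (k * m + s))
      (hON.natDegree_eq _).le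
    rw [op_norm_one hON, mul_one] at hle
    have hc := hcore1 k Q
    rw [hQ, hcoef, norm_mul, norm_pow, Complex.norm_real, Complex.norm_real,
      Real.norm_of_nonneg hkp.le, Real.norm_of_nonneg hR0.le] at hc
    generalize (∑' n : ℕ, ‖∑ l ∈ Finset.range (k+1),
      Q l * (Hx (fun n => Ring.choose (-α) n * (r ^ m) ^ n) ((n:ℤ) - l) : ℂ)‖ ^ 2 / ((n:ℝ) + 1)) = S at *
    generalize r ^ m = R at *
    have hpi := Real.pi_pos
    rw [div_mul_eq_mul_div, le_div_iff₀ (by positivity)]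
    have hb : (0:ℝ) ≤ k + 1 + C / (k + 1) := by positivity
    have e : κ (k * m + s) ^ 2 * (Real.pi * R ^ (2 * k + 2))
        = (κ (k * m + s) * R ^ k) ^ 2 * (Real.pi * R ^ 2) := by ring
    rw [e]
    calc _ ≤ ((k + 1 + C / (k + 1)) * S) * (Real.pi * R ^ 2) :=
          mul_le_mul_of_nonneg_right hc (by positivity)
      _ = (k + 1 + C / (k + 1)) * (R ^ 2 * (Real.pi * S)) := by ring
      _ ≤ (k + 1 + C / (k + 1)) * m := mul_le_mul_of_nonneg_left hle hb
      _ = _ := by ring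
  have hl : (m / (Real.pi * (r ^ m) ^ (2 * k + 2))) * (k + 1)
      ≤ κ (k * m + s) ^ 2 * (1 + D / ((k:ℝ) + 1) ^ 2) := by
    obtain ⟨p, hpd, hpc, hpi⟩ := lower_key hr0 hr1 hm0 s k α hα h0 h1
      (fun n => Ring.choose α n * (r ^ m) ^ n) (by simp)
    have he := extremal hr0 hr1 hm0 hON (k * m + s) p hpd hpc
    rw [hpi] at he
    have hc := hcore2 k
    generalize (∑' n : ℕ, (∑ l ∈ Finset.range (k+1),
      Ring.choose α (k - l) * (r ^ m) ^ (k - l) * Hx (fun n => Ring.choose (-α) n * (r ^ m) ^ n) ((n:ℤ) - l)) ^ 2 / ((n:ℝ) + 1)) = S at *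
    generalize r ^ m = R at *
    have hpi := Real.pi_pos
    have h2 := he.trans (mul_le_mul_of_nonneg_left (mul_le_mul_of_nonneg_left hc hpi.le)
      (by positivity : 0 ≤ R ^ (2 * k + 2) / (m:ℝ)))
    generalize hX : 1 + D / ((k:ℝ) + 1) ^ 2 = X at *
    rw [div_mul_eq_mul_div, div_le_iff₀ (by positivity)]
    rw [div_le_iff₀ (by positivity)] at h2
    have h3 := mul_le_mul_of_nonneg_left h2 (by positivity : 0 ≤ (m:ℝ) * (k + 1))
    rw [mul_one] at h3
    refine h3.trans_eq ?_
    field_simp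
  refine final_bound hk1 (M := m / (Real.pi * (r ^ m) ^ (2 * k + 2))) (by positivity) hC hD h0 h1 (by positivity) ?_ hu hl
  have hv2 : v = 2 * α := by rw [hv, hα]; field_simp; ring
  have hms : (m:ℝ) * k + 1 + s = m * (k + 1 - α) := by rw [hα]; field_simp; ring
  rw [hms, hv2, show r ^ (2 * k * m + 2 * m) = (r ^ m) ^ (2 * k + 2) by rw [← pow_mul]; congr 1; ring]
  have : (k:ℝ) ≠ 0 := by positivity
  field_simp
end
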